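/- Fix T > 0. For each n ∈ ℕ let A^n : [0,T] → ℝ^{n×n} be measurable and bounded with A^n_{jk}(t) = A^n_{kj}(t) ≥ 0 for all j,k and a.e. t, and let W_{G_n}(t,·,·) denote the associated step graphon. Assume there is W ∈ L¹([0,T]×[0,1]²;ℝ) with W(t,x,y) = W(t,y,x) a.e. such that ∫₀^T ‖W_{G_n}(t,·,·) − W(t,·,·)‖_□ dt → 0 as n → ∞, and assume that either there is K₀ > 0 with ‖W_{G_n}‖_{L²([0,T]×[0,1]²)} ≤ K₀ for every n, or there is K₁ > 0 with esssup_{t∈[0,T], x∈[0,1]} ∫₀¹ W_{G_n}(t,x,y) dy ≤ K₁ for every n. For each n let β^n_k, γ^n_j : [0,T] → ℝ be measurable, and assume the associated step functions β^n, γ^n satisfy 0 ≤ β^n, γ^n ≤ M a.e. on [0,T]×[0,1] for some M > 0, and β^n → β, γ^n → γ strongly in L¹([0,T]×[0,1]) for some β, γ ∈ L^∞([0,T]×[0,1]). Let (s^n, i^n, r^n) be the step-function form of the solution of the graph SIR system with coefficients β^n_k, γ^n_j, A^n_{jk} and initial data satisfying 0 ≤ s^n_{j,0}, i^n_{j,0},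 r^n_{j,0} ≤ 1 and s^n_{j,0} + i^n_{j,0} + r^n_{j,0} = 1 for every j. Then there exist a strictly increasing sequence (n_m)_m, functions s₀, i₀, r₀ ∈ L^∞([0,1]) with 0 ≤ s₀, i₀, r₀ ≤ 1 and s₀ + i₀ + r₀ = 1 a.e., and a distributional solution (s,i,r) : [0,T]×[0,1] → [0,1]³ of the continuum SIR system with kernel W and initial data (s₀,i₀,r₀), satisfying 0 ≤ s, i, r ≤ 1 and s + i + r = 1 a.e., such that s^{n_m} → s, i^{n_m} → i and r^{n_m} → r weakly* in L^∞([0,T]×[0,1]) as m → ∞. -/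

import Mathlib

open MeasureTheory Real Filter Set

noncomputable section

/-- The subinterval `I^n_j = (j/n, (j+1)/n)` of `(0,1)`, for `j : Fin n`
(corresponding to `((j-1)/n, j/n)` in one-based indexing). -/
def Inj (n : ℕ) (j : Fin n) : Set ℝ := Set.Ioo ((j : ℝ) / n) (((j : ℝ) + 1) / n)

/-- Step function on `[0,1]` associated with a vector `v : Fin n → ℝ`. -/
def stepFn (n : ℕ) (v : Fin n → ℝ) (x : ℝ) : ℝ :=
  ∑ j : Fin n, Set.indicator (Inj n j) (fun _ => v j) x

/-- Step kernel (step graphon) on `[0,1]²` associated with a matrix. -/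
def stepKer (n : ℕ) (A : Fin n → Fin n → ℝ) (x y : ℝ) : ℝ :=
  ∑ j : Fin n, ∑ k : Fin n,
    Set.indicator (Inj n j) (fun _ => Set.indicator (Inj n k) (fun _ => A j k) y) x

/-- Average `⟨u⟩_{I^n_j} = n ∫_{I^n_j} u`. -/
def avg1 (n : ℕ) (j : Fin n) (u : ℝ → ℝ) : ℝ := (n : ℝ) * ∫ x in Inj n j, u x

/-- Average `⟨U⟩_{I^n_j × I^n_k} = n² ∬_{I^n_j × I^n_k} U`. -/
def avg2 (n : ℕ) (j k : Fin n) (U : ℝ → ℝ → ℝ) : ℝ :=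
  (n : ℝ) ^ 2 * ∫ x in Inj n j, ∫ y in Inj n k, U x y

/-- Carathéodory (integral-form) solutions of the graph SIR system on a time set `J`. -/
def IsGraphSIRSol (n : ℕ) (J : Set ℝ) (β γ : Fin n → ℝ → ℝ)
    (A : Fin n → Fin n → ℝ → ℝ) (s i r : Fin n → ℝ → ℝ) : Prop :=
  (∀ j : Fin n, ContinuousOn (s j) J ∧ ContinuousOn (i j) J ∧ ContinuousOn (r j) J) ∧
  ∀ j : Fin n, ∀ t ∈ J,
    (s j t = s j 0 - ∫ τ in (0:ℝ)..t,
        s j τ * (1 / (n : ℝ) * ∑ k : Fin n, β k τ * A j k τ * i k τ)) ∧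
    (i j t = i j 0 + ∫ τ in (0:ℝ)..t,
        (s j τ * (1 / (n : ℝ) * ∑ k : Fin n, β k τ * A j k τ * i k τ) - γ j τ * i j τ)) ∧
    (r j t = r j 0 + ∫ τ in (0:ℝ)..t, γ j τ * i j τ)

/-- Smooth test functions on `[0,T) × [0,1]` (vanishing for `t` close to `T`). -/
def IsTest (T : ℝ) (φ : ℝ → ℝ → ℝ) : Prop :=
  ContDiff ℝ (⊤ : ℕ∞) (fun p : ℝ × ℝ => φ p.1 p.2) ∧ ∃ T' : ℝ, T' < T ∧ ∀ t x : ℝ, T' ≤ t → φ t x = 0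

/-- Distributional solutions of the continuum SIR system on `[0,T] × [0,1]`
with kernel `W`, coefficients `β, γ` and initial data `(s₀, i₀, r₀)`. -/
def IsDistribSol (T : ℝ) (W : ℝ → ℝ → ℝ → ℝ) (β γ : ℝ → ℝ → ℝ)
    (s0 i0 r0 : ℝ → ℝ) (s i r : ℝ → ℝ → ℝ) : Prop :=
  Measurable (fun p : ℝ × ℝ => s p.1 p.2) ∧
  Measurable (fun p : ℝ × ℝ => i p.1 p.2) ∧
  Measurable (fun p : ℝ × ℝ => r p.1 p.2) ∧
  (∀ φ : ℝ → ℝ → ℝ, IsTest T φ →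
    (∫ t in Set.Icc (0:ℝ) T, ∫ x in Set.Icc (0:ℝ) 1,
        s t x * (deriv (fun τ => φ τ x) t
          - φ t x * ∫ y in Set.Icc (0:ℝ) 1, β t y * W t x y * i t y))
      + (∫ x in Set.Icc (0:ℝ) 1, s0 x * φ 0 x) = 0) ∧
  (∀ ψ : ℝ → ℝ → ℝ, IsTest T ψ →
    (∫ t in Set.Icc (0:ℝ) T, ∫ x in Set.Icc (0:ℝ) 1,
        (i t x * (deriv (fun τ => ψ τ x) t - γ t x * ψ t x)
          + s t x * ψ t x * ∫ y in Set.Icc (0:ℝ) 1, β t y * W t x y * i t y))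
      + (∫ x in Set.Icc (0:ℝ) 1, i0 x * ψ 0 x) = 0) ∧
  (∀ η : ℝ → ℝ → ℝ, IsTest T η →
    (∫ t in Set.Icc (0:ℝ) T, ∫ x in Set.Icc (0:ℝ) 1,
        (r t x * deriv (fun τ => η τ x) t + γ t x * η t x * i t x))
      + (∫ x in Set.Icc (0:ℝ) 1, r0 x * η 0 x) = 0)

/-- The cut norm of a kernel on `[0,1]²`. -/
def cutNorm (U : ℝ → ℝ → ℝ) : ℝ :=
  sSup { c : ℝ | ∃ S T : Set ℝ, MeasurableSet S ∧ MeasurableSet T ∧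
    S ⊆ Set.Icc 0 1 ∧ T ⊆ Set.Icc 0 1 ∧ c = |∫ x in S, ∫ y in T, U x y| }

/-- `L²(0,1)` distance. -/
def L2dist (f g : ℝ → ℝ) : ℝ := Real.sqrt (∫ x in Set.Icc (0:ℝ) 1, (f x - g x) ^ 2)

/-- `L¹(0,1)` distance. -/
def L1dist (f g : ℝ → ℝ) : ℝ := ∫ x in Set.Icc (0:ℝ) 1, |f x - g x|


section
lemma bdd_int {X : Type*} [MeasurableSpace X] {μ : Measure X} [IsFiniteMeasure μ] {Q : X → ℝ}
    {C : ℝ} (hm : Measurable Q) (hb : ∀ x, |Q x| ≤ C) : Integrable Q μ :=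
  Integrable.of_bound hm.aestronglyMeasurable C (Eventually.of_forall hb)

lemma bdd_mul_int {X : Type*} [MeasurableSpace X] {μ : Measure X} {Q g : X → ℝ}
    {C : ℝ} (hm : Measurable Q) (hb : ∀ x, |Q x| ≤ C) (hg : Integrable g μ) :
    Integrable (fun x => Q x * g x) μ :=
  hg.bdd_mul hm.aestronglyMeasurable (Eventually.of_forall hb)

lemma bdd_int_le {X : Type*} [MeasurableSpace X] {μ : Measure X} {Q g : X → ℝ}
    {C : ℝ} (hb : ∀ x, |Q x| ≤ C) (hg : Integrable g μ) :
    |∫ x, Q x * g x ∂μ| ≤ C * ∫ x, |g x| ∂μ := by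
  rw [← integral_const_mul, ← Real.norm_eq_abs]
  refine norm_integral_le_of_norm_le (hg.abs.const_mul C) (Eventually.of_forall fun x => ?_)
  rw [norm_mul]
  exact mul_le_mul_of_nonneg_right (hb x) (abs_nonneg _)

lemma weak_ext {X : Type*} [MeasurableSpace X] (μ : Measure X) [IsFiniteMeasure μ]
    (Q : ℕ → X → ℝ) (Q0 : X → ℝ) (C : ℝ) (hm : ∀ n, Measurable (Q n)) (hm0 : Measurable Q0)
    (hb : ∀ n x, |Q n x| ≤ C) (hb0 : ∀ x, |Q0 x| ≤ C)
    (h : ∀ E, MeasurableSet E → Tendsto (fun n => ∫ x in E, Q n x ∂μ) atTop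
      (nhds (∫ x in E, Q0 x ∂μ)))
    (g : X → ℝ) (hg : Integrable g μ) :
    Tendsto (fun n => ∫ x, Q n x * g x ∂μ) atTop (nhds (∫ x, Q0 x * g x ∂μ)) := by
  refine Integrable.induction (μ := μ) (fun g => Tendsto (fun n => ∫ x, Q n x * g x ∂μ) atTop
    (nhds (∫ x, Q0 x * g x ∂μ))) ?_ ?_ ?_ ?_ hg
  · intro c s hs _
    have key : ∀ q : X → ℝ, ∫ x, q x * s.indicator (fun _ => c) x ∂μ
        = (∫ x in s, q x ∂μ) * c := by
      intro q
      rw [← integral_mul_const, ← integral_indicator hs]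
      congr 1; ext x
      by_cases hx : x ∈ s <;> simp [hx]
    simp only [key]
    exact (h s hs).mul_const c
  · intro f g _ hf hg h1 h2
    have key : ∀ q : X → ℝ, Measurable q → (∀ x, |q x| ≤ C) → ∫ x, q x * (f + g) x ∂μ
        = ∫ x, q x * f x ∂μ + ∫ x, q x * g x ∂μ := by
      intro q hq hqb
      rw [← integral_add (bdd_mul_int hq hqb hf) (bdd_mul_int hq hqb hg)]
      congr 1; ext x; simp [mul_add]
    rw [key _ hm0 hb0]
    simp only [fun n => key _ (hm n) (hb n)]
    exact h1.add h2
  · refine isClosed_of_closure_subset fun f hf => ?_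
    rw [Metric.mem_closure_iff] at hf
    simp only [mem_setOf_eq]
    rw [Metric.tendsto_atTop]
    intro ε hε
    obtain ⟨f', hf', hd⟩ := hf (ε / (3 * (|C| + 1))) (by positivity)
    simp only [mem_setOf_eq] at hf'
    rw [Metric.tendsto_atTop] at hf'
    obtain ⟨N, hN⟩ := hf' (ε / 3) (by positivity)
    refine ⟨N, fun n hn => ?_⟩
    have hfi := L1.integrable_coeFn f
    have hfi' := L1.integrable_coeFn f'
    have hdist : ∫ x, |f x - f' x| ∂μ < ε / (3 * (|C| + 1)) := by
      rw [dist_eq_norm, L1.norm_eq_integral_norm] at hd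
      refine lt_of_eq_of_lt (integral_congr_ae ?_) hd
      filter_upwards [Lp.coeFn_sub f f'] with x hx
      rw [hx]; simp
    have key : ∀ q : X → ℝ, Measurable q → (∀ x, |q x| ≤ C) →
        |∫ x, q x * f x ∂μ - ∫ x, q x * f' x ∂μ| < ε / 3 := by
      intro q hq hqb
      rw [← integral_sub (bdd_mul_int hq hqb hfi) (bdd_mul_int hq hqb hfi')]
      have := bdd_int_le (μ := μ) hqb (hfi.sub hfi')
      simp only [Pi.sub_apply, mul_sub] at this
      refine this.trans_lt ?_
      have h0 : 0 ≤ ∫ x, |f x - f' x| ∂μ := integral_nonneg fun x => abs_nonneg _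
      calc C * ∫ x, |f x - f' x| ∂μ ≤ (|C| + 1) * ∫ x, |f x - f' x| ∂μ := by
            apply mul_le_mul_of_nonneg_right _ h0
            linarith [le_abs_self C]
        _ < (|C| + 1) * (ε / (3 * (|C| + 1))) := by
            apply mul_lt_mul_of_pos_left hdist; positivity
        _ = ε / 3 := by field_simp
    have h1 := key _ (hm n) (hb n)
    have h2 := key _ hm0 hb0
    have h3 := hN n hn
    rw [Real.dist_eq] at h3 ⊢
    rw [abs_lt] at *
    constructor <;> linarith [h1.1, h1.2, h2.1, h2.2, h3.1, h3.2]
  · intro f g hfg _ h1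
    have key : ∀ q : X → ℝ, ∫ x, q x * f x ∂μ = ∫ x, q x * g x ∂μ := fun q =>
      integral_congr_ae (by filter_upwards [hfg] with x hx; rw [hx])
    simpa only [key] using h1

lemma pi_ext {X : Type*} [mX : MeasurableSpace X] (μ : Measure X) [IsFiniteMeasure μ]
    (Q : ℕ → X → ℝ) (Q0 : X → ℝ) (C : ℝ) (hm : ∀ n, Measurable (Q n)) (hm0 : Measurable Q0)
    (hb : ∀ n x, |Q n x| ≤ C) (hb0 : ∀ x, |Q0 x| ≤ C) (𝒞 : Set (Set X))
    (hgen : mX = MeasurableSpace.generateFrom 𝒞) (hpi : IsPiSystem 𝒞)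
    (huniv : Tendsto (fun n => ∫ x, Q n x ∂μ) atTop (nhds (∫ x, Q0 x ∂μ)))
    (h : ∀ E ∈ 𝒞, Tendsto (fun n => ∫ x in E, Q n x ∂μ) atTop
      (nhds (∫ x in E, Q0 x ∂μ))) :
    ∀ E, MeasurableSet E → Tendsto (fun n => ∫ x in E, Q n x ∂μ) atTop
      (nhds (∫ x in E, Q0 x ∂μ)) := by
  have hi : ∀ n, Integrable (Q n) μ := fun n => bdd_int (hm n) (hb n)
  have hi0 : Integrable Q0 μ := bdd_int hm0 hb0
  refine MeasurableSpace.induction_on_inter (C := fun E _ =>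
    Tendsto (fun n => ∫ x in E, Q n x ∂μ) atTop (nhds (∫ x in E, Q0 x ∂μ))) hgen hpi ?_ h ?_ ?_
  · simp
  · intro t ht h1
    have e : ∀ q : X → ℝ, Integrable q μ → ∫ x in tᶜ, q x ∂μ = ∫ x, q x ∂μ - ∫ x in t, q x ∂μ := by
      intro q hq
      rw [← integral_add_compl ht hq]; ring
    rw [e _ hi0]
    simp only [fun n => e _ (hi n)]
    exact huniv.sub h1
  · intro f hd hfm hf
    have e : ∀ q : X → ℝ, Integrable q μ → ∫ x in ⋃ i, f i, q x ∂μ = ∑' i, ∫ x in f i, q x ∂μ :=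
      fun q hq => integral_iUnion hfm hd hq.integrableOn
    rw [e _ hi0]
    simp only [fun n => e _ (hi n)]
    refine tendsto_tsum_of_dominated_convergence (bound := fun i => C * μ.real (f i)) ?_ hf ?_
    · apply Summable.mul_left
      have := measure_iUnion hd hfm (μ := μ)
      have h2 : ∑' i, μ (f i) ≠ ⊤ := by rw [← this]; exact measure_ne_top _ _
      exact ENNReal.summable_toReal h2
    · refine Eventually.of_forall fun n i => ?_
      exact norm_setIntegral_le_of_norm_le_const (measure_lt_top _ _) (fun x _ => hb n x)

lemma weak_compact {X : Type*} [mX : MeasurableSpace X] [MeasurableSpace.CountablyGenerated X]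
    (μ : Measure X) [IsFiniteMeasure μ]
    (Q : ℕ → X → ℝ) (hm : ∀ n, Measurable (Q n)) (hb0 : ∀ n x, 0 ≤ Q n x)
    (hb1 : ∀ n x, Q n x ≤ 1) :
    ∃ φ : ℕ → ℕ, StrictMono φ ∧ ∃ Q0 : X → ℝ, Measurable Q0 ∧ (∀ x, 0 ≤ Q0 x) ∧ (∀ x, Q0 x ≤ 1) ∧
      ∀ E, MeasurableSet E → Tendsto (fun n => ∫ x in E, Q (φ n) x ∂μ) atTop
      (nhds (∫ x in E, Q0 x ∂μ)) := by
  have habs : ∀ n x, |Q n x| ≤ 1 := fun n x => abs_le.2 ⟨by linarith [hb0 n x], hb1 n x⟩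
  have hmem : ∀ n, MemLp (Q n) 2 μ := fun n =>
    MemLp.of_bound (hm n).aestronglyMeasurable 1 (Eventually.of_forall (habs n))
  haveI : Fact ((2 : ENNReal) ≠ ⊤) := ⟨by simp⟩
  let u : ℕ → Lp ℝ 2 μ := fun n => (hmem n).toLp (Q n)
  let R : ℝ := (μ.real univ) ^ ((2 : ENNReal).toReal⁻¹) * 1
  have hu : ∀ n, ‖u n‖ ≤ R := by
    intro n
    refine Lp.norm_le_of_ae_bound zero_le_one ?_
    filter_upwards [(hmem n).coeFn_toLp] with x hx
    rw [hx]; exact habs n x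
  let F : ℕ → WeakDual ℝ (Lp ℝ 2 μ) := fun n =>
    StrongDual.toWeakDual (InnerProductSpace.toDual ℝ (Lp ℝ 2 μ) (u n))
  have hF : ∀ n, F n ∈ (WeakDual.toStrongDual (𝕜 := ℝ) (E := Lp ℝ 2 μ)) ⁻¹' Metric.closedBall 0 R := by
    intro n
    simp only [mem_preimage, Metric.mem_closedBall, dist_zero_right]
    have : WeakDual.toStrongDual (F n) = InnerProductSpace.toDual ℝ (Lp ℝ 2 μ) (u n) := rfl
    rw [this]
    simpa using hu n
  obtain ⟨a, ha, φ, hφ, hlim⟩ := WeakDual.isSeqCompact_closedBall ℝ (Lp ℝ 2 μ) 0 R hF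
  let v : Lp ℝ 2 μ := (InnerProductSpace.toDual ℝ (Lp ℝ 2 μ)).symm (WeakDual.toStrongDual a)
  have hv : ∀ E, MeasurableSet E → Tendsto (fun n => ∫ x in E, Q (φ n) x ∂μ) atTop
      (nhds (∫ x in E, v x ∂μ)) := by
    intro E hE
    have h1 := (WeakDual.eval_continuous (𝕜 := ℝ) (indicatorConstLp 2 hE (measure_ne_top μ E) (1:ℝ))).tendsto a |>.comp hlim
    have h2 : a (indicatorConstLp 2 hE (measure_ne_top μ E) (1:ℝ)) = ∫ x in E, v x ∂μ := by
      rw [← L2.inner_indicatorConstLp_one (𝕜 := ℝ) hE (measure_ne_top μ E) v, real_inner_comm]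
      simp only [v]
      rw [InnerProductSpace.toDual_symm_apply]; rfl
    rw [h2] at h1
    refine h1.congr fun n => ?_
    have h3 : F (φ n) (indicatorConstLp 2 hE (measure_ne_top μ E) (1:ℝ)) = ∫ x in E, u (φ n) x ∂μ := by
      rw [← L2.inner_indicatorConstLp_one (𝕜 := ℝ) hE (measure_ne_top μ E) (u (φ n)), real_inner_comm]
      rfl
    simp only [Function.comp]
    rw [h3]
    refine integral_congr_ae (ae_restrict_of_ae ?_)
    exact (hmem (φ n)).coeFn_toLp
  have hvi : Integrable v μ := (Lp.memLp v).integrable (by norm_num)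
  have hv0 : 0 ≤ᵐ[μ] v := by
    refine ae_nonneg_of_forall_setIntegral_nonneg hvi fun E hE _ => ?_
    exact ge_of_tendsto' (hv E hE) fun n => integral_nonneg (hb0 _)
  have hv1 : v ≤ᵐ[μ] fun _ => (1:ℝ) := by
    refine ae_le_of_forall_setIntegral_le hvi (integrable_const _) fun E hE _ => ?_
    refine le_of_tendsto' (hv E hE) fun n => ?_
    exact integral_mono (bdd_int (hm _) (habs _)) (integrable_const _) (hb1 _)
  have hvm : Measurable v := (Lp.stronglyMeasurable v).measurable
  refine ⟨φ, hφ, fun x => max 0 (min (v x) 1), by fun_prop, fun x => le_max_left _ _,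
    fun x => max_le zero_le_one (min_le_right _ _), fun E hE => ?_⟩
  have : ∫ x in E, max 0 (min (v x) 1) ∂μ = ∫ x in E, v x ∂μ := by
    refine integral_congr_ae (ae_restrict_of_ae ?_)
    filter_upwards [hv0, hv1] with x h0 h1
    simp only [Pi.zero_apply] at h0
    rw [min_eq_left h1, max_eq_right h0]
  rw [this]
  exact hv E hE

end

section


abbrev mu1 : Measure ℝ := volume.restrict (Icc (0:ℝ) 1)

instance : IsProbabilityMeasure mu1 := ⟨by simp [mu1]⟩

lemma le_cut_bdd {U : ℝ → ℝ → ℝ}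
    (hU : Integrable (fun p : ℝ × ℝ => U p.1 p.2) (mu1.prod mu1)) (S T : Set ℝ) :
    |∫ p in S ×ˢ T, U p.1 p.2 ∂(mu1.prod mu1)| ≤ ∫ p, |U p.1 p.2| ∂(mu1.prod mu1) := by
  refine (abs_integral_le_integral_abs).trans ?_
  exact setIntegral_le_integral hU.abs (Eventually.of_forall fun _ => abs_nonneg _)

lemma cut_set_eq {U : ℝ → ℝ → ℝ}
    (hU : Integrable (fun p : ℝ × ℝ => U p.1 p.2) (mu1.prod mu1)) {S T : Set ℝ} 
    (hS : MeasurableSet S) (hT : MeasurableSet T) :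
    ∫ p in S ×ˢ T, U p.1 p.2 ∂(mu1.prod mu1) = ∫ x in S ∩ Icc 0 1, ∫ y in T ∩ Icc 0 1, U x y := by
  rw [setIntegral_prod _ hU.integrableOn]
  rw [Measure.restrict_restrict hS, Measure.restrict_restrict hT]

lemma cut_bddAbove {U : ℝ → ℝ → ℝ}
    (hU : Integrable (fun p : ℝ × ℝ => U p.1 p.2) (mu1.prod mu1)) :
    ∀ c ∈ { c : ℝ | ∃ S T : Set ℝ, MeasurableSet S ∧ MeasurableSet T ∧
    S ⊆ Set.Icc 0 1 ∧ T ⊆ Set.Icc 0 1 ∧ c = |∫ x in S, ∫ y in T, U x y| },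
    c ≤ ∫ p, |U p.1 p.2| ∂(mu1.prod mu1) := by
  rintro c ⟨S, T, hS, hT, hS1, hT1, rfl⟩
  have := le_cut_bdd hU S T
  rwa [cut_set_eq hU hS hT, inter_eq_left.2 hS1, inter_eq_left.2 hT1] at this

lemma le_cut {U : ℝ → ℝ → ℝ}
    (hU : Integrable (fun p : ℝ × ℝ => U p.1 p.2) (mu1.prod mu1)) {S T : Set ℝ} 
    (hS : MeasurableSet S) (hT : MeasurableSet T) :
    |∫ p in S ×ˢ T, U p.1 p.2 ∂(mu1.prod mu1)| ≤ cutNorm U := by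
  refine le_csSup ⟨_, cut_bddAbove hU⟩ ?_
  exact ⟨S ∩ Icc 0 1, T ∩ Icc 0 1, hS.inter measurableSet_Icc, hT.inter measurableSet_Icc,
    inter_subset_right, inter_subset_right, by rw [cut_set_eq hU hS hT]⟩

lemma cut_le {U : ℝ → ℝ → ℝ}
    (hU : Integrable (fun p : ℝ × ℝ => U p.1 p.2) (mu1.prod mu1)) {c : ℝ}
    (h : ∀ S T, MeasurableSet S → MeasurableSet T →
      |∫ p in S ×ˢ T, U p.1 p.2 ∂(mu1.prod mu1)| ≤ c) : cutNorm U ≤ c := by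
  refine csSup_le ⟨_, ∅, ∅, by simp, by simp, by simp, by simp, rfl⟩ ?_
  rintro _ ⟨S, T, hS, hT, hS1, hT1, rfl⟩
  have := h S T hS hT
  rwa [cut_set_eq hU hS hT, inter_eq_left.2 hS1, inter_eq_left.2 hT1] at this

lemma aux2 {X : Type*} [MeasurableSpace X] {μ : Measure X} {f h : X → ℝ} {c : ℝ}
    (hi : Integrable h μ) (hh : Measurable h) (hf : ∀ x, |f x| ≤ 1)
    (hc : ∀ S, MeasurableSet S → |∫ x in S, h x ∂μ| ≤ c) : |∫ x, f x * h x ∂μ| ≤ 2 * c := by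
  refine (bdd_int_le hf hi).trans ?_
  have hS : MeasurableSet {x | 0 ≤ h x} := measurableSet_le measurable_const hh
  rw [one_mul, ← integral_add_compl hS hi.abs]
  have e1 : ∫ x in {x | 0 ≤ h x}, |h x| ∂μ = ∫ x in {x | 0 ≤ h x}, h x ∂μ :=
    setIntegral_congr_fun hS fun x hx => abs_of_nonneg hx
  have e2 : ∫ x in {x | 0 ≤ h x}ᶜ, |h x| ∂μ = - ∫ x in {x | 0 ≤ h x}ᶜ, h x ∂μ := by
    rw [← integral_neg]
    refine setIntegral_congr_fun hS.compl fun x hx => abs_of_neg ?_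
    simpa using hx
  rw [e1, e2]
  have h1 := hc _ hS
  have h2 := hc _ hS.compl
  rw [abs_le] at h1 h2
  linarith [h1.2, h2.1]

lemma cut_bilin {U : ℝ → ℝ → ℝ} (hm : Measurable (fun p : ℝ × ℝ => U p.1 p.2))
    (hU : Integrable (fun p : ℝ × ℝ => U p.1 p.2) (mu1.prod mu1)) {f g : ℝ → ℝ}
    (hfm : Measurable f) (hgm : Measurable g) (hf : ∀ x, |f x| ≤ 1) (hg : ∀ x, |g x| ≤ 1) :
    |∫ p, f p.1 * (g p.2 * U p.1 p.2) ∂(mu1.prod mu1)| ≤ 4 * cutNorm U := by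
  have hgU : Integrable (fun p : ℝ × ℝ => g p.2 * U p.1 p.2) (mu1.prod mu1) :=
    bdd_mul_int (Q := fun p : ℝ × ℝ => g p.2) (by fun_prop) (fun p => hg p.2) hU
  have hfU : Integrable (fun p : ℝ × ℝ => f p.1 * (g p.2 * U p.1 p.2)) (mu1.prod mu1) :=
    bdd_mul_int (Q := fun p : ℝ × ℝ => f p.1) (by fun_prop) (fun p => hf p.1) hgU
  have step1 : ∀ S, MeasurableSet S →
      |∫ x in S, ∫ y, g y * U x y ∂mu1 ∂mu1| ≤ 2 * cutNorm U := by
    intro S hS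
    have e : ∫ x in S, ∫ y, g y * U x y ∂mu1 ∂mu1 = ∫ y, g y * ∫ x in S, U x y ∂mu1 ∂mu1 := by
      simp_rw [← integral_const_mul]
      refine integral_integral_swap ?_
      have := hgU.integrableOn (s := S ×ˢ univ)
      rwa [IntegrableOn, ← Measure.prod_restrict, Measure.restrict_univ] at this
    rw [e]
    have hUS : Integrable (fun p : ℝ × ℝ => U p.1 p.2) ((mu1.restrict S).prod mu1) := by
      have := hU.integrableOn (s := S ×ˢ univ)
      rwa [IntegrableOn, ← Measure.prod_restrict, Measure.restrict_univ] at this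
    refine aux2 hUS.integral_prod_right ?_ hg ?_
    · exact (StronglyMeasurable.integral_prod_left' (f := fun p : ℝ × ℝ => U p.1 p.2)
        hm.stronglyMeasurable).measurable
    · intro T hT
      have e2 : ∫ y in T, ∫ x in S, U x y ∂mu1 ∂mu1 = ∫ p in S ×ˢ T, U p.1 p.2 ∂(mu1.prod mu1) := by
        rw [setIntegral_prod _ hU.integrableOn]
        refine (integral_integral_swap ?_).symm
        have := hU.integrableOn (s := S ×ˢ T)
        rwa [IntegrableOn, ← Measure.prod_restrict] at this
      rw [e2]
      exact le_cut hU hS hT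
  have e : ∫ p, f p.1 * (g p.2 * U p.1 p.2) ∂(mu1.prod mu1)
      = ∫ x, f x * ∫ y, g y * U x y ∂mu1 ∂mu1 := by
    rw [integral_prod _ hfU]
    simp_rw [integral_const_mul]
  rw [e]
  have := aux2 (f := f) hgU.integral_prod_left ?_ hf step1
  · linarith
  · exact (StronglyMeasurable.integral_prod_right' (f := fun p : ℝ × ℝ => g p.2 * U p.1 p.2)
        ((hgm.comp measurable_snd).mul hm).stronglyMeasurable).measurable

lemma dens1 {X : Type*} [mX : MeasurableSpace X] {μ : Measure X} {h : X → ℝ} {c : ℝ}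
    (𝒜 : Set (Set X)) (h𝒜 : IsSetAlgebra 𝒜) (hgen : mX = MeasurableSpace.generateFrom 𝒜)
    (hi : Integrable h μ)
    (hc : ∀ S ∈ 𝒜, |∫ x in S, h x ∂μ| ≤ c) (S : Set X) (hS : MeasurableSet S) :
    |∫ x in S, h x ∂μ| ≤ c := by
  let ν := μ.withDensity (fun x => ‖h x‖ₑ)
  have hfin : IsFiniteMeasure ν := isFiniteMeasure_withDensity hi.2.ne
  have hd := Measure.MeasureDense.of_generateFrom_isSetAlgebra_finite (μ := ν) h𝒜 hgen
  refine le_of_forall_pos_le_add fun ε hε => ?_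
  obtain ⟨S', hS', hlt⟩ := hd.approx S hS (measure_ne_top _ _) ε hε
  have hS'm := hd.measurable S' hS'
  have h1 : |∫ x in S, h x ∂μ - ∫ x in S', h x ∂μ| ≤ ∫ x in symmDiff S S', |h x| ∂μ := by
    rw [← integral_indicator hS, ← integral_indicator hS'm,
      ← integral_indicator (hS.symmDiff hS'm),
      ← integral_sub (hi.indicator hS) (hi.indicator hS'm), ← Real.norm_eq_abs]
    refine norm_integral_le_of_norm_le (hi.abs.indicator (hS.symmDiff hS'm))
      (Eventually.of_forall fun x => ?_)
    by_cases a : x ∈ S <;> by_cases b : x ∈ S' <;> simp [a, b, Set.mem_symmDiff]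
  have h2 : ∫ x in symmDiff S S', |h x| ∂μ < ε := by
    have : ν (symmDiff S S') = ENNReal.ofReal (∫ x in symmDiff S S', |h x| ∂μ) := by
      rw [withDensity_apply _ (hS.symmDiff hS'm)]
      exact (ofReal_integral_norm_eq_lintegral_enorm hi.integrableOn).symm
    rw [this] at hlt
    exact (ENNReal.ofReal_lt_ofReal_iff hε).1 hlt
  have h3 := hc S' hS'
  rw [abs_le] at *
  constructor <;> linarith [h1.1, h1.2, h3.1, h3.2]

lemma cut_dense {U : ℝ → ℝ → ℝ} 
    (hU : Integrable (fun p : ℝ × ℝ => U p.1 p.2) (mu1.prod mu1))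
    (𝒜 : Set (Set ℝ)) (h𝒜 : IsSetAlgebra 𝒜)
    (hgen : (inferInstance : MeasurableSpace ℝ) = MeasurableSpace.generateFrom 𝒜) {c : ℝ}
    (h : ∀ S ∈ 𝒜, ∀ T ∈ 𝒜, |∫ p in S ×ˢ T, U p.1 p.2 ∂(mu1.prod mu1)| ≤ c)
    (S T : Set ℝ) (hS : MeasurableSet S) (hT : MeasurableSet T) :
      |∫ p in S ×ˢ T, U p.1 p.2 ∂(mu1.prod mu1)| ≤ c := by
  have hr : ∀ S T, IntegrableOn (fun p : ℝ × ℝ => U p.1 p.2) (S ×ˢ T) (mu1.prod mu1) :=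
    fun S T => hU.integrableOn
  have hr' : ∀ S T, Integrable (fun p : ℝ × ℝ => U p.1 p.2) ((mu1.restrict S).prod (mu1.restrict T)) :=
    fun S T => by rw [Measure.prod_restrict]; exact hr S T
  have e : ∀ S T, ∫ p in S ×ˢ T, U p.1 p.2 ∂(mu1.prod mu1)
      = ∫ x in S, ∫ y in T, U x y ∂mu1 ∂mu1 := fun S T => by
    rw [setIntegral_prod _ hU.integrableOn]
  have e' : ∀ S T, ∫ p in S ×ˢ T, U p.1 p.2 ∂(mu1.prod mu1)
      = ∫ y in T, ∫ x in S, U x y ∂mu1 ∂mu1 := fun S T => by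
    rw [e]
    exact integral_integral_swap (hr' S T)
  have hfirst : ∀ S, MeasurableSet S → ∀ T ∈ 𝒜, |∫ p in S ×ˢ T, U p.1 p.2 ∂(mu1.prod mu1)| ≤ c := by
    intro S hS T hT
    rw [e]
    refine dens1 𝒜 h𝒜 hgen ?_ (fun S' hS' => ?_) S hS
    · have := (hr' univ T).integral_prod_left
      rwa [Measure.restrict_univ] at this
    · rw [← e]; exact h S' hS' T hT
  rw [e']
  refine dens1 𝒜 h𝒜 hgen ?_ (fun T' hT' => ?_) T hT
  · have := (hr' S univ).integral_prod_right
    rwa [Measure.restrict_univ] at this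
  · rw [← e']; exact hfirst S hS T' hT'

lemma exists_alg : ∃ 𝒜 : Set (Set ℝ), 𝒜.Countable ∧ IsSetAlgebra 𝒜 ∧
    (inferInstance : MeasurableSpace ℝ) = MeasurableSpace.generateFrom 𝒜 := by
  refine ⟨generateSetAlgebra (MeasurableSpace.countableGeneratingSet ℝ),
    countable_generateSetAlgebra MeasurableSpace.countable_countableGeneratingSet,
    isSetAlgebra_generateSetAlgebra, ?_⟩
  rw [generateFrom_generateSetAlgebra_eq, MeasurableSpace.generateFrom_countableGeneratingSet]

lemma cut_integrable (μT : Measure ℝ) [IsFiniteMeasure μT] {U : ℝ → ℝ → ℝ → ℝ}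
    (hm : Measurable (fun p : ℝ × ℝ × ℝ => U p.1 p.2.1 p.2.2))
    (hU : Integrable (fun p : ℝ × ℝ × ℝ => U p.1 p.2.1 p.2.2) (μT.prod (mu1.prod mu1))) :
    Integrable (fun t => cutNorm (U t)) μT := by
  obtain ⟨𝒜, hc, hA, hgen⟩ := exists_alg
  have hAm : ∀ S ∈ 𝒜, MeasurableSet S := 
    (Measure.MeasureDense.of_generateFrom_isSetAlgebra_finite (μ := mu1) hA hgen).measurable
  have : Countable 𝒜 := hc
  have : Nonempty 𝒜 := ⟨⟨∅, hA.empty_mem⟩⟩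
  have hbd : Integrable (fun t => ∫ q, |U t q.1 q.2| ∂(mu1.prod mu1)) μT := hU.abs.integral_prod_left
  let c : ℝ → ℝ := fun t => ⨆ p : 𝒜 × 𝒜, |∫ q in p.1.1 ×ˢ p.2.1, U t q.1 q.2 ∂(mu1.prod mu1)|
  have hcm : Measurable c := by
    refine Measurable.iSup fun p => ?_
    refine Measurable.abs ?_
    exact (StronglyMeasurable.integral_prod_right' (f := fun p : ℝ × ℝ × ℝ => U p.1 p.2.1 p.2.2)
      hm.stronglyMeasurable).measurable
  have hae := hU.prod_right_ae
  refine Integrable.mono' hbd (AEMeasurable.aestronglyMeasurable ⟨c, hcm, ?_⟩) ?_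
  · filter_upwards [hae] with t ht
    have hb : BddAbove (range fun p : 𝒜 × 𝒜 =>
        |∫ q in p.1.1 ×ˢ p.2.1, U t q.1 q.2 ∂(mu1.prod mu1)|) := by
      refine ⟨∫ q, |U t q.1 q.2| ∂(mu1.prod mu1), ?_⟩
      rintro _ ⟨p, rfl⟩
      exact le_cut_bdd ht _ _
    refine le_antisymm (cut_le ht (cut_dense ht 𝒜 hA hgen fun S hS T hT => ?_)) ?_
    · exact le_ciSup hb (⟨⟨S, hS⟩, ⟨T, hT⟩⟩ : 𝒜 × 𝒜)
    · exact ciSup_le fun p => le_cut ht (hAm _ p.1.2) (hAm _ p.2.2)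
  · filter_upwards [hae] with t ht
    rw [Real.norm_eq_abs, abs_of_nonneg]
    · exact cut_le ht fun S T _ _ => le_cut_bdd ht S T
    · exact (abs_nonneg _).trans (le_cut ht MeasurableSet.empty MeasurableSet.empty)

lemma cut_main (μT : Measure ℝ) [IsFiniteMeasure μT] {U : ℝ → ℝ → ℝ → ℝ}
    (hm : Measurable (fun p : ℝ × ℝ × ℝ => U p.1 p.2.1 p.2.2))
    (hU : Integrable (fun p : ℝ × ℝ × ℝ => U p.1 p.2.1 p.2.2) (μT.prod (mu1.prod mu1)))
    {f g : ℝ → ℝ → ℝ} (hf : Measurable (fun p : ℝ × ℝ => f p.1 p.2))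
    (hg : Measurable (fun p : ℝ × ℝ => g p.1 p.2)) (hf1 : ∀ t x, |f t x| ≤ 1)
    (hg1 : ∀ t x, |g t x| ≤ 1) :
    |∫ p, f p.1 p.2.1 * (g p.1 p.2.2 * U p.1 p.2.1 p.2.2) ∂(μT.prod (mu1.prod mu1))|
      ≤ 4 * ∫ t, cutNorm (U t) ∂μT := by
  have hI : Integrable (fun p : ℝ × ℝ × ℝ => f p.1 p.2.1 * (g p.1 p.2.2 * U p.1 p.2.1 p.2.2))
      (μT.prod (mu1.prod mu1)) := by
    refine bdd_mul_int (Q := fun p : ℝ × ℝ × ℝ => f p.1 p.2.1) ?_ (fun p => hf1 _ _)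
      (bdd_mul_int (Q := fun p : ℝ × ℝ × ℝ => g p.1 p.2.2) ?_ (fun p => hg1 _ _) hU)
    · exact hf.comp (f := fun p : ℝ × ℝ × ℝ => (p.1, p.2.1)) (by fun_prop)
    · exact hg.comp (f := fun p : ℝ × ℝ × ℝ => (p.1, p.2.2)) (by fun_prop)
  rw [integral_prod _ hI, ← integral_const_mul, ← Real.norm_eq_abs]
  refine norm_integral_le_of_norm_le ((cut_integrable μT hm hU).const_mul 4) ?_
  filter_upwards [hU.prod_right_ae] with t ht
  exact cut_bilin (U := U t) (hm.comp (f := fun p : ℝ × ℝ => (t, p.1, p.2)) (by fun_prop)) ht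
    (hf.comp (f := fun x : ℝ => (t, x)) (by fun_prop))
    (hg.comp (f := fun x : ℝ => (t, x)) (by fun_prop)) (hf1 t) (hg1 t)

end

section
abbrev muT (T : ℝ) : Measure ℝ := volume.restrict (Icc (0:ℝ) T)
abbrev mu2 (T : ℝ) : Measure (ℝ × ℝ) := (muT T).prod mu1
abbrev mu3 (T : ℝ) : Measure (ℝ × ℝ × ℝ) := (muT T).prod (mu1.prod mu1)

lemma mu2_eq (T : ℝ) : mu2 T = (volume : Measure (ℝ × ℝ)).restrict (Icc 0 T ×ˢ Icc (0:ℝ) 1) := by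
  rw [mu2, mu1, muT, Measure.prod_restrict]; rfl

lemma mu3_eq (T : ℝ) : mu3 T = (volume : Measure (ℝ × ℝ × ℝ)).restrict
    (Icc 0 T ×ˢ Icc (0:ℝ) 1 ×ˢ Icc (0:ℝ) 1) := by
  rw [mu3, mu1, muT, Measure.prod_restrict, Measure.prod_restrict]; rfl

lemma ibp {T : ℝ} (hT : 0 < T) {u F φ : ℝ → ℝ} {u0 : ℝ} (hF : IntegrableOn F (Icc 0 T))
    (hu : ∀ t ∈ Icc 0 T, u t = u0 + ∫ τ in (0:ℝ)..t, F τ) (hφ : ContDiff ℝ 1 φ) (hφT : φ T = 0) :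
    ∫ t, u t * deriv φ t ∂(muT T) + ∫ t, F t * φ t ∂(muT T) + u0 * φ 0 = 0 := by
  have hFi : IntervalIntegrable F volume 0 T :=
    (intervalIntegrable_iff_integrableOn_Icc_of_le hT.le).2 hF
  have hac : AbsolutelyContinuousOnInterval (fun t => u0 + ∫ τ in (0:ℝ)..t, F τ) 0 T := by
    have h1 := hFi.absolutelyContinuousOnInterval_intervalIntegral (c := 0) (by simp)
    have h2 : AbsolutelyContinuousOnInterval (fun _ : ℝ => u0) 0 T :=
      (LipschitzWith.const u0).lipschitzOnWith.absolutelyContinuousOnInterval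
    exact h2.add h1
  have hac2 : AbsolutelyContinuousOnInterval φ 0 T := by
    exact hφ.contDiffOn.absolutelyContinuousOnInterval
  have h := hac.integral_mul_deriv_eq_deriv_mul hac2
  have e1 : ∫ t, u t * deriv φ t ∂(muT T)
      = ∫ t in (0:ℝ)..T, (u0 + ∫ τ in (0:ℝ)..t, F τ) * deriv φ t := by
    rw [intervalIntegral.integral_of_le hT.le, ← integral_Icc_eq_integral_Ioc]
    refine setIntegral_congr_fun measurableSet_Icc fun t ht => ?_
    simp only [hu t ht]
  have e2 : ∫ t, F t * φ t ∂(muT T)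
      = ∫ t in (0:ℝ)..T, deriv (fun t => u0 + ∫ τ in (0:ℝ)..t, F τ) t * φ t := by
    rw [muT, integral_Icc_eq_integral_Ioc, ← intervalIntegral.integral_of_le hT.le]
    refine intervalIntegral.integral_congr_ae ?_
    filter_upwards [hFi.ae_hasDerivAt_integral] with t ht hm
    have h3 := ht (uIoc_subset_uIcc hm) 0 (by simp)
    rw [(h3.const_add u0).deriv]
  rw [e1, e2, h, hφT]
  simp

lemma test_facts {T : ℝ} {φ : ℝ → ℝ → ℝ} (h : IsTest T φ) :
    Continuous (fun p : ℝ × ℝ => φ p.1 p.2) ∧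
    Continuous (fun p : ℝ × ℝ => deriv (fun τ => φ τ p.2) p.1) ∧
    (∀ x, ContDiff ℝ 1 (fun t => φ t x)) ∧ ∀ x, φ T x = 0 := by
  obtain ⟨h1, T', hT', h2⟩ := h
  have hC1 : ContDiff ℝ 1 (fun p : ℝ × ℝ => φ p.1 p.2) := h1.of_le (by exact_mod_cast le_top)
  refine ⟨h1.continuous, ?_, fun x => ?_, fun x => h2 T x hT'.le⟩
  · have : (fun p : ℝ × ℝ => deriv (fun τ => φ τ p.2) p.1)
        = fun p => fderiv ℝ (fun p : ℝ × ℝ => φ p.1 p.2) p (1, 0) := by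
      ext p
      have h3 : HasFDerivAt (fun p : ℝ × ℝ => φ p.1 p.2)
          (fderiv ℝ (fun p : ℝ × ℝ => φ p.1 p.2) p) p :=
        (hC1.differentiable (by norm_num) p).hasFDerivAt
      have h4 : HasDerivAt (fun τ : ℝ => (τ, p.2)) ((1:ℝ), (0:ℝ)) p.1 :=
        (hasDerivAt_id p.1).prodMk (hasDerivAt_const _ _)
      exact (h3.comp_hasDerivAt (x := p.1) (f := fun τ : ℝ => (τ, p.2)) h4).deriv
    rw [this]
    exact (hC1.continuous_fderiv (by norm_num)).clm_apply continuous_const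
  · exact hC1.comp (f := fun t : ℝ => (t, x)) (by fun_prop)

lemma cont_int (T : ℝ) {f : ℝ × ℝ → ℝ} (hf : Continuous f) : Integrable f (mu2 T) := by
  rw [mu2_eq]
  exact hf.continuousOn.integrableOn_compact (isCompact_Icc.prod isCompact_Icc)

lemma weak_form {T : ℝ} (hT : 0 < T) {u F : ℝ → ℝ → ℝ} {u0 : ℝ → ℝ} {C1 C2 C3 : ℝ}
    (hum : Measurable (fun p : ℝ × ℝ => u p.1 p.2)) (hFm : Measurable (fun p : ℝ × ℝ => F p.1 p.2))
    (hu0m : Measurable u0) (hub : ∀ t x, |u t x| ≤ C1) (hFb : ∀ t x, |F t x| ≤ C2)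
    (hu0b : ∀ x, |u0 x| ≤ C3)
    (heq : ∀ᵐ x ∂mu1, ∀ t ∈ Icc 0 T, u t x = u0 x + ∫ τ in (0:ℝ)..t, F τ x)
    {φ : ℝ → ℝ → ℝ} (hφ : IsTest T φ) :
    ∫ p, u p.1 p.2 * deriv (fun τ => φ τ p.2) p.1 ∂(mu2 T) + ∫ p, F p.1 p.2 * φ p.1 p.2 ∂(mu2 T)
      + ∫ x, u0 x * φ 0 x ∂mu1 = 0 := by
  obtain ⟨hc, hdc, hC1, h0⟩ := test_facts hφ
  have i1 : Integrable (fun p : ℝ × ℝ => u p.1 p.2 * deriv (fun τ => φ τ p.2) p.1) (mu2 T) :=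
    bdd_mul_int (Q := fun p : ℝ × ℝ => u p.1 p.2) hum (fun p => hub _ _) (cont_int T hdc)
  have i2 : Integrable (fun p : ℝ × ℝ => F p.1 p.2 * φ p.1 p.2) (mu2 T) :=
    bdd_mul_int (Q := fun p : ℝ × ℝ => F p.1 p.2) hFm (fun p => hFb _ _) (cont_int T hc)
  have i3 : Integrable (fun x => u0 x * φ 0 x) mu1 := by
    refine bdd_mul_int hu0m hu0b ?_
    exact (hc.comp (f := fun x : ℝ => ((0:ℝ), x)) (by fun_prop)).continuousOn.integrableOn_compact
      isCompact_Icc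
  rw [integral_prod_symm _ i1, integral_prod_symm _ i2,
    ← integral_add i1.integral_prod_right i2.integral_prod_right]
  refine (integral_add (i1.integral_prod_right.add i2.integral_prod_right) i3).symm.trans ?_
  refine integral_eq_zero_of_ae ?_
  filter_upwards [heq] with x hx
  refine ibp hT (u := fun t => u t x) (F := fun t => F t x) ?_ hx (hC1 x) (h0 x)
  exact bdd_int (μ := muT T) (hFm.comp (f := fun t : ℝ => (t, x)) (by fun_prop)) (fun t => hFb t x)

end

section
lemma red3 {T : ℝ} {H : ℝ → ℝ → ℝ → ℝ}
    (hH : Integrable (fun p : ℝ × ℝ × ℝ => H p.1 p.2.1 p.2.2) (mu3 T)) :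
    Integrable (fun q : ℝ × ℝ => ∫ y, H q.1 q.2 y ∂mu1) (mu2 T) ∧
    ∫ q, (∫ y, H q.1 q.2 y ∂mu1) ∂(mu2 T) = ∫ p, H p.1 p.2.1 p.2.2 ∂(mu3 T) := by
  have hmp := measurePreserving_prodAssoc (muT T) mu1 mu1
  have h1 := (hmp.integrable_comp_emb (MeasurableEquiv.measurableEmbedding _)).2 hH
  refine ⟨h1.integral_prod_left, ?_⟩
  have h2 := hmp.integral_comp' (g := fun p : ℝ × ℝ × ℝ => H p.1 p.2.1 p.2.2)
  exact (integral_prod _ h1).symm.trans h2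

lemma strong1 {T : ℝ} {s : ℕ → ℝ → ℝ → ℝ} {sl : ℝ → ℝ → ℝ}
    (hsm : ∀ n, Measurable (fun p : ℝ × ℝ => s n p.1 p.2))
    (hslm : Measurable (fun p : ℝ × ℝ => sl p.1 p.2))
    (hs1 : ∀ n t x, |s n t x| ≤ 1) (hsl1 : ∀ t x, |sl t x| ≤ 1)
    (hconv : ∀ E, MeasurableSet E → Tendsto (fun n => ∫ p in E, s n p.1 p.2 ∂(mu2 T)) atTop
      (nhds (∫ p in E, sl p.1 p.2 ∂(mu2 T))))
    {w : ℝ → ℝ} (hw : IntegrableOn w (Icc 0 T)) {ε : ℕ → ℝ} (hε : Tendsto ε atTop (nhds 0))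
    (hw0 : ∀ t, 0 ≤ w t)
    (hequi : ∀ n t' t, 0 ≤ t' → t' ≤ t → t ≤ T →
      ∫ x, |s n t x - s n t' x| ∂mu1 ≤ ε n + ∫ τ in t'..t, w τ)
    {B : Set ℝ} (hB : MeasurableSet B) :
    ∀ᵐ t ∂(muT T), Tendsto (fun n => ∫ x in B, s n t x ∂mu1) atTop
      (nhds (∫ x in B, sl t x ∂mu1)) := by
  rcases lt_or_ge T 0 with hT0 | hT
  · simp [muT, Icc_eq_empty_of_lt hT0]
  -- sections
  have hsec : ∀ n t, Integrable (fun x => s n t x) mu1 := fun n t =>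
    bdd_int ((hsm n).comp (f := fun x : ℝ => (t, x)) (by fun_prop)) (hs1 n t)
  have hfm : ∀ n, Measurable (fun t => ∫ x in B, s n t x ∂mu1) := fun n =>
    (StronglyMeasurable.integral_prod_right' (f := fun p : ℝ × ℝ => s n p.1 p.2)
      (hsm n).stronglyMeasurable).measurable
  have hflm : Measurable (fun t => ∫ x in B, sl t x ∂mu1) :=
    (StronglyMeasurable.integral_prod_right' (f := fun p : ℝ × ℝ => sl p.1 p.2)
      hslm.stronglyMeasurable).measurable
  have hbd : ∀ q : ℝ → ℝ, (∀ x, |q x| ≤ 1) → |∫ x in B, q x ∂mu1| ≤ 1 := by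
    intro q hq
    have := norm_setIntegral_le_of_norm_le_const (s := B) (μ := mu1) (f := q) (C := 1)
      (measure_lt_top _ _) (fun x _ => hq x)
    refine this.trans ?_
    rw [one_mul]; exact measureReal_le_one
  have hfi : ∀ n a b, IntervalIntegrable (fun t => ∫ x in B, s n t x ∂mu1) volume a b := fun n a b => by
    rw [intervalIntegrable_iff]
    have : IsFiniteMeasure (volume.restrict (uIoc a b)) := by unfold uIoc; infer_instance
    exact bdd_int (μ := volume.restrict (uIoc a b)) (hfm n) (fun t => hbd _ (hs1 n t))
  have hfli : ∀ a b, IntervalIntegrable (fun t => ∫ x in B, sl t x ∂mu1) volume a b := fun a b => by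
    rw [intervalIntegrable_iff]
    have : IsFiniteMeasure (volume.restrict (uIoc a b)) := by unfold uIoc; infer_instance
    exact bdd_int (μ := volume.restrict (uIoc a b)) hflm (fun t => hbd _ (hsl1 t))
  have hwi : ∀ a b, 0 ≤ a → a ≤ b → b ≤ T → IntervalIntegrable w volume a b := fun a b h1 h2 h3 => by
    rw [intervalIntegrable_iff_integrableOn_Icc_of_le h2]
    exact hw.mono_set (Icc_subset_Icc h1 h3)
  have hloc : ∀ᵐ t, HasDerivAt (fun x => ∫ τ in (0:ℝ)..x, ∫ x in B, sl τ x ∂mu1)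
      (∫ x in B, sl t x ∂mu1) t := by
    have : LocallyIntegrable (fun t => ∫ x in B, sl t x ∂mu1) volume := by
      intro t
      refine ⟨Icc (t-1) (t+1), Icc_mem_nhds (by linarith) (by linarith), ?_⟩
      exact bdd_int (μ := volume.restrict (Icc (t-1) (t+1))) hflm (fun t => hbd _ (hsl1 t))
    filter_upwards [LocallyIntegrable.ae_hasDerivAt_integral this] with t ht using ht 0
  have hne : ∀ᵐ t : ℝ, t ≠ T := by simp [ae_iff, measure_singleton]
  refine (ae_restrict_iff' measurableSet_Icc).2 ?_
  filter_upwards [hloc, hne] with t hd htne htm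
  have htT : t < T := lt_of_le_of_ne htm.2 htne
  rw [Metric.tendsto_atTop]
  intro δ hδ
  -- small h
  have hd' := (hasDerivAt_iff_tendsto_slope_zero.1 hd).mono_left
    (nhdsWithin_mono 0 (fun x (hx : x ∈ Ioi (0:ℝ)) => ne_of_gt hx))
  have e1 := (Metric.tendsto_nhds.1 hd') (δ/4) (by positivity)
  have e2 : ∀ᶠ h in nhdsWithin (0:ℝ) (Ioi 0), t + h ≤ T := by
    have : ∀ᶠ h in nhds (0:ℝ), h < T - t := eventually_lt_nhds (by linarith)
    filter_upwards [this.filter_mono nhdsWithin_le_nhds] with h hh; linarith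
  have e3 : ∀ᶠ h in nhdsWithin (0:ℝ) (Ioi 0), ∫ τ in t..(t+h), w τ < δ/4 := by
    have hc : ContinuousOn (fun x => ∫ τ in t..x, w τ) (uIcc t T) := by
      refine intervalIntegral.continuousOn_primitive_interval ?_
      rw [uIcc_of_le htm.2]
      exact hw.mono_set (Icc_subset_Icc htm.1 le_rfl)
    have hc' := hc t left_mem_uIcc
    rw [ContinuousWithinAt] at hc'
    simp only [intervalIntegral.integral_same] at hc'
    have hm : Tendsto (fun h : ℝ => t + h) (nhdsWithin (0:ℝ) (Ioi 0)) (nhdsWithin t (uIcc t T)) := by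
      refine tendsto_nhdsWithin_iff.2 ⟨?_, ?_⟩
      · have : Tendsto (fun h : ℝ => t + h) (nhds 0) (nhds (t + 0)) :=
          (continuous_const.add continuous_id).tendsto 0
        rw [add_zero] at this
        exact this.mono_left nhdsWithin_le_nhds
      · filter_upwards [e2, self_mem_nhdsWithin] with h h1 h2
        rw [uIcc_of_le htm.2]
        exact ⟨by linarith [mem_Ioi.1 h2], h1⟩
    exact (hc'.comp hm).eventually (gt_mem_nhds (by positivity))
  obtain ⟨h, ⟨⟨h1, h2⟩, h3⟩, hpos⟩ := ((e1.and e2).and e3).and self_mem_nhdsWithin |>.exists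
  have hpos : 0 < h := hpos
  -- averages
  have hset : ∀ q : ℝ → ℝ → ℝ, Measurable (fun p : ℝ × ℝ => q p.1 p.2) → (∀ t x, |q t x| ≤ 1) →
      ∫ p in (Icc t (t+h)) ×ˢ B, q p.1 p.2 ∂(mu2 T) = ∫ τ in t..(t+h), ∫ x in B, q τ x ∂mu1 := by
    intro q hq hq1
    rw [setIntegral_prod _ (bdd_int hq (fun p => hq1 _ _)).integrableOn,
      intervalIntegral.integral_of_le (by linarith), ← integral_Icc_eq_integral_Ioc,
      Measure.restrict_restrict measurableSet_Icc,
      inter_eq_left.2 (Icc_subset_Icc htm.1 h2)]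
  have hav := hconv ((Icc t (t+h)) ×ˢ B) (measurableSet_Icc.prod hB)
  rw [hset sl hslm hsl1] at hav
  simp only [fun n => hset (s n) (hsm n) (hs1 n)] at hav
  have hav2 := hav.const_mul h⁻¹
  obtain ⟨N1, hN1⟩ := Metric.tendsto_atTop.1 hav2 (δ/4) (by positivity)
  obtain ⟨N2, hN2⟩ := Metric.tendsto_atTop.1 hε (δ/4) (by positivity)
  refine ⟨max N1 N2, fun n hn => ?_⟩
  have k1 := hN1 n (le_trans (le_max_left _ _) hn)
  have k2 := hN2 n (le_trans (le_max_right _ _) hn)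
  have k3 : |∫ x in B, s n t x ∂mu1 - h⁻¹ * ∫ τ in t..(t+h), ∫ x in B, s n τ x ∂mu1|
      ≤ ε n + ∫ τ in t..(t+h), w τ := by
    have ec : ∫ x in B, s n t x ∂mu1 = h⁻¹ * ∫ τ in t..(t+h), ∫ x in B, s n t x ∂mu1 := by
      rw [intervalIntegral.integral_const]; simp; field_simp
    rw [ec, ← mul_sub, ← intervalIntegral.integral_sub intervalIntegrable_const (hfi n _ _), abs_mul,
      abs_of_pos (inv_pos.2 hpos)]
    have : |∫ τ in t..(t+h), (∫ x in B, s n t x ∂mu1 - ∫ x in B, s n τ x ∂mu1)|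
        ≤ (ε n + ∫ τ in t..(t+h), w τ) * |t + h - t| := by
      rw [← Real.norm_eq_abs]
      refine intervalIntegral.norm_integral_le_of_norm_le_const fun τ hτ => ?_
      rw [uIoc_of_le (by linarith)] at hτ
      have h5 := hequi n t τ htm.1 hτ.1.le (hτ.2.trans h2)
      have h6 : ∫ σ in t..τ, w σ ≤ ∫ σ in t..(t+h), w σ :=
        intervalIntegral.integral_mono_interval le_rfl hτ.1.le hτ.2
          (Eventually.of_forall hw0) (hwi _ _ htm.1 (by linarith) h2)
      rw [← integral_sub (hsec n t).integrableOn (hsec n τ).integrableOn, Real.norm_eq_abs]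
      refine (abs_integral_le_integral_abs).trans ?_
      refine (setIntegral_le_integral ((hsec n t).sub (hsec n τ)).abs
        (Eventually.of_forall fun _ => abs_nonneg _)).trans ?_
      have h7 : ∫ x, |((fun x => s n t x) - fun x => s n τ x) x| ∂mu1
          = ∫ x, |s n τ x - s n t x| ∂mu1 := by
        congr 1; ext x; rw [abs_sub_comm]; rfl
      linarith [h7.le]
    calc _ ≤ h⁻¹ * ((ε n + ∫ τ in t..(t+h), w τ) * |t + h - t|) :=
          mul_le_mul_of_nonneg_left this (inv_pos.2 hpos).le
      _ = _ := by rw [add_sub_cancel_left, abs_of_pos hpos]; field_simp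
  rw [Real.dist_eq] at *
  rw [intervalIntegral.integral_interval_sub_left (hfli _ _) (hfli _ _)] at h1
  simp only [smul_eq_mul, sub_zero] at *
  have k2' := abs_lt.1 k2
  rw [abs_lt] at *
  rw [abs_le] at k3
  constructor <;> linarith [k3.1, k3.2, h1.1, h1.2, k1.1, k1.2]

end

section
lemma sec_meas {q : ℝ → ℝ → ℝ} (hq : Measurable (fun p : ℝ × ℝ => q p.1 p.2)) (B : Set ℝ) :
    Measurable (fun t => ∫ x in B, q t x ∂mu1) :=
  (StronglyMeasurable.integral_prod_right' (f := fun p : ℝ × ℝ => q p.1 p.2)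
      hq.stronglyMeasurable).measurable

lemma sec_bd (B : Set ℝ) {q : ℝ → ℝ} (hq : ∀ x, |q x| ≤ 1) : |∫ x in B, q x ∂mu1| ≤ 1 := by
  have := norm_setIntegral_le_of_norm_le_const (s := B) (μ := mu1) (f := q) (C := 1)
    (measure_lt_top _ _) (fun x _ => hq x)
  refine this.trans ?_
  rw [one_mul]; exact measureReal_le_one

lemma prod_weak {T : ℝ} {s i : ℕ → ℝ → ℝ → ℝ} {sl il : ℝ → ℝ → ℝ}
    (hsm : ∀ n, Measurable (fun p : ℝ × ℝ => s n p.1 p.2))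
    (hslm : Measurable (fun p : ℝ × ℝ => sl p.1 p.2))
    (hs1 : ∀ n t x, |s n t x| ≤ 1) (hsl1 : ∀ t x, |sl t x| ≤ 1)
    (him : ∀ n, Measurable (fun p : ℝ × ℝ => i n p.1 p.2))
    (hilm : Measurable (fun p : ℝ × ℝ => il p.1 p.2))
    (hi1 : ∀ n t x, |i n t x| ≤ 1) (hil1 : ∀ t x, |il t x| ≤ 1)
    (hconv : ∀ E, MeasurableSet E → Tendsto (fun n => ∫ p in E, s n p.1 p.2 ∂(mu2 T)) atTop
      (nhds (∫ p in E, sl p.1 p.2 ∂(mu2 T))))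
    (hconvi : ∀ E, MeasurableSet E → Tendsto (fun n => ∫ p in E, i n p.1 p.2 ∂(mu2 T)) atTop
      (nhds (∫ p in E, il p.1 p.2 ∂(mu2 T))))
    {w : ℝ → ℝ} (hw : IntegrableOn w (Icc 0 T)) {ε : ℕ → ℝ} (hε : Tendsto ε atTop (nhds 0))
    (hw0 : ∀ t, 0 ≤ w t)
    (hequi : ∀ n t' t, 0 ≤ t' → t' ≤ t → t ≤ T →
      ∫ x, |s n t x - s n t' x| ∂mu1 ≤ ε n + ∫ τ in t'..t, w τ)
    {H : ℝ × ℝ × ℝ → ℝ} (hH : Integrable H (mu3 T)) :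
    Tendsto (fun n => ∫ p, (s n p.1 p.2.1 * i n p.1 p.2.2) * H p ∂(mu3 T)) atTop
      (nhds (∫ p, (sl p.1 p.2.1 * il p.1 p.2.2) * H p ∂(mu3 T))) := by
  have hpm : ∀ {a b : ℝ → ℝ → ℝ}, Measurable (fun p : ℝ × ℝ => a p.1 p.2) →
      Measurable (fun p : ℝ × ℝ => b p.1 p.2) →
      Measurable (fun p : ℝ × ℝ × ℝ => a p.1 p.2.1 * b p.1 p.2.2) := by
    intro a b ha hb
    exact (ha.comp (f := fun p : ℝ × ℝ × ℝ => (p.1, p.2.1)) (by fun_prop)).mul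
      (hb.comp (f := fun p : ℝ × ℝ × ℝ => (p.1, p.2.2)) (by fun_prop))
  have hpb : ∀ {a b : ℝ → ℝ → ℝ}, (∀ t x, |a t x| ≤ 1) → (∀ t x, |b t x| ≤ 1) →
      ∀ p : ℝ × ℝ × ℝ, |a p.1 p.2.1 * b p.1 p.2.2| ≤ 1 := by
    intro a b ha hb p
    rw [abs_mul]
    exact mul_le_one₀ (ha _ _) (abs_nonneg _) (hb _ _)
  have hbox : ∀ A B C : Set ℝ, MeasurableSet A → MeasurableSet B → MeasurableSet C →
      Tendsto (fun n => ∫ p in A ×ˢ (B ×ˢ C), s n p.1 p.2.1 * i n p.1 p.2.2 ∂(mu3 T)) atTop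
      (nhds (∫ p in A ×ˢ (B ×ˢ C), sl p.1 p.2.1 * il p.1 p.2.2 ∂(mu3 T))) := by
    intro A B C hA hB hC
    have key : ∀ {a b : ℝ → ℝ → ℝ}, Measurable (fun p : ℝ × ℝ => a p.1 p.2) →
      Measurable (fun p : ℝ × ℝ => b p.1 p.2) → (∀ t x, |a t x| ≤ 1) → (∀ t x, |b t x| ≤ 1) →
      ∫ p in A ×ˢ (B ×ˢ C), a p.1 p.2.1 * b p.1 p.2.2 ∂(mu3 T)
        = ∫ t in A, (∫ x in B, a t x ∂mu1) * (∫ y in C, b t y ∂mu1) ∂(muT T) := by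
      intro a b ha hb ha1 hb1
      rw [setIntegral_prod _ (bdd_int (hpm ha hb) (hpb ha1 hb1)).integrableOn]
      congr 1; ext t
      exact setIntegral_prod_mul (μ := mu1) (ν := mu1) (fun x => a t x) (fun y => b t y) B C
    rw [key hslm hilm hsl1 hil1]
    simp only [fun n => key (hsm n) (him n) (hs1 n) (hi1 n)]
    have hst := strong1 hsm hslm hs1 hsl1 hconv hw hε hw0 hequi hB
    -- first part
    have p1 : Tendsto (fun n => ∫ t in A, ((∫ x in B, s n t x ∂mu1) - ∫ x in B, sl t x ∂mu1)
        * (∫ y in C, i n t y ∂mu1) ∂(muT T)) atTop (nhds (∫ t in A, (0:ℝ) ∂(muT T))) := by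
      refine tendsto_integral_of_dominated_convergence (fun _ => 2) ?_ ?_ ?_ ?_
      · intro n
        exact (((sec_meas (hsm n) B).sub (sec_meas hslm B)).mul (sec_meas (him n) C)).aestronglyMeasurable
      · exact integrable_const _
      · intro n
        refine Eventually.of_forall fun t => ?_
        rw [Real.norm_eq_abs, abs_mul]
        have h1 := sec_bd B (hs1 n t)
        have h2 := sec_bd B (hsl1 t)
        have h3 := sec_bd C (hi1 n t)
        have h4 := abs_sub (∫ x in B, s n t x ∂mu1) (∫ x in B, sl t x ∂mu1)
        calc _ ≤ (2:ℝ) * 1 := mul_le_mul (by linarith) h3 (abs_nonneg _) (by norm_num)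
          _ = 2 := by norm_num
      · filter_upwards [ae_restrict_of_ae hst] with t ht
        have h5 : Tendsto (fun n => (∫ x in B, s n t x ∂mu1) - ∫ x in B, sl t x ∂mu1) atTop (nhds 0) := by
          simpa using ht.sub_const (∫ x in B, sl t x ∂mu1)
        have h6 := h5.abs
        rw [abs_zero] at h6
        refine squeeze_zero_norm (fun n => ?_) h6
        rw [Real.norm_eq_abs, abs_mul]
        exact mul_le_of_le_one_right (abs_nonneg _) (sec_bd C (hi1 n t))
    -- second part
    have key2 : ∀ {b : ℝ → ℝ → ℝ}, Measurable (fun p : ℝ × ℝ => b p.1 p.2) →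
        (∀ t x, |b t x| ≤ 1) →
        ∫ q, b q.1 q.2 * (A ×ˢ C).indicator (fun q : ℝ × ℝ => ∫ x in B, sl q.1 x ∂mu1) q ∂(mu2 T)
        = ∫ t in A, (∫ x in B, sl t x ∂mu1) * (∫ y in C, b t y ∂mu1) ∂(muT T) := by
      intro b hb hb1
      have e1 : (fun q : ℝ × ℝ => b q.1 q.2 *
          (A ×ˢ C).indicator (fun q : ℝ × ℝ => ∫ x in B, sl q.1 x ∂mu1) q)
          = (A ×ˢ C).indicator (fun q : ℝ × ℝ => (∫ x in B, sl q.1 x ∂mu1) * b q.1 q.2) := by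
        ext q
        by_cases hq : q ∈ A ×ˢ C
        · rw [indicator_of_mem hq, indicator_of_mem hq, mul_comm]
        · rw [indicator_of_notMem hq, indicator_of_notMem hq, mul_zero]
      rw [e1, integral_indicator (hA.prod hC), setIntegral_prod]
      · simp only [integral_const_mul]
      · refine (bdd_int (C := 1) (((sec_meas hslm B).comp measurable_fst).mul hb) ?_).integrableOn
        intro p
        simp only [Function.comp, Pi.mul_apply]
        rw [abs_mul]
        exact mul_le_one₀ (sec_bd B (hsl1 _)) (abs_nonneg _) (hb1 _ _)
    have p2 := weak_ext (mu2 T) (fun n p => i n p.1 p.2) (fun p => il p.1 p.2) 1 him hilm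
      (fun n p => hi1 n _ _) (fun p => hil1 _ _) hconvi
      ((A ×ˢ C).indicator (fun q : ℝ × ℝ => ∫ x in B, sl q.1 x ∂mu1))
      ((bdd_int ((sec_meas hslm B).comp measurable_fst)
        (fun p => sec_bd B (hsl1 p.1))).indicator (hA.prod hC))
    simp only [key2 hilm hil1, fun n => key2 (him n) (hi1 n)] at p2
    have p3 := p1.add p2
    simp only [integral_zero, zero_add] at p3
    refine p3.congr fun n => ?_
    have bi : ∀ {a b : ℝ → ℝ → ℝ}, Measurable (fun p : ℝ × ℝ => a p.1 p.2) →
      Measurable (fun p : ℝ × ℝ => b p.1 p.2) → (∀ t x, |a t x| ≤ 1) → (∀ t x, |b t x| ≤ 1) →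
      Integrable (fun t => (∫ x in B, a t x ∂mu1) * (∫ y in C, b t y ∂mu1)) ((muT T).restrict A) := by
      intro a b ha hb ha1 hb1
      refine bdd_int (C := 1) ((sec_meas ha B).mul (sec_meas hb C)) fun t => ?_
      rw [abs_mul]
      exact mul_le_one₀ (sec_bd B (ha1 _)) (abs_nonneg _) (sec_bd C (hb1 _))
    simp only [sub_mul]
    rw [integral_sub (bi (hsm n) (him n) (hs1 n) (hi1 n)) (bi hslm (him n) hsl1 (hi1 n))]
    ring
  have hE := pi_ext (mu3 T) (fun n p => s n p.1 p.2.1 * i n p.1 p.2.2)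
    (fun p => sl p.1 p.2.1 * il p.1 p.2.2) 1 (fun n => hpm (hsm n) (him n)) (hpm hslm hilm)
    (fun n => hpb (hs1 n) (hi1 n)) (hpb hsl1 hil1)
    (image2 (· ×ˢ ·) {s | MeasurableSet s} (image2 (· ×ˢ ·) {s | MeasurableSet s} {s | MeasurableSet s}))
    (generateFrom_eq_prod MeasurableSpace.generateFrom_measurableSet generateFrom_prod
      isCountablySpanning_measurableSet
      (isCountablySpanning_measurableSet.prod isCountablySpanning_measurableSet)).symm
    (MeasurableSpace.isPiSystem_measurableSet.prod isPiSystem_prod)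
    (by simpa using hbox univ univ univ .univ .univ .univ)
    (by
      rintro - ⟨s, hs, -, ⟨t, ht, u, hu, rfl⟩, rfl⟩
      exact hbox s t u hs ht hu)
  exact weak_ext (mu3 T) _ _ 1 (fun n => hpm (hsm n) (him n)) (hpm hslm hilm)
    (fun n => hpb (hs1 n) (hi1 n)) (hpb hsl1 hil1) hE H hH

end

section
abbrev Meas2 (f : ℝ → ℝ → ℝ) : Prop := Measurable (fun p : ℝ × ℝ => f p.1 p.2)
abbrev Meas3 (f : ℝ → ℝ → ℝ → ℝ) : Prop := Measurable (fun p : ℝ × ℝ × ℝ => f p.1 p.2.1 p.2.2)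

lemma Meas2.xx {f : ℝ → ℝ → ℝ} (h : Meas2 f) : Measurable (fun p : ℝ × ℝ × ℝ => f p.1 p.2.1) :=
  h.comp (f := fun p : ℝ × ℝ × ℝ => (p.1, p.2.1)) (by fun_prop)

lemma Meas2.yy {f : ℝ → ℝ → ℝ} (h : Meas2 f) : Measurable (fun p : ℝ × ℝ × ℝ => f p.1 p.2.2) :=
  h.comp (f := fun p : ℝ × ℝ × ℝ => (p.1, p.2.2)) (by fun_prop)

lemma Meas2.sec {f : ℝ → ℝ → ℝ} (h : Meas2 f) (t : ℝ) : Measurable (f t) :=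
  h.comp (f := fun x : ℝ => (t, x)) (by fun_prop)

lemma Meas2.sec' {f : ℝ → ℝ → ℝ} (h : Meas2 f) (x : ℝ) : Measurable (fun t => f t x) :=
  h.comp (f := fun t : ℝ => (t, x)) (by fun_prop)

lemma Meas3.sec {f : ℝ → ℝ → ℝ → ℝ} (h : Meas3 f) (t x : ℝ) : Measurable (f t x) :=
  h.comp (f := fun y : ℝ => (t, x, y)) (by fun_prop)

lemma Meas3.int {H : ℝ → ℝ → ℝ → ℝ} (h : Meas3 H) : Meas2 (fun t x => ∫ y, H t x y ∂mu1) :=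
  (StronglyMeasurable.integral_prod_right' (f := fun p : (ℝ × ℝ) × ℝ => H p.1.1 p.1.2 p.2)
      (h.comp (f := fun p : (ℝ × ℝ) × ℝ => (p.1.1, p.1.2, p.2)) (by fun_prop)).stronglyMeasurable).measurable

lemma mp_yy (T : ℝ) : MeasurePreserving (fun p : ℝ × ℝ × ℝ => (p.1, p.2.2)) (mu3 T) (mu2 T) :=
  (MeasurePreserving.id (muT T)).prod (measurePreserving_snd (μ := mu1) (ν := mu1))

lemma mp_xx (T : ℝ) : MeasurePreserving (fun p : ℝ × ℝ × ℝ => (p.1, p.2.1)) (mu3 T) (mu2 T) :=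
  (MeasurePreserving.id (muT T)).prod (measurePreserving_fst (μ := mu1) (ν := mu1))

lemma int_yy {T : ℝ} {f : ℝ → ℝ → ℝ} (h : Meas2 f) :
    ∫ p, f p.1 p.2.2 ∂(mu3 T) = ∫ q, f q.1 q.2 ∂(mu2 T) := by
  have := integral_map (μ := mu3 T) (mp_yy T).measurable.aemeasurable
    (f := fun q : ℝ × ℝ => f q.1 q.2) h.aestronglyMeasurable
  rw [(mp_yy T).map_eq] at this
  exact this.symm

lemma ind_int {T t' t : ℝ} (h0 : 0 ≤ t') (h1 : t' ≤ t) (h2 : t ≤ T) (f : ℝ → ℝ) :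
    ∫ τ, (Icc t' t).indicator (fun _ => (1:ℝ)) τ * f τ ∂(muT T) = ∫ τ in t'..t, f τ := by
  have : (fun τ => (Icc t' t).indicator (fun _ => (1:ℝ)) τ * f τ) = (Icc t' t).indicator f := by
    ext τ; by_cases h : τ ∈ Icc t' t <;> simp [h]
  rw [intervalIntegral.integral_of_le h1, ← integral_Icc_eq_integral_Ioc, this,
    setIntegral_indicator measurableSet_Icc, inter_eq_right.2 (Icc_subset_Icc h0 h2)]

lemma incr {T M C : ℝ} (hM : 0 ≤ M) {u F : ℝ → ℝ → ℝ} {u0 : ℝ → ℝ} {w : ℝ → ℝ → ℝ → ℝ}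
    (hum : Meas2 u) (hub : ∀ t x, |u t x| ≤ 1)
    (hFm : Meas2 F) (hwm : Meas3 w) (hw0 : ∀ t x y, 0 ≤ w t x y) (hwC : ∀ t x y, w t x y ≤ C)
    (hF : ∀ t x, |F t x| ≤ M * ∫ y, w t x y ∂mu1)
    (heq : ∀ᵐ x ∂mu1, ∀ t ∈ Icc 0 T, u t x = u0 x + ∫ τ in (0:ℝ)..t, F τ x)
    {t' t : ℝ} (h0 : 0 ≤ t') (h1 : t' ≤ t) (h2 : t ≤ T) :
    ∫ x, |u t x - u t' x| ∂mu1 ≤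
      M * ∫ p, (Icc t' t).indicator (fun _ => (1:ℝ)) p.1 * w p.1 p.2.1 p.2.2 ∂(mu3 T) := by
  have hwb : ∀ t x y, |w t x y| ≤ C := fun t x y => by rw [abs_of_nonneg (hw0 _ _ _)]; exact hwC _ _ _
  have hwi : Integrable (fun p : ℝ × ℝ × ℝ => w p.1 p.2.1 p.2.2) (mu3 T) :=
    bdd_int hwm (fun p => hwb _ _ _)
  have hind : Measurable ((Icc t' t).indicator (fun _ => (1:ℝ))) :=
    measurable_const.indicator measurableSet_Icc
  have hindb : ∀ τ, |(Icc t' t).indicator (fun _ => (1:ℝ)) τ| ≤ 1 := by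
    intro τ; by_cases h : τ ∈ Icc t' t <;> simp [h]
  have hGm := hwm.int
  have hGb : ∀ t x, |∫ y, w t x y ∂mu1| ≤ C := by
    intro t x
    have := norm_integral_le_of_norm_le_const (μ := mu1) (f := fun y => w t x y) (C := C)
      (Eventually.of_forall fun y => hwb t x y)
    simpa using this
  have e1 := (red3 (T := T) (H := fun t0 x y => (Icc t' t).indicator (fun _ => (1:ℝ)) t0 * w t0 x y)
    (bdd_mul_int (hind.comp measurable_fst) (fun p => hindb p.1) hwi))
  rw [← e1.2, integral_prod_symm _ e1.1]
  simp only [integral_const_mul]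
  rw [← integral_const_mul]
  apply integral_mono_ae (μ := mu1) (E := ℝ)
  · exact bdd_int (C := 2) (measurable_norm.comp ((hum.sec t).sub (hum.sec t'))) (fun x => by
      simp only [Function.comp, Pi.sub_apply, Real.norm_eq_abs, abs_abs]
      linarith [abs_sub (u t x) (u t' x), hub t x, hub t' x])
  · have := e1.1.integral_prod_right
    simp only [integral_const_mul] at this
    exact this.const_mul M
  · filter_upwards [heq] with x hx
    rw [hx t ⟨by linarith, h2⟩, hx t' ⟨h0, by linarith⟩, add_sub_add_left_eq_sub]
    have hFi : ∀ a b, IntervalIntegrable (fun τ => F τ x) volume a b := by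
      intro a b
      rw [intervalIntegrable_iff]
      have : IsFiniteMeasure (volume.restrict (uIoc a b)) := by unfold uIoc; infer_instance
      exact bdd_int (μ := volume.restrict (uIoc a b)) (C := M * C) (hFm.sec' x) (fun t =>
        (hF t x).trans (mul_le_mul_of_nonneg_left ((le_abs_self _).trans (hGb t x)) hM))
    rw [intervalIntegral.integral_interval_sub_left (hFi _ _) (hFi _ _)]
    have e2 : ∫ τ, (Icc t' t).indicator (fun _ => (1:ℝ)) τ * ∫ y, w τ x y ∂mu1 ∂(muT T)
        = ∫ τ in t'..t, ∫ y, w τ x y ∂mu1 := by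
      exact ind_int h0 h1 h2 _
    rw [e2, ← intervalIntegral.integral_const_mul]
    refine (intervalIntegral.abs_integral_le_integral_abs h1).trans ?_
    refine intervalIntegral.integral_mono_on h1 (hFi _ _).abs ?_ (fun τ _ => hF τ x)
    refine IntervalIntegrable.const_mul ?_ M
    rw [intervalIntegrable_iff]
    have : IsFiniteMeasure (volume.restrict (uIoc t' t)) := by unfold uIoc; infer_instance
    exact bdd_int (μ := volume.restrict (uIoc t' t)) (hGm.sec' x) (fun t => hGb t x)

/-- mass of the limit kernel -/
lemma incr2 {T C : ℝ} {w W : ℝ → ℝ → ℝ → ℝ} (hwm : Meas3 w) (hwb : ∀ t x y, |w t x y| ≤ C)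
    (hWm : Meas3 W) (hW : Integrable (fun p : ℝ × ℝ × ℝ => W p.1 p.2.1 p.2.2) (mu3 T))
    {t' t : ℝ} (h0 : 0 ≤ t') (h1 : t' ≤ t) (h2 : t ≤ T) :
    ∫ p, (Icc t' t).indicator (fun _ => (1:ℝ)) p.1 * w p.1 p.2.1 p.2.2 ∂(mu3 T) ≤
      4 * ∫ τ, cutNorm (fun x y => w τ x y - W τ x y) ∂(muT T)
      + ∫ τ in t'..t, ∫ q, |W τ q.1 q.2| ∂(mu1.prod mu1) := by
  have hwi : Integrable (fun p : ℝ × ℝ × ℝ => w p.1 p.2.1 p.2.2) (mu3 T) :=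
    bdd_int hwm (fun p => hwb _ _ _)
  have hind : Measurable ((Icc t' t).indicator (fun _ => (1:ℝ))) :=
    measurable_const.indicator measurableSet_Icc
  have hindb : ∀ τ, |(Icc t' t).indicator (fun _ => (1:ℝ)) τ| ≤ 1 := by
    intro τ; by_cases h : τ ∈ Icc t' t <;> simp [h]
  have hind0 : ∀ τ, 0 ≤ (Icc t' t).indicator (fun _ => (1:ℝ)) τ := by
    intro τ; by_cases h : τ ∈ Icc t' t <;> simp [h]
  have c := cut_main (muT T) (U := fun t x y => w t x y - W t x y) (hwm.sub hWm) (hwi.sub hW)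
    (f := fun t0 _ => (Icc t' t).indicator (fun _ => (1:ℝ)) t0) (g := fun _ _ => 1)
    (hind.comp measurable_fst) measurable_const (fun t x => hindb t) (fun t x => by simp)
  simp only [one_mul] at c
  have c := (abs_le.1 c).2
  have i1 : Integrable (fun p : ℝ × ℝ × ℝ => (Icc t' t).indicator (fun _ => (1:ℝ)) p.1 * w p.1 p.2.1 p.2.2) (mu3 T) :=
    bdd_mul_int (hind.comp measurable_fst) (fun p => hindb p.1) hwi
  have i2 : Integrable (fun p : ℝ × ℝ × ℝ => (Icc t' t).indicator (fun _ => (1:ℝ)) p.1 * W p.1 p.2.1 p.2.2) (mu3 T) :=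
    bdd_mul_int (hind.comp measurable_fst) (fun p => hindb p.1) hW
  have i3 : Integrable (fun p : ℝ × ℝ × ℝ => (Icc t' t).indicator (fun _ => (1:ℝ)) p.1 * |W p.1 p.2.1 p.2.2|) (mu3 T) :=
    bdd_mul_int (hind.comp measurable_fst) (fun p => hindb p.1) hW.abs
  have e1 : ∫ p, (Icc t' t).indicator (fun _ => (1:ℝ)) p.1 * (w p.1 p.2.1 p.2.2 - W p.1 p.2.1 p.2.2) ∂(mu3 T)
      = ∫ p, (Icc t' t).indicator (fun _ => (1:ℝ)) p.1 * w p.1 p.2.1 p.2.2 ∂(mu3 T)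
      - ∫ p, (Icc t' t).indicator (fun _ => (1:ℝ)) p.1 * W p.1 p.2.1 p.2.2 ∂(mu3 T) := by
    rw [← integral_sub i1 i2]; simp only [mul_sub]
  have e2 : ∫ p, (Icc t' t).indicator (fun _ => (1:ℝ)) p.1 * W p.1 p.2.1 p.2.2 ∂(mu3 T) ≤
      ∫ p, (Icc t' t).indicator (fun _ => (1:ℝ)) p.1 * |W p.1 p.2.1 p.2.2| ∂(mu3 T) :=
    integral_mono i2 i3 (fun p => mul_le_mul_of_nonneg_left (le_abs_self _) (hind0 _))
  have e3 : ∫ p, (Icc t' t).indicator (fun _ => (1:ℝ)) p.1 * |W p.1 p.2.1 p.2.2| ∂(mu3 T)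
      = ∫ τ in t'..t, ∫ q, |W τ q.1 q.2| ∂(mu1.prod mu1) := by
    rw [integral_prod _ i3]
    simp only [integral_const_mul]
    exact ind_int h0 h1 h2 _
  linarith

end

section
lemma abs_le_one_of {a : ℝ} (h0 : 0 ≤ a) (h1 : a ≤ 1) : |a| ≤ 1 := by rwa [abs_of_nonneg h0]

lemma D1_bound {T K M : ℝ} (hK : 0 < K) (hM : 0 < M) {s i b Φ : ℝ → ℝ → ℝ} {w W : ℝ → ℝ → ℝ → ℝ}
    (hs : Meas2 s) (hi : Meas2 i) (hb : Meas2 b) (hΦ : Meas2 Φ) (hw : Meas3 w) (hW : Meas3 W)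
    (hs1 : ∀ t x, |s t x| ≤ 1) (hi1 : ∀ t x, |i t x| ≤ 1) (hb1 : ∀ t x, |b t x| ≤ M)
    (hΦ1 : ∀ t x, |Φ t x| ≤ K)
    (hwi : Integrable (fun p : ℝ × ℝ × ℝ => w p.1 p.2.1 p.2.2) (mu3 T))
    (hWi : Integrable (fun p : ℝ × ℝ × ℝ => W p.1 p.2.1 p.2.2) (mu3 T)) :
    |∫ p, (s p.1 p.2.1 * i p.1 p.2.2) * (Φ p.1 p.2.1 * (b p.1 p.2.2 *
      (w p.1 p.2.1 p.2.2 - W p.1 p.2.1 p.2.2))) ∂(mu3 T)| ≤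
      K * M * (4 * ∫ τ, cutNorm (fun x y => w τ x y - W τ x y) ∂(muT T)) := by
  have c := cut_main (muT T) (U := fun t x y => w t x y - W t x y) (hw.sub hW) (hwi.sub hWi)
    (f := fun t x => s t x * (Φ t x * K⁻¹)) (g := fun t x => i t x * (b t x * M⁻¹))
    (hs.mul (hΦ.mul_const _)) (hi.mul (hb.mul_const _))
    (fun t x => by
      rw [abs_mul, abs_mul, abs_of_pos (inv_pos.2 hK)]
      refine mul_le_one₀ (hs1 _ _) (by positivity) ?_
      rw [← div_eq_mul_inv, div_le_one hK]; exact hΦ1 _ _)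
    (fun t x => by
      rw [abs_mul, abs_mul, abs_of_pos (inv_pos.2 hM)]
      refine mul_le_one₀ (hi1 _ _) (by positivity) ?_
      rw [← div_eq_mul_inv, div_le_one hM]; exact hb1 _ _)
  have e : ∀ p : ℝ × ℝ × ℝ, (s p.1 p.2.1 * i p.1 p.2.2) * (Φ p.1 p.2.1 * (b p.1 p.2.2 *
      (w p.1 p.2.1 p.2.2 - W p.1 p.2.1 p.2.2))) = K * M * ((s p.1 p.2.1 * (Φ p.1 p.2.1 * K⁻¹)) *
      ((i p.1 p.2.2 * (b p.1 p.2.2 * M⁻¹)) * (w p.1 p.2.1 p.2.2 - W p.1 p.2.1 p.2.2))) := by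
    intro p; field_simp
  simp only [e]
  rw [integral_const_mul, abs_mul, abs_of_pos (mul_pos hK hM)]
  exact mul_le_mul_of_nonneg_left c (mul_pos hK hM).le

lemma D2_tendsto {T K M : ℝ} {s i b : ℕ → ℝ → ℝ → ℝ} {β Φ : ℝ → ℝ → ℝ}
    {W : ℝ → ℝ → ℝ → ℝ}
    (hs1 : ∀ n t x, |s n t x| ≤ 1) (hi1 : ∀ n t x, |i n t x| ≤ 1)
    (hb : ∀ n, Meas2 (b n)) (hβ : Meas2 β)
    (hb1 : ∀ n t x, |b n t x| ≤ M)
    {C : ℝ} (hβ1 : ∀ t x, |β t x| ≤ C)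
    (hΦ1 : ∀ t x, |Φ t x| ≤ K)
    (hWi : Integrable (fun p : ℝ × ℝ × ℝ => W p.1 p.2.1 p.2.2) (mu3 T))
    (hL : Tendsto (fun n => ∫ p, |b n p.1 p.2 - β p.1 p.2| ∂(mu2 T)) atTop (nhds 0)) :
    Tendsto (fun n => ∫ p, (s n p.1 p.2.1 * i n p.1 p.2.2) * (Φ p.1 p.2.1 *
      ((b n p.1 p.2.2 - β p.1 p.2.2) * W p.1 p.2.1 p.2.2)) ∂(mu3 T)) atTop (nhds 0) := by
  have habs : ∀ n, Meas2 (fun t y => |b n t y - β t y|) := fun n => measurable_norm.comp ((hb n).sub hβ)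
  have habd : ∀ n t y, |b n t y - β t y| ≤ M + C := fun n t y =>
    (abs_sub _ _).trans (add_le_add (hb1 n t y) (hβ1 t y))
  have hK : 0 ≤ K := (abs_nonneg _).trans (hΦ1 0 0)
  have hMC : 0 ≤ M + C := (abs_nonneg _).trans (habd 0 0 0)
  have h := weak_ext (mu3 T) (fun n p => |b n p.1 p.2.2 - β p.1 p.2.2|) (fun _ => 0) (M + C)
    (fun n => (habs n).yy) measurable_const (fun n p => by rw [abs_abs]; exact habd n _ _)
    (fun p => by simpa using hMC)
    (by
      intro E hE
      simp only [integral_zero]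
      refine squeeze_zero (fun n => integral_nonneg fun _ => abs_nonneg _) (fun n => ?_) hL
      rw [← int_yy (habs n)]
      refine setIntegral_le_integral (bdd_int (habs n).yy (C := M + C) fun p => ?_)
        (Eventually.of_forall fun _ => abs_nonneg _)
      rw [abs_abs]; exact habd n _ _)
    (fun p => |W p.1 p.2.1 p.2.2|) hWi.abs
  simp only [zero_mul, integral_zero] at h
  have h' := h.const_mul K
  rw [mul_zero] at h'
  refine squeeze_zero_norm (fun n => ?_) h'
  have hint : Integrable (fun p : ℝ × ℝ × ℝ => |b n p.1 p.2.2 - β p.1 p.2.2| * |W p.1 p.2.1 p.2.2|) (mu3 T) :=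
    bdd_mul_int (habs n).yy (fun p => by rw [abs_abs]; exact habd n _ _) hWi.abs
  rw [← integral_const_mul]
  refine norm_integral_le_of_norm_le (hint.const_mul K) (Eventually.of_forall fun p => ?_)
  rw [Real.norm_eq_abs, abs_mul, abs_mul, abs_mul, abs_mul]
  have a1 : |s n p.1 p.2.1| * |i n p.1 p.2.2| ≤ 1 := mul_le_one₀ (hs1 _ _ _) (abs_nonneg _) (hi1 _ _ _)
  have a2 := hΦ1 p.1 p.2.1
  calc _ ≤ 1 * (|Φ p.1 p.2.1| * (|b n p.1 p.2.2 - β p.1 p.2.2| * |W p.1 p.2.1 p.2.2|)) :=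
        mul_le_mul_of_nonneg_right a1 (by positivity)
    _ ≤ 1 * (K * (|b n p.1 p.2.2 - β p.1 p.2.2| * |W p.1 p.2.1 p.2.2|)) := by gcongr
    _ = _ := by ring

lemma trunc {T : ℝ} (hT : 0 < T) {φ : ℝ → ℝ → ℝ} (hφ : Continuous (fun p : ℝ × ℝ => φ p.1 p.2)) :
    ∃ (Φ : ℝ → ℝ → ℝ) (K : ℝ), 0 < K ∧ Meas2 Φ ∧ (∀ t x, |Φ t x| ≤ K) ∧
      ∀ᵐ p ∂(mu2 T), φ p.1 p.2 = Φ p.1 p.2 := by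
  obtain ⟨K, hK⟩ := (isCompact_Icc.prod isCompact_Icc : IsCompact (Icc 0 T ×ˢ Icc (0:ℝ) 1)).exists_bound_of_continuousOn
    hφ.continuousOn
  refine ⟨fun t x => φ (max 0 (min T t)) (max 0 (min 1 x)), max K 1, by positivity, ?_, ?_, ?_⟩
  · exact (hφ.comp (by fun_prop : Continuous (fun p : ℝ × ℝ => (max 0 (min T p.1), max 0 (min 1 p.2))))).measurable
  · intro t x
    refine le_trans ?_ (le_max_left _ _)
    exact hK (max 0 (min T t), max 0 (min 1 x)) ⟨⟨le_max_left _ _, max_le hT.le (min_le_left _ _)⟩,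
      ⟨le_max_left _ _, max_le zero_le_one (min_le_left _ _)⟩⟩
  · rw [mu2_eq]
    refine ae_restrict_of_forall_mem (measurableSet_Icc.prod measurableSet_Icc) fun p hp => ?_
    simp only
    rw [min_eq_right hp.1.2, min_eq_right hp.2.2, max_eq_right hp.1.1, max_eq_right hp.2.1]

structure Approx (T M : ℝ) (s i r b g : ℝ → ℝ → ℝ) (w : ℝ → ℝ → ℝ → ℝ) (s0 i0 r0 : ℝ → ℝ) : Prop where
  ms : Meas2 s
  mi : Meas2 i
  mr : Meas2 r
  mb : Meas2 b
  mg : Meas2 g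
  mw : Meas3 w
  ms0 : Measurable s0
  mi0 : Measurable i0
  mr0 : Measurable r0
  s_b : ∀ t x, 0 ≤ s t x ∧ s t x ≤ 1
  i_b : ∀ t x, 0 ≤ i t x ∧ i t x ≤ 1
  r_b : ∀ t x, 0 ≤ r t x ∧ r t x ≤ 1
  s0_b : ∀ x, 0 ≤ s0 x ∧ s0 x ≤ 1
  i0_b : ∀ x, 0 ≤ i0 x ∧ i0 x ≤ 1
  r0_b : ∀ x, 0 ≤ r0 x ∧ r0 x ≤ 1
  b_b : ∀ t x, 0 ≤ b t x ∧ b t x ≤ M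
  g_b : ∀ t x, 0 ≤ g t x ∧ g t x ≤ M
  w_b : ∃ C, ∀ t x y, 0 ≤ w t x y ∧ w t x y ≤ C
  es : ∀ᵐ x ∂mu1, ∀ t ∈ Icc 0 T, s t x = s0 x + ∫ τ in (0:ℝ)..t,
    -(s τ x * ∫ y, b τ y * w τ x y * i τ y ∂mu1)
  ei : ∀ᵐ x ∂mu1, ∀ t ∈ Icc 0 T, i t x = i0 x + ∫ τ in (0:ℝ)..t,
    (s τ x * (∫ y, b τ y * w τ x y * i τ y ∂mu1) - g τ x * i τ x)
  er : ∀ᵐ x ∂mu1, ∀ t ∈ Icc 0 T, r t x = r0 x + ∫ τ in (0:ℝ)..t, g τ x * i τ x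
  sum0 : ∀ᵐ x ∂mu1, s0 x + i0 x + r0 x = 1
  sum : ∀ᵐ p ∂(mu2 T), s p.1 p.2 + i p.1 p.2 + r p.1 p.2 = 1

variable {T M : ℝ} {s i r b g : ℝ → ℝ → ℝ} {w : ℝ → ℝ → ℝ → ℝ} {s0 i0 r0 : ℝ → ℝ}

lemma Approx.w_int (h : Approx T M s i r b g w s0 i0 r0) :
    Integrable (fun p : ℝ × ℝ × ℝ => w p.1 p.2.1 p.2.2) (mu3 T) := by
  obtain ⟨C, hC⟩ := h.w_b
  exact bdd_int h.mw (C := C) fun p => by rw [abs_of_nonneg (hC _ _ _).1]; exact (hC _ _ _).2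

lemma Approx.prodm (h : Approx T M s i r b g w s0 i0 r0) :
    Meas3 (fun t x y => b t y * w t x y * i t y) := (h.mb.yy.mul h.mw).mul h.mi.yy

lemma Approx.Gm (h : Approx T M s i r b g w s0 i0 r0) :
    Meas2 (fun t x => ∫ y, b t y * w t x y * i t y ∂mu1) := h.prodm.int

lemma Approx.bwi (h : Approx T M s i r b g w s0 i0 r0) (t x y : ℝ) :
    0 ≤ b t y * w t x y * i t y ∧ b t y * w t x y * i t y ≤ M * w t x y := by
  obtain ⟨C, hC⟩ := h.w_b
  have h1 := h.b_b t y
  have h2 := h.i_b t y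
  have h3 := hC t x y
  have h4 : b t y * w t x y ≤ M * w t x y := mul_le_mul_of_nonneg_right h1.2 h3.1
  have h5 := mul_nonneg h1.1 h3.1
  exact ⟨mul_nonneg h5 h2.1, (mul_le_of_le_one_right h5 h2.2).trans h4⟩

lemma Approx.wsec (h : Approx T M s i r b g w s0 i0 r0) (t x : ℝ) : Integrable (w t x) mu1 := by
  obtain ⟨C, hC⟩ := h.w_b
  exact bdd_int (h.mw.sec t x) (C := C) fun y => by rw [abs_of_nonneg (hC _ _ _).1]; exact (hC _ _ _).2

lemma Approx.G_b (h : Approx T M s i r b g w s0 i0 r0) (t x : ℝ) :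
    0 ≤ ∫ y, b t y * w t x y * i t y ∂mu1 ∧
    ∫ y, b t y * w t x y * i t y ∂mu1 ≤ M * ∫ y, w t x y ∂mu1 := by
  refine ⟨integral_nonneg fun y => (h.bwi t x y).1, ?_⟩
  rw [← integral_const_mul]
  exact integral_mono_of_nonneg (Eventually.of_forall fun y => (h.bwi t x y).1)
    ((h.wsec t x).const_mul M) (Eventually.of_forall fun y => (h.bwi t x y).2)

lemma Approx.G_bd (h : Approx T M s i r b g w s0 i0 r0) (hM : 0 < M) :
    ∃ C, ∀ t x, ∫ y, b t y * w t x y * i t y ∂mu1 ≤ C := by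
  obtain ⟨C, hC⟩ := h.w_b
  refine ⟨M * C, fun t x => (h.G_b t x).2.trans (mul_le_mul_of_nonneg_left ?_ hM.le)⟩
  have : ∫ y, w t x y ∂mu1 ≤ ∫ y, C ∂mu1 :=
    integral_mono (h.wsec t x) (integrable_const _) (fun y => (hC t x y).2)
  simpa using this

lemma Approx.sG_b (h : Approx T M s i r b g w s0 i0 r0) (t x : ℝ) :
    |s t x * ∫ y, b t y * w t x y * i t y ∂mu1| ≤ ∫ y, b t y * w t x y * i t y ∂mu1 := by
  rw [abs_mul, abs_of_nonneg (h.s_b t x).1, abs_of_nonneg (h.G_b t x).1]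
  exact mul_le_of_le_one_left (h.G_b t x).1 (h.s_b t x).2

lemma Approx.equi (h : Approx T M s i r b g w s0 i0 r0) (hM : 0 < M) {W : ℝ → ℝ → ℝ → ℝ}
    (hWm : Meas3 W) (hW : Integrable (fun p : ℝ × ℝ × ℝ => W p.1 p.2.1 p.2.2) (mu3 T))
    {t' t : ℝ} (h0 : 0 ≤ t') (h1 : t' ≤ t) (h2 : t ≤ T) :
    ∫ x, |s t x - s t' x| ∂mu1 ≤ M * (4 * ∫ τ, cutNorm (fun x y => w τ x y - W τ x y) ∂(muT T))
      + ∫ τ in t'..t, M * ∫ q, |W τ q.1 q.2| ∂(mu1.prod mu1) := by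
  obtain ⟨C, hC⟩ := h.w_b
  have a := incr (T := T) hM.le (u := s) h.ms (fun t x => abs_le_one_of (h.s_b t x).1 (h.s_b t x).2)
    (F := fun t x => -(s t x * ∫ y, b t y * w t x y * i t y ∂mu1)) (h.ms.mul h.Gm).neg h.mw
    (fun t x y => (hC t x y).1) (fun t x y => (hC t x y).2)
    (fun t x => by rw [abs_neg]; exact (h.sG_b t x).trans (h.G_b t x).2) h.es h0 h1 h2
  have c := incr2 (T := T) h.mw (C := C) (fun t x y => by rw [abs_of_nonneg (hC _ _ _).1]; exact (hC _ _ _).2)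
    hWm hW h0 h1 h2
  rw [intervalIntegral.integral_const_mul, ← mul_add]
  exact a.trans (mul_le_mul_of_nonneg_left c hM.le)

/-- weak formulations for an approximate solution with truncated test function in the lower order terms -/
lemma Approx.weak (h : Approx T M s i r b g w s0 i0 r0) (hT : 0 < T) (hM : 0 < M)
    {φ Φ : ℝ → ℝ → ℝ} {K : ℝ} (hφ : IsTest T φ) (hΦ : Meas2 Φ) (hΦb : ∀ t x, |Φ t x| ≤ K)
    (hae : ∀ᵐ p ∂(mu2 T), φ p.1 p.2 = Φ p.1 p.2) :
    (∫ p, s p.1 p.2 * deriv (fun τ => φ τ p.2) p.1 ∂(mu2 T)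
      - ∫ p, (s p.1 p.2.1 * i p.1 p.2.2) * (Φ p.1 p.2.1 * (b p.1 p.2.2 * w p.1 p.2.1 p.2.2)) ∂(mu3 T)
      + ∫ x, s0 x * φ 0 x ∂mu1 = 0) ∧
    (∫ p, i p.1 p.2 * deriv (fun τ => φ τ p.2) p.1 ∂(mu2 T)
      + ∫ p, (s p.1 p.2.1 * i p.1 p.2.2) * (Φ p.1 p.2.1 * (b p.1 p.2.2 * w p.1 p.2.1 p.2.2)) ∂(mu3 T)
      - ∫ p, i p.1 p.2 * (g p.1 p.2 * Φ p.1 p.2) ∂(mu2 T)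
      + ∫ x, i0 x * φ 0 x ∂mu1 = 0) ∧
    (∫ p, r p.1 p.2 * deriv (fun τ => φ τ p.2) p.1 ∂(mu2 T)
      + ∫ p, i p.1 p.2 * (g p.1 p.2 * Φ p.1 p.2) ∂(mu2 T)
      + ∫ x, r0 x * φ 0 x ∂mu1 = 0) := by
  obtain ⟨C, hC⟩ := h.G_bd hM
  have s1 := fun t x => abs_le_one_of (h.s_b t x).1 (h.s_b t x).2
  have i1 := fun t x => abs_le_one_of (h.i_b t x).1 (h.i_b t x).2
  have gi1 : ∀ t x, |g t x * i t x| ≤ M := fun t x => by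
    rw [abs_mul, abs_of_nonneg (h.g_b t x).1]
    exact (mul_le_of_le_one_right (h.g_b t x).1 (i1 t x)).trans (h.g_b t x).2
  have w1 := weak_form hT (u := s) (F := fun t x => -(s t x * ∫ y, b t y * w t x y * i t y ∂mu1))
    (C1 := 1) (C2 := C) (C3 := 1) h.ms (h.ms.mul h.Gm).neg h.ms0
    s1
    (fun t x => by rw [abs_neg]; exact (h.sG_b t x).trans (hC t x))
    (fun x => abs_le_one_of (h.s0_b x).1 (h.s0_b x).2) h.es hφ
  have w2 := weak_form hT (u := i) (F := fun t x => s t x * (∫ y, b t y * w t x y * i t y ∂mu1) - g t x * i t x)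
    (C1 := 1) (C2 := C + M) (C3 := 1) h.mi ((h.ms.mul h.Gm).sub (h.mg.mul h.mi)) h.mi0
    i1
    (fun t x => (abs_sub _ _).trans (add_le_add ((h.sG_b t x).trans (hC t x)) (gi1 t x)))
    (fun x => abs_le_one_of (h.i0_b x).1 (h.i0_b x).2) h.ei hφ
  have w3 := weak_form hT (u := r) (F := fun t x => g t x * i t x)
    (C1 := 1) (C2 := M) (C3 := 1) h.mr (h.mg.mul h.mi) h.mr0
    (fun t x => abs_le_one_of (h.r_b t x).1 (h.r_b t x).2) gi1
    (fun x => abs_le_one_of (h.r0_b x).1 (h.r0_b x).2) h.er hφ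
  have hrep : ∀ F : ℝ → ℝ → ℝ, ∫ p, F p.1 p.2 * φ p.1 p.2 ∂(mu2 T) = ∫ p, F p.1 p.2 * Φ p.1 p.2 ∂(mu2 T) := by
    intro F
    refine integral_congr_ae ?_
    filter_upwards [hae] with p hp; rw [hp]
  rw [hrep (fun t x => -(s t x * ∫ y, b t y * w t x y * i t y ∂mu1))] at w1
  rw [hrep (fun t x => s t x * (∫ y, b t y * w t x y * i t y ∂mu1) - g t x * i t x)] at w2
  rw [hrep (fun t x => g t x * i t x)] at w3
  have hΦi : Integrable (fun p : ℝ × ℝ => Φ p.1 p.2) (mu2 T) := bdd_int hΦ (fun p => hΦb _ _)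
  have hI : Integrable (fun p : ℝ × ℝ × ℝ => (s p.1 p.2.1 * i p.1 p.2.2) * (Φ p.1 p.2.1 * (b p.1 p.2.2 * w p.1 p.2.1 p.2.2))) (mu3 T) := by
    refine bdd_mul_int (C := 1) (h.ms.xx.mul h.mi.yy) (fun p => ?_) ?_
    · rw [abs_mul]; exact mul_le_one₀ (s1 _ _) (abs_nonneg _) (i1 _ _)
    · refine bdd_mul_int (C := K) hΦ.xx (fun p => hΦb _ _) ?_
      refine bdd_mul_int (C := M) h.mb.yy (fun p => ?_) h.w_int
      rw [abs_of_nonneg (h.b_b _ _).1]; exact (h.b_b _ _).2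
  have hR := (red3 (H := fun t x y => (s t x * i t y) * (Φ t x * (b t y * w t x y))) hI).2
  have hR2 : ∀ q : ℝ × ℝ, ∫ y, (s q.1 q.2 * i q.1 y) * (Φ q.1 q.2 * (b q.1 y * w q.1 q.2 y)) ∂mu1
      = s q.1 q.2 * (∫ y, b q.1 y * w q.1 q.2 y * i q.1 y ∂mu1) * Φ q.1 q.2 := by
    intro q
    rw [← integral_const_mul, ← integral_mul_const]
    congr 1; ext y; ring
  simp only [hR2] at hR
  have hgr : ∀ p : ℝ × ℝ, g p.1 p.2 * i p.1 p.2 * Φ p.1 p.2 = i p.1 p.2 * (g p.1 p.2 * Φ p.1 p.2) := by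
    intro p; ring
  refine ⟨?_, ?_, ?_⟩
  · rw [← hR]
    simp only [neg_mul, integral_neg] at w1
    linarith
  · rw [← hR]
    simp only [sub_mul] at w2
    rw [integral_sub] at w2
    · simp only [hgr] at w2; linarith
    · exact bdd_mul_int (C := C) (h.ms.mul h.Gm) (fun p => (h.sG_b _ _).trans (hC _ _)) hΦi
    · exact bdd_mul_int (C := M) (h.mg.mul h.mi) (fun p => gi1 _ _) hΦi
  · simp only [hgr] at w3; exact w3

end

section
/-- convergence of integrals over all measurable sets -/
def WConv {X : Type*} [MeasurableSpace X] (μ : Measure X) (Q : ℕ → X → ℝ) (Q0 : X → ℝ) : Prop :=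
  ∀ E, MeasurableSet E → Tendsto (fun n => ∫ x in E, Q n x ∂μ) atTop (nhds (∫ x in E, Q0 x ∂μ))

abbrev unc (f : ℝ → ℝ → ℝ) : ℝ × ℝ → ℝ := fun p => f p.1 p.2

lemma core1 {T M : ℝ} (hT : 0 < T) (hM : 0 < M)
    {s i r b g : ℕ → ℝ → ℝ → ℝ} {w : ℕ → ℝ → ℝ → ℝ → ℝ} {s0 i0 r0 : ℕ → ℝ → ℝ}
    (h : ∀ n, Approx T M (s n) (i n) (r n) (b n) (g n) (w n) (s0 n) (i0 n) (r0 n))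
    {W : ℝ → ℝ → ℝ → ℝ} (hWm : Meas3 W)
    (hW : Integrable (fun p : ℝ × ℝ × ℝ => W p.1 p.2.1 p.2.2) (mu3 T))
    (hcut : Tendsto (fun n => ∫ τ, cutNorm (fun x y => w n τ x y - W τ x y) ∂(muT T)) atTop (nhds 0))
    {β γ : ℝ → ℝ → ℝ} {C : ℝ} (hβm : Meas2 β) (hγm : Meas2 γ) (hβ : ∀ t x, |β t x| ≤ C)
    (hγ : ∀ t x, |γ t x| ≤ C)
    (hβL : Tendsto (fun n => ∫ p, |b n p.1 p.2 - β p.1 p.2| ∂(mu2 T)) atTop (nhds 0))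
    (hγL : Tendsto (fun n => ∫ p, |g n p.1 p.2 - γ p.1 p.2| ∂(mu2 T)) atTop (nhds 0))
    {sl il rl : ℝ → ℝ → ℝ} {sl0 il0 rl0 : ℝ → ℝ}
    (msl : Meas2 sl) (mil : Meas2 il) (mrl : Meas2 rl)
    (msl0 : Measurable sl0) (mil0 : Measurable il0) (mrl0 : Measurable rl0)
    (sl1 : ∀ t x, |sl t x| ≤ 1) (il1 : ∀ t x, |il t x| ≤ 1) (rl1 : ∀ t x, |rl t x| ≤ 1)
    (sl01 : ∀ x, |sl0 x| ≤ 1) (il01 : ∀ x, |il0 x| ≤ 1) (rl01 : ∀ x, |rl0 x| ≤ 1)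
    (cs : WConv (mu2 T) (fun n => unc (s n)) (unc sl)) (ci : WConv (mu2 T) (fun n => unc (i n)) (unc il))
    (cr : WConv (mu2 T) (fun n => unc (r n)) (unc rl))
    (cs0 : WConv mu1 s0 sl0) (ci0 : WConv mu1 i0 il0) (cr0 : WConv mu1 r0 rl0)
    {φ : ℝ → ℝ → ℝ} (hφ : IsTest T φ) :
    (∫ p, sl p.1 p.2 * deriv (fun τ => φ τ p.2) p.1 ∂(mu2 T)
      - ∫ p, (sl p.1 p.2.1 * il p.1 p.2.2) * (φ p.1 p.2.1 * (β p.1 p.2.2 * W p.1 p.2.1 p.2.2)) ∂(mu3 T)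
      + ∫ x, sl0 x * φ 0 x ∂mu1 = 0) ∧
    (∫ p, il p.1 p.2 * deriv (fun τ => φ τ p.2) p.1 ∂(mu2 T)
      + ∫ p, (sl p.1 p.2.1 * il p.1 p.2.2) * (φ p.1 p.2.1 * (β p.1 p.2.2 * W p.1 p.2.1 p.2.2)) ∂(mu3 T)
      - ∫ p, il p.1 p.2 * (γ p.1 p.2 * φ p.1 p.2) ∂(mu2 T)
      + ∫ x, il0 x * φ 0 x ∂mu1 = 0) ∧
    (∫ p, rl p.1 p.2 * deriv (fun τ => φ τ p.2) p.1 ∂(mu2 T)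
      + ∫ p, il p.1 p.2 * (γ p.1 p.2 * φ p.1 p.2) ∂(mu2 T)
      + ∫ x, rl0 x * φ 0 x ∂mu1 = 0) ∧
    Integrable (fun p : ℝ × ℝ × ℝ => (sl p.1 p.2.1 * il p.1 p.2.2) *
      (φ p.1 p.2.1 * (β p.1 p.2.2 * W p.1 p.2.1 p.2.2))) (mu3 T) ∧
    Integrable (fun p : ℝ × ℝ => il p.1 p.2 * (γ p.1 p.2 * φ p.1 p.2)) (mu2 T) := by
  obtain ⟨hφc, hφd, -, -⟩ := test_facts hφ
  obtain ⟨Φ, K, hK, hΦm, hΦb, hae⟩ := trunc hT hφc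
  have ss1 := fun n t x => abs_le_one_of ((h n).s_b t x).1 ((h n).s_b t x).2
  have ii1 := fun n t x => abs_le_one_of ((h n).i_b t x).1 ((h n).i_b t x).2
  have rr1 := fun n t x => abs_le_one_of ((h n).r_b t x).1 ((h n).r_b t x).2
  have bb1 : ∀ n t x, |b n t x| ≤ M := fun n t x => by
    rw [abs_of_nonneg ((h n).b_b t x).1]; exact ((h n).b_b t x).2
  have gg1 : ∀ n t x, |g n t x| ≤ M := fun n t x => by
    rw [abs_of_nonneg ((h n).g_b t x).1]; exact ((h n).g_b t x).2
  have hae3 : ∀ᵐ p ∂(mu3 T), φ p.1 p.2.1 = Φ p.1 p.2.1 :=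
    (mp_xx T).quasiMeasurePreserving.ae hae
  have r3 : ∫ p, (sl p.1 p.2.1 * il p.1 p.2.2) * (φ p.1 p.2.1 * (β p.1 p.2.2 * W p.1 p.2.1 p.2.2)) ∂(mu3 T)
      = ∫ p, (sl p.1 p.2.1 * il p.1 p.2.2) * (Φ p.1 p.2.1 * (β p.1 p.2.2 * W p.1 p.2.1 p.2.2)) ∂(mu3 T) := by
    refine integral_congr_ae ?_
    filter_upwards [hae3] with p hp; rw [hp]
  have r2 : ∫ p, il p.1 p.2 * (γ p.1 p.2 * φ p.1 p.2) ∂(mu2 T)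
      = ∫ p, il p.1 p.2 * (γ p.1 p.2 * Φ p.1 p.2) ∂(mu2 T) := by
    refine integral_congr_ae ?_
    filter_upwards [hae] with p hp; rw [hp]
  have siB : ∀ {a c : ℝ → ℝ → ℝ}, (∀ t x, |a t x| ≤ 1) → (∀ t x, |c t x| ≤ 1) →
      ∀ p : ℝ × ℝ × ℝ, |a p.1 p.2.1 * c p.1 p.2.2| ≤ 1 := by
    intro a c ha hc p
    rw [abs_mul]; exact mul_le_one₀ (ha _ _) (abs_nonneg _) (hc _ _)
  have hΦβW : Integrable (fun p : ℝ × ℝ × ℝ => Φ p.1 p.2.1 * (β p.1 p.2.2 * W p.1 p.2.1 p.2.2)) (mu3 T) :=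
    bdd_mul_int (C := K) hΦm.xx (fun p => hΦb _ _) (bdd_mul_int (C := C) hβm.yy (fun p => hβ _ _) hW)
  -- the nonlinear term
  have hnl : Tendsto (fun n => ∫ p, (s n p.1 p.2.1 * i n p.1 p.2.2) * (Φ p.1 p.2.1 *
      (b n p.1 p.2.2 * w n p.1 p.2.1 p.2.2)) ∂(mu3 T)) atTop
      (nhds (∫ p, (sl p.1 p.2.1 * il p.1 p.2.2) * (Φ p.1 p.2.1 * (β p.1 p.2.2 * W p.1 p.2.1 p.2.2)) ∂(mu3 T))) := by
    have hε : Tendsto (fun n => M * (4 * ∫ τ, cutNorm (fun x y => w n τ x y - W τ x y) ∂(muT T))) atTop (nhds 0) := by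
      simpa using (hcut.const_mul 4).const_mul M
    have P := prod_weak (T := T) (fun n => (h n).ms) msl ss1 sl1 (fun n => (h n).mi) mil ii1 il1 cs ci
      (w := fun τ => M * ∫ q, |W τ q.1 q.2| ∂(mu1.prod mu1))
      (hW.abs.integral_prod_left.const_mul M) hε
      (fun t => mul_nonneg hM.le (integral_nonneg fun _ => abs_nonneg _))
      (fun n t' t a1 a2 a3 => (h n).equi hM hWm hW a1 a2 a3) hΦβW
    have D1 : Tendsto (fun n => ∫ p, (s n p.1 p.2.1 * i n p.1 p.2.2) * (Φ p.1 p.2.1 * (b n p.1 p.2.2 *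
      (w n p.1 p.2.1 p.2.2 - W p.1 p.2.1 p.2.2))) ∂(mu3 T)) atTop (nhds 0) := by
      refine squeeze_zero_norm (fun n => D1_bound hK hM (h n).ms (h n).mi (h n).mb hΦm (h n).mw hWm (ss1 n) (ii1 n)
        (bb1 n) hΦb (h n).w_int hW) ?_
      simpa using (hcut.const_mul 4).const_mul (K * M)
    have D2 := D2_tendsto (T := T) ss1 ii1 (fun n => (h n).mb) hβm bb1 hβ hΦb hW hβL
    have S := (D1.add D2).add P
    rw [add_zero, zero_add] at S
    refine S.congr fun n => ?_
    have I1 : Integrable (fun p : ℝ × ℝ × ℝ => (s n p.1 p.2.1 * i n p.1 p.2.2) * (Φ p.1 p.2.1 * (b n p.1 p.2.2 *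
      (w n p.1 p.2.1 p.2.2 - W p.1 p.2.1 p.2.2)))) (mu3 T) :=
      bdd_mul_int (C := 1) ((h n).ms.xx.mul (h n).mi.yy) (siB (ss1 n) (ii1 n))
        (bdd_mul_int (C := K) hΦm.xx (fun p => hΦb _ _)
        (bdd_mul_int (C := M) (h n).mb.yy (fun p => bb1 n _ _) ((h n).w_int.sub hW)))
    have I2 : Integrable (fun p : ℝ × ℝ × ℝ => (s n p.1 p.2.1 * i n p.1 p.2.2) * (Φ p.1 p.2.1 *
      ((b n p.1 p.2.2 - β p.1 p.2.2) * W p.1 p.2.1 p.2.2))) (mu3 T) :=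
      bdd_mul_int (C := 1) ((h n).ms.xx.mul (h n).mi.yy) (siB (ss1 n) (ii1 n))
        (bdd_mul_int (C := K) hΦm.xx (fun p => hΦb _ _)
        (bdd_mul_int (C := M + C) ((h n).mb.yy.sub hβm.yy)
          (fun p => (abs_sub _ _).trans (add_le_add (bb1 n _ _) (hβ _ _))) hW))
    have I3 : Integrable (fun p : ℝ × ℝ × ℝ => (s n p.1 p.2.1 * i n p.1 p.2.2) * (Φ p.1 p.2.1 *
      (β p.1 p.2.2 * W p.1 p.2.1 p.2.2))) (mu3 T) :=
      bdd_mul_int (C := 1) ((h n).ms.xx.mul (h n).mi.yy) (siB (ss1 n) (ii1 n)) hΦβW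
    rw [← integral_add I1 I2]
    refine (integral_add (I1.add I2) I3).symm.trans ?_
    congr 1; ext p; simp only [Pi.add_apply]; ring
  -- the gamma term
  have hΦi : Integrable (fun p : ℝ × ℝ => Φ p.1 p.2) (mu2 T) := bdd_int hΦm (fun p => hΦb _ _)
  have hγΦ : Integrable (fun p : ℝ × ℝ => γ p.1 p.2 * Φ p.1 p.2) (mu2 T) :=
    bdd_mul_int (C := C) hγm (fun p => hγ _ _) hΦi
  have hga : Tendsto (fun n => ∫ p, i n p.1 p.2 * (g n p.1 p.2 * Φ p.1 p.2) ∂(mu2 T)) atTop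
      (nhds (∫ p, il p.1 p.2 * (γ p.1 p.2 * Φ p.1 p.2) ∂(mu2 T))) := by
    have P := weak_ext (mu2 T) _ _ 1 (fun n => (h n).mi) mil (fun n p => ii1 n _ _) (fun p => il1 _ _) ci
      (fun p => γ p.1 p.2 * Φ p.1 p.2) hγΦ
    have hd : ∀ n, Integrable (fun p : ℝ × ℝ => g n p.1 p.2 - γ p.1 p.2) (mu2 T) := fun n =>
      bdd_int (C := M + C) ((h n).mg.sub hγm)
          (fun p => (abs_sub _ _).trans (add_le_add (gg1 n _ _) (hγ _ _)))
    have D : Tendsto (fun n => ∫ p, (i n p.1 p.2 * Φ p.1 p.2) * (g n p.1 p.2 - γ p.1 p.2) ∂(mu2 T)) atTop (nhds 0) := by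
      have hz := hγL.const_mul K
      rw [mul_zero] at hz
      refine squeeze_zero_norm (fun n => ?_) hz
      refine bdd_int_le (C := K) (fun p => ?_) (hd n)
      rw [abs_mul]
      exact (mul_le_of_le_one_left (abs_nonneg _) (ii1 n _ _)).trans (hΦb _ _)
    have S := D.add P
    rw [zero_add] at S
    refine S.congr fun n => ?_
    have I1 : Integrable (fun p : ℝ × ℝ => (i n p.1 p.2 * Φ p.1 p.2) * (g n p.1 p.2 - γ p.1 p.2)) (mu2 T) :=
      bdd_mul_int (C := K) ((h n).mi.mul hΦm) (fun p => by
        rw [abs_mul]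
        exact (mul_le_of_le_one_left (abs_nonneg _) (ii1 n _ _)).trans (hΦb _ _)) (hd n)
    have I2 : Integrable (fun p : ℝ × ℝ => i n p.1 p.2 * (γ p.1 p.2 * Φ p.1 p.2)) (mu2 T) :=
      bdd_mul_int (C := 1) (h n).mi (fun p => ii1 n _ _) hγΦ
    rw [← integral_add I1 I2]
    congr 1; ext p; ring
  -- linear terms
  have hφdi := cont_int T hφd
  have hφ0 : Integrable (fun x => φ 0 x) mu1 := by
    have : Continuous (fun x => φ 0 x) := hφc.comp (by fun_prop : Continuous (fun x : ℝ => ((0:ℝ), x)))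
    exact this.integrableOn_Icc
  have ls := weak_ext (mu2 T) _ _ 1 (fun n => (h n).ms) msl (fun n p => ss1 n _ _) (fun p => sl1 _ _) cs _ hφdi
  have li := weak_ext (mu2 T) _ _ 1 (fun n => (h n).mi) mil (fun n p => ii1 n _ _) (fun p => il1 _ _) ci _ hφdi
  have lr := weak_ext (mu2 T) _ _ 1 (fun n => (h n).mr) mrl (fun n p => rr1 n _ _) (fun p => rl1 _ _) cr _ hφdi
  have ls0 := weak_ext mu1 _ _ 1 (fun n => (h n).ms0) msl0
    (fun n x => abs_le_one_of ((h n).s0_b x).1 ((h n).s0_b x).2) sl01 cs0 _ hφ0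
  have li0 := weak_ext mu1 _ _ 1 (fun n => (h n).mi0) mil0
    (fun n x => abs_le_one_of ((h n).i0_b x).1 ((h n).i0_b x).2) il01 ci0 _ hφ0
  have lr0 := weak_ext mu1 _ _ 1 (fun n => (h n).mr0) mrl0
    (fun n x => abs_le_one_of ((h n).r0_b x).1 ((h n).r0_b x).2) rl01 cr0 _ hφ0
  have wk := fun n => (h n).weak hT hM hφ hΦm hΦb hae
  rw [r3, r2]
  refine ⟨?_, ?_, ?_, ?_, ?_⟩
  · refine tendsto_nhds_unique ((ls.sub hnl).add ls0) ?_
    exact tendsto_const_nhds.congr fun n => (wk n).1.symm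
  · refine tendsto_nhds_unique (((li.add hnl).sub hga).add li0) ?_
    exact tendsto_const_nhds.congr fun n => (wk n).2.1.symm
  · refine tendsto_nhds_unique ((lr.add hga).add lr0) ?_
    exact tendsto_const_nhds.congr fun n => (wk n).2.2.symm
  · refine (bdd_mul_int (C := 1) (msl.xx.mul mil.yy) (siB sl1 il1) hΦβW).congr ?_
    filter_upwards [hae3] with p hp; simp only [hp, Pi.mul_apply]
  · refine (bdd_mul_int (C := 1) mil (fun p => il1 _ _) hγΦ).congr ?_
    filter_upwards [hae] with p hp; simp only [hp]

end

section
lemma WConv.sub {X : Type*} [MeasurableSpace X] {μ : Measure X} {Q : ℕ → X → ℝ} {Q0 : X → ℝ}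
    (h : WConv μ Q Q0) {φ : ℕ → ℕ} (hφ : StrictMono φ) : WConv μ (fun n => Q (φ n)) Q0 :=
  fun E hE => (h E hE).comp hφ.tendsto_atTop

lemma sum_one {X : Type*} [MeasurableSpace X] {μ : Measure X} [IsFiniteMeasure μ]
    {a b c : ℕ → X → ℝ} {a0 b0 c0 : X → ℝ}
    (ma : ∀ n, Measurable (a n)) (mb : ∀ n, Measurable (b n)) (mc : ∀ n, Measurable (c n))
    (ma0 : Measurable a0) (mb0 : Measurable b0) (mc0 : Measurable c0)
    (ha : ∀ n x, |a n x| ≤ 1) (hb : ∀ n x, |b n x| ≤ 1) (hc : ∀ n x, |c n x| ≤ 1)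
    (ha0 : ∀ x, |a0 x| ≤ 1) (hb0 : ∀ x, |b0 x| ≤ 1) (hc0 : ∀ x, |c0 x| ≤ 1)
    (ca : WConv μ a a0) (cb : WConv μ b b0) (cc : WConv μ c c0)
    (hs : ∀ n, ∀ᵐ x ∂μ, a n x + b n x + c n x = 1) :
    ∀ᵐ x ∂μ, a0 x + b0 x + c0 x = 1 := by
  have Ia := bdd_int (μ := μ) ma0 ha0
  have Ib := bdd_int (μ := μ) mb0 hb0
  have Ic := bdd_int (μ := μ) mc0 hc0
  refine Integrable.ae_eq_of_forall_setIntegral_eq (fun x => a0 x + b0 x + c0 x) (fun _ => (1:ℝ))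
    ((Ia.add Ib).add Ic) (integrable_const _) ?_
  intro E hE _
  have h1 := ((ca E hE).add (cb E hE)).add (cc E hE)
  have h2 : ∀ n, (∫ x in E, a n x ∂μ + ∫ x in E, b n x ∂μ) + ∫ x in E, c n x ∂μ = ∫ x in E, (1:ℝ) ∂μ := by
    intro n
    have Ia := (bdd_int (μ := μ) (ma n) (ha n)).integrableOn (s := E)
    have Ib := (bdd_int (μ := μ) (mb n) (hb n)).integrableOn (s := E)
    have Ic := (bdd_int (μ := μ) (mc n) (hc n)).integrableOn (s := E)
    have Iab : IntegrableOn (fun x => a n x + b n x) E μ := Ia.add Ib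
    rw [← integral_add Ia Ib, ← integral_add Iab Ic]
    exact integral_congr_ae (ae_restrict_of_ae (hs n))
  have h3 := tendsto_nhds_unique h1 (tendsto_const_nhds.congr fun n => (h2 n).symm)
  have Ia := Ia.integrableOn (s := E)
  have Ib := Ib.integrableOn (s := E)
  have Ic := Ic.integrableOn (s := E)
  have Iab : IntegrableOn (fun x => a0 x + b0 x) E μ := Ia.add Ib
  rw [integral_add Iab Ic, integral_add Ia Ib]
  exact h3

lemma core2 {T M : ℝ} (hT : 0 < T) (hM : 0 < M)
    {s i r b g : ℕ → ℝ → ℝ → ℝ} {w : ℕ → ℝ → ℝ → ℝ → ℝ} {s0 i0 r0 : ℕ → ℝ → ℝ}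
    (h : ∀ n, Approx T M (s n) (i n) (r n) (b n) (g n) (w n) (s0 n) (i0 n) (r0 n))
    {W : ℝ → ℝ → ℝ → ℝ} (hWm : Meas3 W)
    (hW : Integrable (fun p : ℝ × ℝ × ℝ => W p.1 p.2.1 p.2.2) (mu3 T))
    (hcut : Tendsto (fun n => ∫ τ, cutNorm (fun x y => w n τ x y - W τ x y) ∂(muT T)) atTop (nhds 0))
    {β γ : ℝ → ℝ → ℝ} {C : ℝ} (hβm : Meas2 β) (hγm : Meas2 γ) (hβ : ∀ t x, |β t x| ≤ C)
    (hγ : ∀ t x, |γ t x| ≤ C)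
    (hβL : Tendsto (fun n => ∫ p, |b n p.1 p.2 - β p.1 p.2| ∂(mu2 T)) atTop (nhds 0))
    (hγL : Tendsto (fun n => ∫ p, |g n p.1 p.2 - γ p.1 p.2| ∂(mu2 T)) atTop (nhds 0)) :
    ∃ φ : ℕ → ℕ, StrictMono φ ∧ ∃ s0l i0l r0l : ℝ → ℝ, Measurable s0l ∧ Measurable i0l ∧ Measurable r0l ∧
      (∀ x, 0 ≤ s0l x ∧ s0l x ≤ 1) ∧ (∀ x, 0 ≤ i0l x ∧ i0l x ≤ 1) ∧ (∀ x, 0 ≤ r0l x ∧ r0l x ≤ 1) ∧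
      (∀ᵐ x ∂mu1, s0l x + i0l x + r0l x = 1) ∧
    ∃ sl il rl : ℝ → ℝ → ℝ, Meas2 sl ∧ Meas2 il ∧ Meas2 rl ∧
      (∀ t x, 0 ≤ sl t x ∧ sl t x ≤ 1) ∧ (∀ t x, 0 ≤ il t x ∧ il t x ≤ 1) ∧
      (∀ t x, 0 ≤ rl t x ∧ rl t x ≤ 1) ∧ (∀ᵐ p ∂(mu2 T), sl p.1 p.2 + il p.1 p.2 + rl p.1 p.2 = 1) ∧
      WConv (mu2 T) (fun n => unc (s (φ n))) (unc sl) ∧ WConv (mu2 T) (fun n => unc (i (φ n))) (unc il) ∧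
      WConv (mu2 T) (fun n => unc (r (φ n))) (unc rl) ∧
      ∀ φ : ℝ → ℝ → ℝ, IsTest T φ →
    (∫ p, sl p.1 p.2 * deriv (fun τ => φ τ p.2) p.1 ∂(mu2 T)
      - ∫ p, (sl p.1 p.2.1 * il p.1 p.2.2) * (φ p.1 p.2.1 * (β p.1 p.2.2 * W p.1 p.2.1 p.2.2)) ∂(mu3 T)
      + ∫ x, s0l x * φ 0 x ∂mu1 = 0) ∧
    (∫ p, il p.1 p.2 * deriv (fun τ => φ τ p.2) p.1 ∂(mu2 T)
      + ∫ p, (sl p.1 p.2.1 * il p.1 p.2.2) * (φ p.1 p.2.1 * (β p.1 p.2.2 * W p.1 p.2.1 p.2.2)) ∂(mu3 T)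
      - ∫ p, il p.1 p.2 * (γ p.1 p.2 * φ p.1 p.2) ∂(mu2 T)
      + ∫ x, i0l x * φ 0 x ∂mu1 = 0) ∧
    (∫ p, rl p.1 p.2 * deriv (fun τ => φ τ p.2) p.1 ∂(mu2 T)
      + ∫ p, il p.1 p.2 * (γ p.1 p.2 * φ p.1 p.2) ∂(mu2 T)
      + ∫ x, r0l x * φ 0 x ∂mu1 = 0) ∧
    Integrable (fun p : ℝ × ℝ × ℝ => (sl p.1 p.2.1 * il p.1 p.2.2) *
      (φ p.1 p.2.1 * (β p.1 p.2.2 * W p.1 p.2.1 p.2.2))) (mu3 T) ∧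
    Integrable (fun p : ℝ × ℝ => il p.1 p.2 * (γ p.1 p.2 * φ p.1 p.2)) (mu2 T) := by
  obtain ⟨φ1, h1, Q1, m1, z1, o1, c1⟩ := weak_compact (mu2 T) (fun n => unc (s n))
    (fun n => (h n).ms) (fun n p => ((h n).s_b _ _).1) (fun n p => ((h n).s_b _ _).2)
  obtain ⟨φ2, h2, Q2, m2, z2, o2, c2⟩ := weak_compact (mu2 T) (fun n => unc (i (φ1 n)))
    (fun n => (h _).mi) (fun n p => ((h _).i_b _ _).1) (fun n p => ((h _).i_b _ _).2)
  obtain ⟨φ3, h3, Q3, m3, z3, o3, c3⟩ := weak_compact (mu2 T) (fun n => unc (r (φ1 (φ2 n))))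
    (fun n => (h _).mr) (fun n p => ((h _).r_b _ _).1) (fun n p => ((h _).r_b _ _).2)
  obtain ⟨φ4, h4, Q4, m4, z4, o4, c4⟩ := weak_compact mu1 (fun n => s0 (φ1 (φ2 (φ3 n))))
    (fun n => (h _).ms0) (fun n p => ((h _).s0_b _).1) (fun n p => ((h _).s0_b _).2)
  obtain ⟨φ5, h5, Q5, m5, z5, o5, c5⟩ := weak_compact mu1 (fun n => i0 (φ1 (φ2 (φ3 (φ4 n)))))
    (fun n => (h _).mi0) (fun n p => ((h _).i0_b _).1) (fun n p => ((h _).i0_b _).2)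
  obtain ⟨φ6, h6, Q6, m6, z6, o6, c6⟩ := weak_compact mu1 (fun n => r0 (φ1 (φ2 (φ3 (φ4 (φ5 n))))))
    (fun n => (h _).mr0) (fun n p => ((h _).r0_b _).1) (fun n p => ((h _).r0_b _).2)
  let φ : ℕ → ℕ := fun n => φ1 (φ2 (φ3 (φ4 (φ5 (φ6 n)))))
  have hφ : StrictMono φ := h1.comp (h2.comp (h3.comp (h4.comp (h5.comp h6))))
  have d1 : WConv (mu2 T) (fun n => unc (s (φ n))) Q1 :=
    WConv.sub (Q := fun n => unc (s (φ1 n))) c1 (h2.comp (h3.comp (h4.comp (h5.comp h6))))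
  have d2 : WConv (mu2 T) (fun n => unc (i (φ n))) Q2 :=
    WConv.sub (Q := fun n => unc (i (φ1 (φ2 n)))) c2 ((h3.comp (h4.comp (h5.comp h6))))
  have d3 : WConv (mu2 T) (fun n => unc (r (φ n))) Q3 :=
    WConv.sub (Q := fun n => unc (r (φ1 (φ2 (φ3 n))))) c3 (h4.comp (h5.comp h6))
  have d4 : WConv mu1 (fun n => s0 (φ n)) Q4 :=
    WConv.sub (Q := fun n => s0 (φ1 (φ2 (φ3 (φ4 n))))) c4 (h5.comp h6)
  have d5 : WConv mu1 (fun n => i0 (φ n)) Q5 :=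
    WConv.sub (Q := fun n => i0 (φ1 (φ2 (φ3 (φ4 (φ5 n)))))) c5 h6
  have d6 : WConv mu1 (fun n => r0 (φ n)) Q6 := c6
  have b1 := fun p => abs_le_one_of (z1 p) (o1 p)
  have b2 := fun p => abs_le_one_of (z2 p) (o2 p)
  have b3 := fun p => abs_le_one_of (z3 p) (o3 p)
  have b4 := fun p => abs_le_one_of (z4 p) (o4 p)
  have b5 := fun p => abs_le_one_of (z5 p) (o5 p)
  have b6 := fun p => abs_le_one_of (z6 p) (o6 p)
  refine ⟨φ, hφ, Q4, Q5, Q6, m4, m5, m6, fun x => ⟨z4 x, o4 x⟩, fun x => ⟨z5 x, o5 x⟩,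
    fun x => ⟨z6 x, o6 x⟩, ?_, fun t x => Q1 (t, x), fun t x => Q2 (t, x), fun t x => Q3 (t, x),
    m1, m2, m3, fun t x => ⟨z1 _, o1 _⟩, fun t x => ⟨z2 _, o2 _⟩, fun t x => ⟨z3 _, o3 _⟩, ?_,
    d1, d2, d3, ?_⟩
  · exact sum_one (fun n => (h _).ms0) (fun n => (h _).mi0) (fun n => (h _).mr0) m4 m5 m6
      (fun n x => abs_le_one_of ((h _).s0_b x).1 ((h _).s0_b x).2)
      (fun n x => abs_le_one_of ((h _).i0_b x).1 ((h _).i0_b x).2)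
      (fun n x => abs_le_one_of ((h _).r0_b x).1 ((h _).r0_b x).2)
      b4 b5 b6 d4 d5 d6 (fun n => (h _).sum0)
  · exact sum_one (fun n => (h _).ms) (fun n => (h _).mi) (fun n => (h _).mr) m1 m2 m3
      (fun n x => abs_le_one_of ((h _).s_b _ _).1 ((h _).s_b _ _).2)
      (fun n x => abs_le_one_of ((h _).i_b _ _).1 ((h _).i_b _ _).2)
      (fun n x => abs_le_one_of ((h _).r_b _ _).1 ((h _).r_b _ _).2)
      b1 b2 b3 d1 d2 d3 (fun n => (h _).sum)
  · intro ψ hψ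
    exact core1 hT hM (fun n => h (φ n)) hWm hW (hcut.comp hφ.tendsto_atTop) hβm hγm hβ hγ
      (hβL.comp hφ.tendsto_atTop) (hγL.comp hφ.tendsto_atTop) (sl := fun t x => Q1 (t, x))
      (il := fun t x => Q2 (t, x)) (rl := fun t x => Q3 (t, x)) m1 m2 m3 m4 m5 m6
      (fun t x => b1 _) (fun t x => b2 _) (fun t x => b3 _) b4 b5 b6 d1 d2 d3 d4 d5 d6 hψ

lemma to_iter {T : ℝ} {f : ℝ → ℝ → ℝ} (hf : Integrable (fun p : ℝ × ℝ => f p.1 p.2) (mu2 T)) :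
    ∫ t in Set.Icc (0:ℝ) T, ∫ x in Set.Icc (0:ℝ) 1, f t x = ∫ p, f p.1 p.2 ∂(mu2 T) := by
  rw [integral_prod _ hf]

/-- from product-integral identities to the distributional formulation -/
lemma core3 {T : ℝ} {W : ℝ → ℝ → ℝ → ℝ} {β γ β' γ' : ℝ → ℝ → ℝ}
    (hβ : ∀ᵐ p ∂(mu2 T), β' p.1 p.2 = β p.1 p.2) (hγ : ∀ᵐ p ∂(mu2 T), γ' p.1 p.2 = γ p.1 p.2)
    {s0l i0l r0l : ℝ → ℝ} {sl il rl : ℝ → ℝ → ℝ} (ms : Meas2 sl) (mi : Meas2 il) (mr : Meas2 rl)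
    (bs : ∀ t x, |sl t x| ≤ 1) (bi : ∀ t x, |il t x| ≤ 1) (br : ∀ t x, |rl t x| ≤ 1)
    (H : ∀ φ : ℝ → ℝ → ℝ, IsTest T φ →
    (∫ p, sl p.1 p.2 * deriv (fun τ => φ τ p.2) p.1 ∂(mu2 T)
      - ∫ p, (sl p.1 p.2.1 * il p.1 p.2.2) * (φ p.1 p.2.1 * (β' p.1 p.2.2 * W p.1 p.2.1 p.2.2)) ∂(mu3 T)
      + ∫ x, s0l x * φ 0 x ∂mu1 = 0) ∧
    (∫ p, il p.1 p.2 * deriv (fun τ => φ τ p.2) p.1 ∂(mu2 T)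
      + ∫ p, (sl p.1 p.2.1 * il p.1 p.2.2) * (φ p.1 p.2.1 * (β' p.1 p.2.2 * W p.1 p.2.1 p.2.2)) ∂(mu3 T)
      - ∫ p, il p.1 p.2 * (γ' p.1 p.2 * φ p.1 p.2) ∂(mu2 T)
      + ∫ x, i0l x * φ 0 x ∂mu1 = 0) ∧
    (∫ p, rl p.1 p.2 * deriv (fun τ => φ τ p.2) p.1 ∂(mu2 T)
      + ∫ p, il p.1 p.2 * (γ' p.1 p.2 * φ p.1 p.2) ∂(mu2 T)
      + ∫ x, r0l x * φ 0 x ∂mu1 = 0) ∧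
    Integrable (fun p : ℝ × ℝ × ℝ => (sl p.1 p.2.1 * il p.1 p.2.2) *
      (φ p.1 p.2.1 * (β' p.1 p.2.2 * W p.1 p.2.1 p.2.2))) (mu3 T) ∧
    Integrable (fun p : ℝ × ℝ => il p.1 p.2 * (γ' p.1 p.2 * φ p.1 p.2)) (mu2 T)) :
    IsDistribSol T W β γ s0l i0l r0l sl il rl := by
  have key : ∀ φ : ℝ → ℝ → ℝ, IsTest T φ → 
      Integrable (fun p : ℝ × ℝ => sl p.1 p.2 * φ p.1 p.2 * ∫ y, β p.1 y * W p.1 p.2 y * il p.1 y ∂mu1) (mu2 T) ∧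
      ∫ p, (sl p.1 p.2 * φ p.1 p.2 * ∫ y, β p.1 y * W p.1 p.2 y * il p.1 y ∂mu1) ∂(mu2 T) = 
      ∫ p, (sl p.1 p.2.1 * il p.1 p.2.2) * (φ p.1 p.2.1 * (β' p.1 p.2.2 * W p.1 p.2.1 p.2.2)) ∂(mu3 T) ∧
      Integrable (fun p : ℝ × ℝ => γ p.1 p.2 * φ p.1 p.2 * il p.1 p.2) (mu2 T) ∧
      ∫ p, (γ p.1 p.2 * φ p.1 p.2 * il p.1 p.2) ∂(mu2 T) =
      ∫ p, il p.1 p.2 * (γ' p.1 p.2 * φ p.1 p.2) ∂(mu2 T) := by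
    intro φ hφ
    obtain ⟨-, -, -, i3, i2⟩ := H φ hφ
    have e3 : (fun p : ℝ × ℝ × ℝ => (sl p.1 p.2.1 * il p.1 p.2.2) *
      (φ p.1 p.2.1 * (β' p.1 p.2.2 * W p.1 p.2.1 p.2.2))) =ᵐ[mu3 T] 
      (fun p => sl p.1 p.2.1 * φ p.1 p.2.1 * (β p.1 p.2.2 * W p.1 p.2.1 p.2.2 * il p.1 p.2.2)) := by
      filter_upwards [(mp_yy T).quasiMeasurePreserving.ae hβ] with p hp
      rw [hp]; ring
    have e2 : (fun p : ℝ × ℝ => il p.1 p.2 * (γ' p.1 p.2 * φ p.1 p.2)) =ᵐ[mu2 T] 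
        (fun p : ℝ × ℝ => γ p.1 p.2 * φ p.1 p.2 * il p.1 p.2) := by
      filter_upwards [hγ] with p hp
      rw [hp]; ring
    have R := red3 (H := fun t x y => sl t x * φ t x * (β t y * W t x y * il t y)) (i3.congr e3)
    simp only [integral_const_mul] at R
    refine ⟨R.1, R.2.trans (integral_congr_ae e3.symm), i2.congr e2, integral_congr_ae e2.symm⟩
  have hd : ∀ φ : ℝ → ℝ → ℝ, IsTest T φ → ∀ u : ℝ → ℝ → ℝ, Meas2 u → (∀ t x, |u t x| ≤ 1) →
      Integrable (fun p : ℝ × ℝ => u p.1 p.2 * deriv (fun τ => φ τ p.2) p.1) (mu2 T) := by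
    intro φ hφ u hu hb
    exact bdd_mul_int (C := 1) hu (fun p => hb _ _) (cont_int T (test_facts hφ).2.1)
  refine ⟨ms, mi, mr, ?_, ?_, ?_⟩
  · intro φ hφ
    obtain ⟨k1, k2, k3, k4⟩ := key φ hφ
    have d := hd φ hφ sl ms bs
    have e : (fun p : ℝ × ℝ => sl p.1 p.2 * (deriv (fun τ => φ τ p.2) p.1 - φ p.1 p.2 * 
        ∫ y in Set.Icc (0:ℝ) 1, β p.1 y * W p.1 p.2 y * il p.1 y)) = fun p =>
        (sl p.1 p.2 * deriv (fun τ => φ τ p.2) p.1) - sl p.1 p.2 * φ p.1 p.2 * ∫ y, β p.1 y * W p.1 p.2 y * il p.1 y ∂mu1 := by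
      ext p; ring
    rw [to_iter (f := fun t x => sl t x * (deriv (fun τ => φ τ x) t - φ t x * 
        ∫ y in Set.Icc (0:ℝ) 1, β t y * W t x y * il t y)) (by rw [e]; exact d.sub k1), e,
        integral_sub d k1, k2]
    exact (H φ hφ).1
  · intro φ hφ
    obtain ⟨k1, k2, k3, k4⟩ := key φ hφ
    have d := hd φ hφ il mi bi
    have dk : Integrable (fun p : ℝ × ℝ => (il p.1 p.2 * deriv (fun τ => φ τ p.2) p.1) + sl p.1 p.2 * φ p.1 p.2 *
      ∫ y, β p.1 y * W p.1 p.2 y * il p.1 y ∂mu1) (mu2 T) := d.add k1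
    have e : (fun p : ℝ × ℝ => il p.1 p.2 * (deriv (fun τ => φ τ p.2) p.1 - γ p.1 p.2 * φ p.1 p.2) + sl p.1 p.2 * φ p.1 p.2 *
        ∫ y in Set.Icc (0:ℝ) 1, β p.1 y * W p.1 p.2 y * il p.1 y) = fun p =>
        ((il p.1 p.2 * deriv (fun τ => φ τ p.2) p.1) + sl p.1 p.2 * φ p.1 p.2 * ∫ y, β p.1 y * W p.1 p.2 y * il p.1 y ∂mu1)
          - γ p.1 p.2 * φ p.1 p.2 * il p.1 p.2 := by
      ext p; ring
    rw [to_iter (f := fun t x => il t x * (deriv (fun τ => φ τ x) t - γ t x * φ t x) + sl t x * φ t x *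
        ∫ y in Set.Icc (0:ℝ) 1, β t y * W t x y * il t y) (by rw [e]; exact (d.add k1).sub k3), e,
        integral_sub dk k3, integral_add d k1, k2, k4]
    exact (H φ hφ).2.1
  · intro φ hφ
    obtain ⟨k1, k2, k3, k4⟩ := key φ hφ
    have d := hd φ hφ rl mr br
    rw [to_iter (f := fun t x => rl t x * deriv (fun τ => φ τ x) t + γ t x * φ t x * il t x) (d.add k3),
        integral_add d k3, k4]
    exact (H φ hφ).2.2.1

end

section
lemma pos_lemma {n : ℕ} {T C : ℝ} (hC : 0 ≤ C) {u f : Fin n → ℝ → ℝ}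
    (hu : ∀ j, Continuous (u j)) (hf : ∀ j a b, IntervalIntegrable (f j) volume a b)
    (h : ∀ j, ∀ t ∈ Icc 0 T, u j t = u j 0 + ∫ τ in (0:ℝ)..t, f j τ)
    (h0 : ∀ j, 0 ≤ u j 0)
    (hb : ∀ j, ∀ t ∈ Icc 0 T, u j t < 0 → -(C * ∑ k, max 0 (-(u k t))) ≤ f j t) :
    ∀ j, ∀ t ∈ Icc 0 T, 0 ≤ u j t := by
  set F : ℝ → ℝ := fun t => ∑ k, max 0 (-(u k t)) with hF
  have hFc : Continuous F := by
    apply continuous_finset_sum; intro k _; exact continuous_const.max (hu k).neg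
  have hF0 : ∀ t, 0 ≤ F t := fun t => Finset.sum_nonneg fun k _ => le_max_left _ _
  have key : ∀ j, ∀ t ∈ Icc 0 T, max 0 (-(u j t)) ≤ C * ∫ τ in (0:ℝ)..t, F τ := by
    intro j t ht
    have hGt : 0 ≤ C * ∫ τ in (0:ℝ)..t, F τ :=
      mul_nonneg hC (intervalIntegral.integral_nonneg ht.1 fun τ _ => hF0 τ)
    refine max_le hGt ?_
    rcases le_or_gt 0 (u j t) with hut | hut
    · linarith
    have hcomp : IsCompact (Icc 0 t ∩ {τ | 0 ≤ u j τ}) :=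
      isCompact_Icc.inter_right (isClosed_le continuous_const (hu j))
    obtain ⟨t0, ⟨ht0, hut0⟩, hmax⟩ := hcomp.exists_isGreatest ⟨0, ⟨le_refl _, ht.1⟩, h0 j⟩
    have e1 := h j t ht
    have e0 := h j t0 ⟨ht0.1, ht0.2.trans ht.2⟩
    have e2 := intervalIntegral.integral_add_adjacent_intervals (hf j 0 t0) (hf j t0 t)
    have e3 : ∫ τ in t0..t, -(C * F τ) ≤ ∫ τ in t0..t, f j τ := by
      refine intervalIntegral.integral_mono_on_of_le_Ioo ht0.2 ((continuous_const.mul hFc).neg.intervalIntegrable _ _) (hf j _ _) ?_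
      intro τ hτ
      refine hb j τ ⟨ht0.1.trans hτ.1.le, hτ.2.le.trans ht.2⟩ ?_
      by_contra hc
      have := hmax ⟨⟨ht0.1.trans hτ.1.le, hτ.2.le⟩, not_lt.1 hc⟩
      linarith [hτ.1]
    rw [intervalIntegral.integral_neg, intervalIntegral.integral_const_mul] at e3
    have e4 := intervalIntegral.integral_add_adjacent_intervals (hFc.intervalIntegrable (μ := volume) 0 t0) (hFc.intervalIntegrable t0 t)
    have e5 : 0 ≤ ∫ τ in (0:ℝ)..t0, F τ := intervalIntegral.integral_nonneg ht0.1 fun τ _ => hF0 τ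
    have e6 : C * ∫ τ in t0..t, F τ ≤ C * ∫ τ in (0:ℝ)..t, F τ := by
      apply mul_le_mul_of_nonneg_left _ hC; linarith
    have : 0 ≤ u j t0 := hut0
    linarith
  have hG : ∀ t ∈ Icc 0 T, F t ≤ (n * C) * ∫ τ in (0:ℝ)..t, F τ := by
    intro t ht
    calc F t ≤ ∑ k : Fin n, C * ∫ τ in (0:ℝ)..t, F τ := Finset.sum_le_sum fun k _ => key k t ht
      _ = _ := by simp; ring
  have hz : ∀ t ∈ Icc 0 T, ‖∫ τ in (0:ℝ)..t, F τ‖ ≤ gronwallBound 0 (n * C) 0 (t - 0) := by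
    refine norm_le_gronwallBound_of_norm_deriv_right_le (f' := F) ?_ ?_ ?_ ?_
    · exact (intervalIntegral.continuous_primitive (fun a b => hFc.intervalIntegrable a b) 0).continuousOn
    · intro x _
      exact (intervalIntegral.integral_hasDerivAt_right (hFc.intervalIntegrable _ _)
        (hFc.stronglyMeasurableAtFilter _ _) hFc.continuousAt).hasDerivWithinAt
    · simp
    · intro x hx
      have hx' : x ∈ Icc 0 T := ⟨hx.1, hx.2.le⟩
      rw [Real.norm_of_nonneg (hF0 x), Real.norm_of_nonneg (intervalIntegral.integral_nonneg hx.1 fun τ _ => hF0 τ), add_zero]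
      exact hG x hx'
  intro j t ht
  have h1 := hz t ht
  have h2 : gronwallBound 0 ((n:ℝ) * C) 0 (t - 0) = 0 := by
    simp [gronwallBound_ε0_δ0]
  rw [h2] at h1
  have h3 := key j t ht
  rw [norm_le_zero_iff.1 h1, mul_zero] at h3
  have := (le_max_right 0 (-(u j t))).trans h3
  linarith

lemma cont_bdd {T : ℝ} {f : ℝ → ℝ} (hf : Continuous f) : ∃ B, 0 ≤ B ∧ ∀ t ∈ Icc 0 T, |f t| ≤ B := by
  obtain ⟨B, hB⟩ := isCompact_Icc.exists_bound_of_continuousOn (s := Icc 0 T) hf.continuousOn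
  exact ⟨max B 0, le_max_right _ _, fun t ht => (hB t ht).trans (le_max_left _ _)⟩

lemma cont_bdd' {n : ℕ} {T : ℝ} {f : Fin n → ℝ → ℝ} (hf : ∀ j, Continuous (f j)) :
    ∃ B, 0 ≤ B ∧ ∀ j, ∀ t ∈ Icc 0 T, |f j t| ≤ B := by
  choose B hB using fun j => cont_bdd (T := T) (hf j)
  refine ⟨∑ j, B j, Finset.sum_nonneg fun j _ => (hB j).1, fun j t ht => ((hB j).2 t ht).trans ?_⟩
  exact Finset.single_le_sum (f := B) (fun j _ => (hB j).1) (Finset.mem_univ j)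

lemma meas_bdd_ii {f : ℝ → ℝ} {C : ℝ} (hm : Measurable f) (hb : ∀ t, |f t| ≤ C) (a b : ℝ) :
    IntervalIntegrable f volume a b := by
  rw [intervalIntegrable_iff]
  haveI : IsFiniteMeasure ((volume : Measure ℝ).restrict (Set.uIoc a b)) := ⟨by simp [Set.uIoc]⟩
  exact bdd_int hm hb

lemma graph_facts {n : ℕ} (hn : 1 ≤ n) {T M C : ℝ} (hT : 0 < T)
    {β γ : Fin n → ℝ → ℝ} {A : Fin n → Fin n → ℝ → ℝ} {s i r : Fin n → ℝ → ℝ}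
    (mβ : ∀ k, Measurable (β k)) (mγ : ∀ k, Measurable (γ k)) (mA : ∀ j k, Measurable (A j k))
    (bβ : ∀ k t, 0 ≤ β k t ∧ β k t ≤ M) (bγ : ∀ k t, 0 ≤ γ k t ∧ γ k t ≤ M)
    (bA : ∀ j k t, 0 ≤ A j k t ∧ A j k t ≤ C)
    (cs : ∀ j, Continuous (s j)) (ci : ∀ j, Continuous (i j)) 
    (es : ∀ j, ∀ t ∈ Icc 0 T, s j t = s j 0 + ∫ τ in (0:ℝ)..t,
        -(s j τ * (1 / (n : ℝ) * ∑ k : Fin n, β k τ * A j k τ * i k τ)))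
    (ei : ∀ j, ∀ t ∈ Icc 0 T, i j t = i j 0 + ∫ τ in (0:ℝ)..t,
        (s j τ * (1 / (n : ℝ) * ∑ k : Fin n, β k τ * A j k τ * i k τ) - γ j τ * i j τ))
    (er : ∀ j, ∀ t ∈ Icc 0 T, r j t = r j 0 + ∫ τ in (0:ℝ)..t, γ j τ * i j τ)
    (hs0 : ∀ j, 0 ≤ s j 0) (hi0 : ∀ j, 0 ≤ i j 0) (hr0 : ∀ j, 0 ≤ r j 0)
    (hsum : ∀ j, s j 0 + i j 0 + r j 0 = 1) :
    (∀ j, ∀ t ∈ Icc 0 T, 0 ≤ s j t) ∧ (∀ j, ∀ t ∈ Icc 0 T, 0 ≤ i j t) ∧ 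
    (∀ j, ∀ t ∈ Icc 0 T, 0 ≤ r j t) ∧ (∀ j, ∀ t ∈ Icc 0 T, s j t + i j t + r j t = 1) := by
  have j0 : Fin n := ⟨0, hn⟩
  have hM : 0 ≤ M := (bβ j0 0).1.trans (bβ j0 0).2
  have hC : 0 ≤ C := (bA j0 j0 0).1.trans (bA j0 j0 0).2
  have hn0 : (0:ℝ) < n := by exact_mod_cast hn
  have hn1 : 1 / (n:ℝ) ≤ 1 := by
    rw [div_le_one hn0]; exact_mod_cast hn
  have hbA : ∀ j k t, 0 ≤ β k t * A j k t ∧ β k t * A j k t ≤ M * C := fun j k t =>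
    ⟨mul_nonneg (bβ k t).1 (bA j k t).1, mul_le_mul (bβ k t).2 (bA j k t).2 (bA j k t).1 hM⟩
  have iX : ∀ j a b, IntervalIntegrable (fun τ => s j τ * (1 / (n : ℝ) * ∑ k : Fin n, β k τ * A j k τ * i k τ)) volume a b := by
    intro j a b
    refine IntervalIntegrable.continuousOn_mul ?_ (cs j).continuousOn
    refine IntervalIntegrable.const_mul ?_ _
    have := IntervalIntegrable.sum (μ := volume) (a := a) (b := b) (Finset.univ : Finset (Fin n)) (f := fun k τ => β k τ * A j k τ * i k τ) (fun k _ => 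
      (meas_bdd_ii (C := M * C) ((mβ k).mul (mA j k)) (fun t => by
        simp only [Pi.mul_apply]
        rw [abs_of_nonneg (hbA j k t).1]; exact (hbA j k t).2) a b).mul_continuousOn (ci k).continuousOn)
    refine this.congr fun τ _ => ?_
    simp
  have iG : ∀ j a b, IntervalIntegrable (fun τ => γ j τ * i j τ) volume a b := by
    intro j a b
    exact (meas_bdd_ii (C := M) (mγ j) (fun t => by
        rw [abs_of_nonneg (bγ j t).1]; exact (bγ j t).2) a b).mul_continuousOn (ci j).continuousOn
  obtain ⟨S, hS, bS⟩ := cont_bdd' (T := T) cs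
  obtain ⟨I, hI, bI⟩ := cont_bdd' (T := T) ci
  have single : ∀ (v : Fin n → ℝ) j, max 0 (-(v j)) ≤ ∑ k, max 0 (-(v k)) := fun v j =>
    Finset.single_le_sum (f := fun k => max 0 (-(v k))) (fun k _ => le_max_left _ _) (Finset.mem_univ j)
  have ps : ∀ j, ∀ t ∈ Icc 0 T, 0 ≤ s j t := by
    refine pos_lemma (C := M * C * I) (by positivity) cs (fun j a b => (iX j a b).neg) es hs0 ?_
    intro j t ht hneg
    have hX : -(M * C * I) ≤ 1 / (n : ℝ) * ∑ k : Fin n, β k t * A j k t * i k t := by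
      have : ∑ k : Fin n, -(M * C * I) ≤ ∑ k : Fin n, β k t * A j k t * i k t := by
        refine Finset.sum_le_sum fun k _ => ?_
        have h1 := (abs_le.1 (bI k t ht)).1
        have h2 := hbA j k t
        nlinarith
      simp only [Finset.sum_const, Finset.card_univ, Fintype.card_fin, nsmul_eq_mul] at this
      rw [one_div, ← div_eq_inv_mul, le_div_iff₀ hn0]
      linarith
    have h1 := single (fun k => s k t) j
    have h2 := le_max_right 0 (-(s j t))
    have h4 : 0 ≤ M * C * I := by positivity
    have q1 := mul_le_mul_of_nonneg_left (h2.trans h1) h4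
    have q2 := mul_le_mul_of_nonneg_left hX (neg_nonneg.2 hneg.le)
    have q3 : -s j t * -(M * C * I) = s j t * (M * C * I) := by ring
    have q4 : M * C * I * -s j t = -(s j t * (M * C * I)) := by ring
    rw [q3] at q2; rw [q4] at q1
    rw [neg_mul] at q2
    exact (neg_le_neg q1).trans (by rw [neg_neg]; exact q2)
  have pi : ∀ j, ∀ t ∈ Icc 0 T, 0 ≤ i j t := by
    refine pos_lemma (C := S * (M * C)) (by positivity) ci (fun j a b => (iX j a b).sub (iG j a b)) ei hi0 ?_
    intro j t ht hneg
    have hF : 0 ≤ ∑ k, max 0 (-(i k t)) := Finset.sum_nonneg fun k _ => le_max_left _ _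
    have hX : -(M * C * ∑ k, max 0 (-(i k t))) ≤ 1 / (n : ℝ) * ∑ k : Fin n, β k t * A j k t * i k t := by
      have : -(M * C * ∑ k, max 0 (-(i k t))) ≤ ∑ k : Fin n, β k t * A j k t * i k t := by
        rw [Finset.mul_sum, ← Finset.sum_neg_distrib]
        refine Finset.sum_le_sum fun k _ => ?_
        have h1 := le_max_right 0 (-(i k t))
        have h3 := le_max_left 0 (-(i k t))
        have h2 := hbA j k t
        nlinarith [mul_le_mul_of_nonneg_left h1 h2.1, mul_le_mul_of_nonneg_right h2.2 h3]
      have h5 : 0 ≤ M * C * ∑ k, max 0 (-(i k t)) := by positivity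
      have h6 : 0 ≤ 1 / (n:ℝ) := by positivity
      nlinarith [mul_le_mul_of_nonneg_left this h6, mul_le_mul_of_nonneg_right hn1 h5]
    have h7 : 0 ≤ -(γ j t * i j t) := by nlinarith [(bγ j t).1]
    have h8 := mul_le_mul_of_nonneg_left hX (ps j t ht)
    have h9 : s j t ≤ S := (le_abs_self _).trans (bS j t ht)
    have h5 : 0 ≤ M * C * ∑ k, max 0 (-(i k t)) := by positivity
    nlinarith [mul_le_mul_of_nonneg_right h9 h5]
  refine ⟨ps, pi, ?_, ?_⟩
  · intro j t ht
    rw [er j t ht]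
    refine add_nonneg (hr0 j) (intervalIntegral.integral_nonneg ht.1 fun τ hτ => ?_)
    exact mul_nonneg (bγ j τ).1 (pi j τ ⟨hτ.1, hτ.2.trans ht.2⟩)
  · intro j t ht
    have e1 := es j t ht
    have e2 := ei j t ht
    have e3 := er j t ht
    rw [intervalIntegral.integral_neg] at e1
    rw [intervalIntegral.integral_sub (iX j 0 t) (iG j 0 t)] at e2
    linarith [hsum j]

end

section
lemma inj_unique {n : ℕ} {j k : Fin n} {x : ℝ} (hj : x ∈ Inj n j) (hk : x ∈ Inj n k) : j = k := by
  have hn : (0:ℝ) < n := by exact_mod_cast (Nat.zero_lt_of_lt j.2)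
  obtain ⟨a1, a2⟩ := hj
  obtain ⟨b1, b2⟩ := hk
  rw [div_lt_iff₀ hn] at a1 b1
  rw [lt_div_iff₀ hn] at a2 b2
  have h1 : (j:ℝ) < k + 1 := by linarith
  have h2 : (k:ℝ) < j + 1 := by linarith
  have h1' : (j:ℕ) < k + 1 := by exact_mod_cast h1
  have h2' : (k:ℕ) < j + 1 := by exact_mod_cast h2
  apply Fin.ext; omega

lemma stepFn_in {n : ℕ} {j : Fin n} {x : ℝ} (hj : x ∈ Inj n j) (v : Fin n → ℝ) : stepFn n v x = v j := by
  unfold stepFn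
  rw [Finset.sum_eq_single j]
  · simp [hj]
  · intro k _ hk
    rw [indicator_of_notMem]
    intro h; exact hk (inj_unique h hj)
  · simp

lemma stepFn_cases (n : ℕ) (x : ℝ) : (∃ j, x ∈ Inj n j ∧ ∀ v, stepFn n v x = v j) ∨ ∀ v, stepFn n v x = 0 := by
  by_cases h : ∃ j, x ∈ Inj n j
  · obtain ⟨j, hj⟩ := h
    exact Or.inl ⟨j, hj, stepFn_in hj⟩
  · right
    intro v
    push Not at h
    exact Finset.sum_eq_zero fun j _ => by rw [indicator_of_notMem (h j)]

lemma stepFn_bd {n : ℕ} {v : Fin n → ℝ} {C : ℝ} (hC : 0 ≤ C) (h : ∀ j, 0 ≤ v j ∧ v j ≤ C) (x : ℝ) :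
    0 ≤ stepFn n v x ∧ stepFn n v x ≤ C := by
  rcases stepFn_cases n x with ⟨j, -, hj⟩ | h0
  · rw [hj]; exact h j
  · rw [h0]; exact ⟨le_refl _, hC⟩

lemma stepKer_eq (n : ℕ) (A : Fin n → Fin n → ℝ) (x y : ℝ) :
    stepKer n A x y = stepFn n (fun j => stepFn n (A j) y) x := by
  unfold stepKer stepFn
  refine Finset.sum_congr rfl fun j _ => ?_
  by_cases hx : x ∈ Inj n j
  · simp [hx]
  · simp [hx]

lemma ae_inj {n : ℕ} (hn : 1 ≤ n) : ∀ᵐ x ∂mu1, ∃ j, x ∈ Inj n j := by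
  have hc : (Set.range fun j : ℕ => (j:ℝ) / n).Countable := Set.countable_range _
  have h1 : ∀ᵐ x ∂mu1, x ∉ (Set.range fun j : ℕ => (j:ℝ) / n) :=
    ae_restrict_of_ae (hc.ae_notMem _)
  have h2 : ∀ᵐ x ∂mu1, x ∈ Icc (0:ℝ) 1 := ae_restrict_mem measurableSet_Icc
  have hn0 : (0:ℝ) < n := by exact_mod_cast hn
  filter_upwards [h1, h2] with x hx hx1
  have hnot : ∀ j : ℕ, (j:ℝ) / n ≠ x := fun j hj => hx ⟨j, hj⟩
  have hx0 : 0 ≤ x * n := mul_nonneg hx1.1 hn0.le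
  have hlt : x < 1 := lt_of_le_of_ne hx1.2 fun h => hnot n (by rw [h]; field_simp)
  have f1 := Nat.floor_le hx0
  have f2 := Nat.lt_floor_add_one (x * n)
  have hj : ⌊x * n⌋₊ < n := by
    rw [Nat.floor_lt hx0]; nlinarith
  refine ⟨⟨⌊x * n⌋₊, hj⟩, ?_, ?_⟩
  · refine lt_of_le_of_ne ?_ (hnot _)
    rw [div_le_iff₀ hn0]; exact f1
  · rw [lt_div_iff₀ hn0]; exact f2

lemma stepFn_meas {X : Type*} [MeasurableSpace X] {n : ℕ} {v : Fin n → X → ℝ} (hv : ∀ j, Measurable (v j))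
    {f : X → ℝ} (hf : Measurable f) : Measurable (fun p => stepFn n (fun j => v j p) (f p)) := by
  unfold stepFn
  refine Finset.measurable_sum _ fun j _ => ?_
  have : (fun p => (Inj n j).indicator (fun _ => v j p) (f p)) = (f ⁻¹' (Inj n j)).indicator (v j) := by
    ext p
    by_cases h : f p ∈ Inj n j
    · rw [indicator_of_mem h, indicator_of_mem (by exact h)]
    · rw [indicator_of_notMem h, indicator_of_notMem (by exact h)]
  rw [this]
  exact (hv j).indicator (hf measurableSet_Ioo)

lemma stepFn_int {n : ℕ} (hn : 1 ≤ n) (v : Fin n → ℝ) : ∫ y, stepFn n v y ∂mu1 = 1 / (n:ℝ) * ∑ k, v k := by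
  have hn0 : (0:ℝ) < n := by exact_mod_cast hn
  unfold stepFn
  rw [integral_finset_sum, Finset.mul_sum]
  · refine Finset.sum_congr rfl fun j _ => ?_
    rw [integral_indicator (show MeasurableSet (Inj n j) from measurableSet_Ioo), setIntegral_const, smul_eq_mul]
    congr 1
    have hsub : Inj n j ⊆ Icc 0 1 := by
      intro x hx
      have h2 : (((j:ℕ):ℝ) + 1) / n ≤ 1 := by
        rw [div_le_one hn0]; exact_mod_cast j.2
      have h1 : 0 ≤ ((j:ℕ):ℝ) / n := by positivity
      exact ⟨h1.trans hx.1.le, hx.2.le.trans h2⟩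
    rw [measureReal_def, Measure.restrict_apply (show MeasurableSet (Inj n j) from measurableSet_Ioo)]
    have : Ioo ((j:ℝ) / n) (((j : ℝ) + 1) / n) ∩ Icc 0 1 = Ioo ((j:ℝ) / n) (((j : ℝ) + 1) / n) :=
      inter_eq_left.2 hsub
    unfold Inj
    rw [this, Real.volume_Ioo, ENNReal.toReal_ofReal]
    · ring
    · rw [← sub_div]; simp
  · intro j _
    exact (integrable_const _).indicator measurableSet_Ioo

lemma stepFn_mul3 {n : ℕ} (a b c : Fin n → ℝ) (y : ℝ) :
    stepFn n a y * stepFn n b y * stepFn n c y = stepFn n (fun k => a k * b k * c k) y := by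
  rcases stepFn_cases n y with ⟨j, -, hj⟩ | h0
  · simp only [hj]
  · simp only [h0]; ring

lemma approx_of {n : ℕ} (hn : 1 ≤ n) {T M C : ℝ} (hM : 0 < M) (hC : 0 ≤ C)
    {β γ : Fin n → ℝ → ℝ} {A : Fin n → Fin n → ℝ → ℝ} {s i r : Fin n → ℝ → ℝ}
    (mβ : ∀ k, Measurable (β k)) (mγ : ∀ k, Measurable (γ k)) (mA : ∀ j k, Measurable (A j k))
    (bβ : ∀ k t, 0 ≤ β k t ∧ β k t ≤ M) (bγ : ∀ k t, 0 ≤ γ k t ∧ γ k t ≤ M)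
    (bA : ∀ j k t, 0 ≤ A j k t ∧ A j k t ≤ C)
    (cs : ∀ j, Continuous (s j)) (ci : ∀ j, Continuous (i j)) (cr : ∀ j, Continuous (r j)) 
    (es : ∀ j, ∀ t ∈ Icc 0 T, s j t = s j 0 + ∫ τ in (0:ℝ)..t,
        -(s j τ * (1 / (n : ℝ) * ∑ k : Fin n, β k τ * A j k τ * i k τ)))
    (ei : ∀ j, ∀ t ∈ Icc 0 T, i j t = i j 0 + ∫ τ in (0:ℝ)..t,
        (s j τ * (1 / (n : ℝ) * ∑ k : Fin n, β k τ * A j k τ * i k τ) - γ j τ * i j τ))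
    (er : ∀ j, ∀ t ∈ Icc 0 T, r j t = r j 0 + ∫ τ in (0:ℝ)..t, γ j τ * i j τ)
    (bs : ∀ j t, 0 ≤ s j t ∧ s j t ≤ 1) (bi : ∀ j t, 0 ≤ i j t ∧ i j t ≤ 1)
    (br : ∀ j t, 0 ≤ r j t ∧ r j t ≤ 1) (hsum : ∀ j t, s j t + i j t + r j t = 1) :
    Approx T M (fun t => stepFn n (fun j => s j t)) (fun t => stepFn n (fun j => i j t))
      (fun t => stepFn n (fun j => r j t)) (fun t => stepFn n (fun j => β j t))
      (fun t => stepFn n (fun j => γ j t)) (fun t => stepKer n (fun j k => A j k t))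
      (stepFn n (fun j => s j 0)) (stepFn n (fun j => i j 0)) (stepFn n (fun j => r j 0)) := by
  have inner : ∀ j x, x ∈ Inj n j → ∀ τ, ∫ y, stepFn n (fun j => β j τ) y * stepKer n (fun j k => A j k τ) x y *
      stepFn n (fun j => i j τ) y ∂mu1 = 1 / (n : ℝ) * ∑ k : Fin n, β k τ * A j k τ * i k τ := by
    intro j x hx τ
    rw [← stepFn_int hn]
    refine integral_congr_ae (ae_of_all _ fun y => ?_)
    simp only
    rw [stepKer_eq, stepFn_in hx, stepFn_mul3]
  have M2 : ∀ v : Fin n → ℝ → ℝ, (∀ j, Measurable (v j)) → Meas2 (fun t => stepFn n (fun j => v j t)) :=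
    fun v hv => stepFn_meas (fun j => (hv j).comp measurable_fst) measurable_snd
  have ms := fun j => (cs j).measurable
  have mi := fun j => (ci j).measurable
  have mr := fun j => (cr j).measurable
  have M1 : ∀ v : Fin n → ℝ, Measurable (stepFn n v) :=
    fun v => stepFn_meas (v := fun j _ => v j) (fun j => measurable_const) measurable_id
  refine {
    ms := M2 s ms, mi := M2 i mi, mr := M2 r mr, mb := M2 β mβ, mg := M2 γ mγ, mw := ?_,
    ms0 := M1 _, mi0 := M1 _, mr0 := M1 _, 
    s_b := fun t x => stepFn_bd zero_le_one (fun j => bs j t) x,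
    i_b := fun t x => stepFn_bd zero_le_one (fun j => bi j t) x,
    r_b := fun t x => stepFn_bd zero_le_one (fun j => br j t) x,
    s0_b := fun x => stepFn_bd zero_le_one (fun j => bs j 0) x,
    i0_b := fun x => stepFn_bd zero_le_one (fun j => bi j 0) x,
    r0_b := fun x => stepFn_bd zero_le_one (fun j => br j 0) x,
    b_b := fun t x => stepFn_bd hM.le (fun j => bβ j t) x,
    g_b := fun t x => stepFn_bd hM.le (fun j => bγ j t) x,
    w_b := ⟨C, fun t x y => ?_⟩, es := ?_, ei := ?_, er := ?_, sum0 := ?_, sum := ?_ }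
  · simp only [Meas3, stepKer_eq]
    exact stepFn_meas (fun j => stepFn_meas (fun k => (mA j k).comp measurable_fst) measurable_snd.snd) measurable_snd.fst
  · rw [stepKer_eq]
    exact stepFn_bd hC (fun j => stepFn_bd hC (fun k => bA j k t) y) x
  · filter_upwards [ae_inj hn] with x hx t ht
    obtain ⟨j, hj⟩ := hx
    simp only [stepFn_in hj, inner j x hj]
    exact es j t ht
  · filter_upwards [ae_inj hn] with x hx t ht
    obtain ⟨j, hj⟩ := hx
    simp only [stepFn_in hj, inner j x hj]
    exact ei j t ht
  · filter_upwards [ae_inj hn] with x hx t ht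
    obtain ⟨j, hj⟩ := hx
    simp only [stepFn_in hj]
    exact er j t ht
  · filter_upwards [ae_inj hn] with x hx
    obtain ⟨j, hj⟩ := hx
    simp only [stepFn_in hj]
    exact hsum j 0
  · have : ∀ᵐ p ∂(mu2 T), ∃ j, p.2 ∈ Inj n j := Measure.quasiMeasurePreserving_snd.ae (ae_inj hn)
    filter_upwards [this] with p hp
    obtain ⟨j, hj⟩ := hp
    simp only [stepFn_in hj]
    exact hsum j _

end

section
lemma exists_inj {n : ℕ} (j : Fin n) {P : ℝ → Prop} (h : ∀ᵐ x ∂mu1, P x) : ∃ x ∈ Inj n j, P x := by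
  have hn : 1 ≤ n := Nat.succ_le_of_lt (Nat.zero_lt_of_lt j.2)
  have hn0 : (0:ℝ) < n := by exact_mod_cast hn
  have hsub : Inj n j ⊆ Icc 0 1 := by
    intro x hx
    have h2 : (((j:ℕ):ℝ) + 1) / n ≤ 1 := by
      rw [div_le_one hn0]; exact_mod_cast j.2
    have h1 : 0 ≤ ((j:ℕ):ℝ) / n := by positivity
    exact ⟨h1.trans hx.1.le, hx.2.le.trans h2⟩
  have hne : mu1 (Inj n j) ≠ 0 := by
    rw [Measure.restrict_apply (show MeasurableSet (Inj n j) from measurableSet_Ioo), inter_eq_left.2 hsub]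
    unfold Inj
    rw [Real.volume_Ioo, ← sub_div]
    simp [hn]
    omega
  have := ((frequently_ae_mem_iff.2 hne).and_eventually h).exists
  exact this

/-- clamp -/
def cl (a b t : ℝ) : ℝ := max a (min b t)

lemma cl_mem {a b : ℝ} (h : a ≤ b) (t : ℝ) : cl a b t ∈ Icc a b :=
  ⟨le_max_left _ _, max_le h (min_le_left _ _)⟩

lemma cl_eq {a b t : ℝ} (h : t ∈ Icc a b) : cl a b t = t := by
  unfold cl; rw [min_eq_right h.2, max_eq_right h.1]

lemma cl_cont (a b : ℝ) : Continuous (cl a b) := continuous_const.max (continuous_const.min continuous_id)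

lemma cl_meas {X : Type*} [MeasurableSpace X] (a b : ℝ) {f : X → ℝ} (hf : Measurable f) :
    Measurable (fun x => cl a b (f x)) := (cl_cont a b).measurable.comp hf

lemma clean {T M : ℝ} (hT : 0 < T) (hM : 0 < M) {n : ℕ} (hn : 1 ≤ n) {A : Fin n → Fin n → ℝ → ℝ}
    (hAm : ∀ j k, Measurable (A j k))
    (hAb : ∃ C : ℝ, ∀ (j k : Fin n), ∀ᵐ t ∂(muT T), |A j k t| ≤ C)
    (hA0 : ∀ (j k : Fin n), ∀ᵐ t ∂(muT T), 0 ≤ A j k t)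
    {β γ : Fin n → ℝ → ℝ} (hβm : ∀ j, Measurable (β j)) (hγm : ∀ j, Measurable (γ j))
    (hβγM : ∀ᵐ p ∂(mu2 T),
      0 ≤ stepFn n (fun k => β k p.1) p.2 ∧ stepFn n (fun k => β k p.1) p.2 ≤ M ∧
      0 ≤ stepFn n (fun k => γ k p.1) p.2 ∧ stepFn n (fun k => γ k p.1) p.2 ≤ M)
    {s i r : Fin n → ℝ → ℝ} (hsol : IsGraphSIRSol n (Set.Icc 0 T) β γ A s i r)
    (hinit : ∀ (j : Fin n),
      0 ≤ s j 0 ∧ s j 0 ≤ 1 ∧ 0 ≤ i j 0 ∧ i j 0 ≤ 1 ∧ 0 ≤ r j 0 ∧ r j 0 ≤ 1 ∧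
      s j 0 + i j 0 + r j 0 = 1) :
    ∃ (S I R B G : ℝ → ℝ → ℝ) (w : ℝ → ℝ → ℝ → ℝ) (S0 I0 R0 : ℝ → ℝ),
      Approx T M S I R B G w S0 I0 R0 ∧
      (∀ᵐ p ∂(mu2 T), S p.1 p.2 = stepFn n (fun k => s k p.1) p.2) ∧
      (∀ᵐ p ∂(mu2 T), I p.1 p.2 = stepFn n (fun k => i k p.1) p.2) ∧
      (∀ᵐ p ∂(mu2 T), R p.1 p.2 = stepFn n (fun k => r k p.1) p.2) ∧
      (∀ᵐ p ∂(mu2 T), B p.1 p.2 = stepFn n (fun k => β k p.1) p.2) ∧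
      (∀ᵐ p ∂(mu2 T), G p.1 p.2 = stepFn n (fun k => γ k p.1) p.2) ∧
      (∀ᵐ t ∂(muT T), ∀ x y, w t x y = stepKer n (fun j k => A j k t) x y) := by
  obtain ⟨C, hC⟩ := hAb
  have hin : ∀ᵐ t ∂(muT T), t ∈ Icc 0 T := ae_restrict_mem measurableSet_Icc
  have aA : ∀ᵐ t ∂(muT T), ∀ j k, cl 0 (max C 0) (A j k t) = A j k t := by
    have h1 := ae_all_iff.2 fun j => ae_all_iff.2 fun k => hC j k
    have h2 := ae_all_iff.2 fun j => ae_all_iff.2 fun k => hA0 j k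
    filter_upwards [h1, h2] with t a b j k
    exact cl_eq ⟨b j k, ((le_abs_self _).trans (a j k)).trans (le_max_left _ _)⟩
  have aβγ : ∀ᵐ t ∂(muT T), ∀ k, cl 0 M (β k t) = β k t ∧ cl 0 M (γ k t) = γ k t := by
    filter_upwards [Measure.ae_ae_of_ae_prod hβγM] with t ht k
    obtain ⟨x, hx, h⟩ := exists_inj k ht
    simp only [stepFn_in hx] at h
    exact ⟨cl_eq ⟨h.1, h.2.1⟩, cl_eq ⟨h.2.2.1, h.2.2.2⟩⟩
  have all : ∀ᵐ t, t ∈ Icc 0 T → (∀ j k, cl 0 (max C 0) (A j k t) = A j k t) ∧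
      ∀ k, cl 0 M (β k t) = β k t ∧ cl 0 M (γ k t) = γ k t :=
    (ae_restrict_iff' measurableSet_Icc).1 (aA.and aβγ)
  have hcl0 : cl 0 T 0 = 0 := cl_eq ⟨le_refl _, hT.le⟩
  have ccont : ∀ f : ℝ → ℝ, ContinuousOn f (Icc 0 T) → Continuous (fun t => f (cl 0 T t)) := fun f hf =>
    hf.comp_continuous (cl_cont 0 T) (cl_mem hT.le)
  have cs := fun j => ccont _ (hsol.1 j).1
  have ci := fun j => ccont _ (hsol.1 j).2.1
  have cr := fun j => ccont _ (hsol.1 j).2.2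
  have bβ : ∀ k t, 0 ≤ cl 0 M (β k t) ∧ cl 0 M (β k t) ≤ M := fun k t => cl_mem hM.le _
  have bγ : ∀ k t, 0 ≤ cl 0 M (γ k t) ∧ cl 0 M (γ k t) ≤ M := fun k t => cl_mem hM.le _
  have bA : ∀ j k t, 0 ≤ cl 0 (max C 0) (A j k t) ∧ cl 0 (max C 0) (A j k t) ≤ max C 0 :=
    fun j k t => cl_mem (le_max_right _ _) _
  have sub : ∀ {t τ : ℝ}, t ∈ Icc 0 T → τ ∈ uIoc 0 t → τ ∈ Icc 0 T := by
    intro t τ ht hτ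
    rw [uIoc_of_le ht.1] at hτ
    exact ⟨hτ.1.le, hτ.2.trans ht.2⟩
  have es : ∀ j, ∀ t ∈ Icc 0 T, s j (cl 0 T t) = s j (cl 0 T 0) + ∫ τ in (0:ℝ)..t,
        -(s j (cl 0 T τ) * (1 / (n : ℝ) * ∑ k : Fin n, cl 0 M (β k τ) * cl 0 (max C 0) (A j k τ) * i k (cl 0 T τ))) := by
    intro j t ht
    rw [cl_eq ht, hcl0, (hsol.2 j t ht).1, intervalIntegral.integral_neg, sub_eq_add_neg]
    congr 2
    refine intervalIntegral.integral_congr_ae ?_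
    filter_upwards [all] with τ hτ h1
    obtain ⟨q1, q2⟩ := hτ (sub ht h1)
    simp only [cl_eq (sub ht h1), q1, (q2 _).1]
  have ei : ∀ j, ∀ t ∈ Icc 0 T, i j (cl 0 T t) = i j (cl 0 T 0) + ∫ τ in (0:ℝ)..t,
        (s j (cl 0 T τ) * (1 / (n : ℝ) * ∑ k : Fin n, cl 0 M (β k τ) * cl 0 (max C 0) (A j k τ) * i k (cl 0 T τ))
          - cl 0 M (γ j τ) * i j (cl 0 T τ)) := by
    intro j t ht
    rw [cl_eq ht, hcl0, (hsol.2 j t ht).2.1]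
    congr 1
    refine intervalIntegral.integral_congr_ae ?_
    filter_upwards [all] with τ hτ h1
    obtain ⟨q1, q2⟩ := hτ (sub ht h1)
    simp only [cl_eq (sub ht h1), q1, (q2 _).1, (q2 _).2]
  have er : ∀ j, ∀ t ∈ Icc 0 T, r j (cl 0 T t) = r j (cl 0 T 0) + ∫ τ in (0:ℝ)..t,
        cl 0 M (γ j τ) * i j (cl 0 T τ) := by
    intro j t ht
    rw [cl_eq ht, hcl0, (hsol.2 j t ht).2.2]
    congr 1
    refine intervalIntegral.integral_congr_ae ?_
    filter_upwards [all] with τ hτ h1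
    obtain ⟨q1, q2⟩ := hτ (sub ht h1)
    simp only [cl_eq (sub ht h1), (q2 _).2]
  obtain ⟨f1, f2, f3, f4⟩ := graph_facts hn hT (fun k => cl_meas 0 M (hβm k)) (fun k => cl_meas 0 M (hγm k))
    (fun j k => cl_meas 0 (max C 0) (hAm j k)) bβ bγ bA (s := fun j t => s j (cl 0 T t))
    (i := fun j t => i j (cl 0 T t)) (r := fun j t => r j (cl 0 T t)) cs ci es ei er
    (fun j => by simp only [hcl0]; exact (hinit j).1) 
    (fun j => by simp only [hcl0]; exact (hinit j).2.2.1)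
    (fun j => by simp only [hcl0]; exact (hinit j).2.2.2.2.1)
    (fun j => by simp only [hcl0]; exact (hinit j).2.2.2.2.2.2)
  have cc : ∀ t, cl 0 T (cl 0 T t) = cl 0 T t := fun t => cl_eq (cl_mem hT.le t)
  have g1 : ∀ j t, 0 ≤ s j (cl 0 T t) := fun j t => by
    have := f1 j (cl 0 T t) (cl_mem hT.le t); simpa only [cc] using this
  have g2 : ∀ j t, 0 ≤ i j (cl 0 T t) := fun j t => by
    have := f2 j (cl 0 T t) (cl_mem hT.le t); simpa only [cc] using this
  have g3 : ∀ j t, 0 ≤ r j (cl 0 T t) := fun j t => by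
    have := f3 j (cl 0 T t) (cl_mem hT.le t); simpa only [cc] using this
  have g4 : ∀ j t, s j (cl 0 T t) + i j (cl 0 T t) + r j (cl 0 T t) = 1 := fun j t => by
    have := f4 j (cl 0 T t) (cl_mem hT.le t); simpa only [cc] using this
  have fst_ae : ∀ {P : ℝ → Prop}, (∀ᵐ t ∂(muT T), P t) → ∀ᵐ p ∂(mu2 T), P p.1 := fun h =>
    Measure.quasiMeasurePreserving_fst.ae h
  refine ⟨_, _, _, _, _, _, _, _, _, approx_of hn hM (le_max_right C 0) (fun k => cl_meas 0 M (hβm k)) (fun k => cl_meas 0 M (hγm k))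
    (fun j k => cl_meas 0 (max C 0) (hAm j k)) bβ bγ bA (s := fun j t => s j (cl 0 T t))
    (i := fun j t => i j (cl 0 T t)) (r := fun j t => r j (cl 0 T t)) cs ci cr es ei er
    (fun j t => ⟨g1 j t, by linarith [g1 j t, g2 j t, g3 j t, g4 j t]⟩)
    (fun j t => ⟨g2 j t, by linarith [g1 j t, g2 j t, g3 j t, g4 j t]⟩)
    (fun j t => ⟨g3 j t, by linarith [g1 j t, g2 j t, g3 j t, g4 j t]⟩) g4, ?_, ?_, ?_, ?_, ?_, ?_⟩
  · filter_upwards [fst_ae hin] with p hp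
    simp only [cl_eq hp]
  · filter_upwards [fst_ae hin] with p hp
    simp only [cl_eq hp]
  · filter_upwards [fst_ae hin] with p hp
    simp only [cl_eq hp]
  · filter_upwards [fst_ae aβγ] with p hp
    simp only [(hp _).1]
  · filter_upwards [fst_ae aβγ] with p hp
    simp only [(hp _).2]
  · filter_upwards [aA] with t ht x y
    simp only [ht]

end

/-- convergence of the graph SIR systems to the continuum SIR system
(Theorem 1.2). -/
theorem graphSIR_convergence
    (T : ℝ) (hT : 0 < T)
    -- the sequence of (time-dependent, symmetric, nonnegative, bounded) adjacency matrices
    (A : (n : ℕ) → Fin n → Fin n → ℝ → ℝ)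
    (hAm : ∀ n j k, Measurable (A n j k))
    (hAb : ∀ n, ∃ C : ℝ, ∀ (j k : Fin n),
      ∀ᵐ t ∂(volume.restrict (Set.Icc 0 T)), |A n j k t| ≤ C)
    (hAsym : ∀ n (j k : Fin n), ∀ᵐ t ∂(volume.restrict (Set.Icc 0 T)),
      A n j k t = A n k j t ∧ 0 ≤ A n j k t)
    -- the limit kernel W
    (W : ℝ → ℝ → ℝ → ℝ)
    (hWmeas : Measurable (fun p : ℝ × ℝ × ℝ => W p.1 p.2.1 p.2.2))
    (hWL1 : IntegrableOn (fun p : ℝ × ℝ × ℝ => W p.1 p.2.1 p.2.2)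
      (Set.Icc 0 T ×ˢ Set.Icc (0:ℝ) 1 ×ˢ Set.Icc (0:ℝ) 1))
    (hWsym : ∀ᵐ p ∂((volume : Measure (ℝ × ℝ × ℝ)).restrict
      (Set.Icc 0 T ×ˢ Set.Icc (0:ℝ) 1 ×ˢ Set.Icc (0:ℝ) 1)),
      W p.1 p.2.1 p.2.2 = W p.1 p.2.2 p.2.1)
    -- convergence of the step graphons to W in the (time-integrated) cut norm
    (hcut : Tendsto (fun n => ∫ t in Set.Icc 0 T,
      cutNorm (fun x y => stepKer n (fun j k => A n j k t) x y - W t x y)) atTop (nhds 0))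
    -- either a uniform L² bound or a uniform degree bound on the step graphons
    (hbd : (∃ K₀ : ℝ, 0 < K₀ ∧ ∀ n : ℕ,
        Real.sqrt (∫ t in Set.Icc 0 T, ∫ x in Set.Icc (0:ℝ) 1, ∫ y in Set.Icc (0:ℝ) 1,
          (stepKer n (fun j k => A n j k t) x y) ^ 2) ≤ K₀) ∨
      (∃ K₁ : ℝ, 0 < K₁ ∧ ∀ n : ℕ,
        essSup (fun p : ℝ × ℝ => ∫ y in Set.Icc (0:ℝ) 1,
            stepKer n (fun j k => A n j k p.1) p.2 y)
          ((volume : Measure (ℝ × ℝ)).restrict (Set.Icc 0 T ×ˢ Set.Icc (0:ℝ) 1)) ≤ K₁))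
    -- the discrete coefficients and their limits
    (βc γc : (n : ℕ) → Fin n → ℝ → ℝ)
    (hβcm : ∀ n j, Measurable (βc n j)) (hγcm : ∀ n j, Measurable (γc n j))
    (β γ : ℝ → ℝ → ℝ)
    (hβm : Measurable (fun p : ℝ × ℝ => β p.1 p.2))
    (hγm : Measurable (fun p : ℝ × ℝ => γ p.1 p.2))
    (hβb : ∃ C : ℝ, ∀ᵐ p ∂((volume : Measure (ℝ × ℝ)).restrict
      (Set.Icc 0 T ×ˢ Set.Icc (0:ℝ) 1)), |β p.1 p.2| ≤ C)
    (hγb : ∃ C : ℝ, ∀ᵐ p ∂((volume : Measure (ℝ × ℝ)).restrict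
      (Set.Icc 0 T ×ˢ Set.Icc (0:ℝ) 1)), |γ p.1 p.2| ≤ C)
    (M : ℝ) (hM : 0 < M)
    (hβγM : ∀ n : ℕ, ∀ᵐ p ∂((volume : Measure (ℝ × ℝ)).restrict
      (Set.Icc 0 T ×ˢ Set.Icc (0:ℝ) 1)),
      0 ≤ stepFn n (fun k => βc n k p.1) p.2 ∧ stepFn n (fun k => βc n k p.1) p.2 ≤ M ∧
      0 ≤ stepFn n (fun k => γc n k p.1) p.2 ∧ stepFn n (fun k => γc n k p.1) p.2 ≤ M)
    (hβL1 : Tendsto (fun n => ∫ p in (Set.Icc 0 T ×ˢ Set.Icc (0:ℝ) 1),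
      |stepFn n (fun k => βc n k p.1) p.2 - β p.1 p.2|
        ∂(volume : Measure (ℝ × ℝ))) atTop (nhds 0))
    (hγL1 : Tendsto (fun n => ∫ p in (Set.Icc 0 T ×ˢ Set.Icc (0:ℝ) 1),
      |stepFn n (fun k => γc n k p.1) p.2 - γ p.1 p.2|
        ∂(volume : Measure (ℝ × ℝ))) atTop (nhds 0))
    -- the solutions of the graph SIR systems
    (s i r : (n : ℕ) → Fin n → ℝ → ℝ)
    (hsol : ∀ n, IsGraphSIRSol n (Set.Icc 0 T) (βc n) (γc n) (A n) (s n) (i n) (r n))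
    (hinit : ∀ n (j : Fin n),
      0 ≤ s n j 0 ∧ s n j 0 ≤ 1 ∧ 0 ≤ i n j 0 ∧ i n j 0 ≤ 1 ∧ 0 ≤ r n j 0 ∧ r n j 0 ≤ 1 ∧
      s n j 0 + i n j 0 + r n j 0 = 1) :
    -- conclusion: a subsequence converges weakly* to a distributional solution
    ∃ φ : ℕ → ℕ, StrictMono φ ∧
    ∃ s0 i0 r0 : ℝ → ℝ, Measurable s0 ∧ Measurable i0 ∧ Measurable r0 ∧
      (∀ᵐ x ∂(volume.restrict (Set.Icc (0:ℝ) 1)),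
        0 ≤ s0 x ∧ s0 x ≤ 1 ∧ 0 ≤ i0 x ∧ i0 x ≤ 1 ∧ 0 ≤ r0 x ∧ r0 x ≤ 1 ∧
        s0 x + i0 x + r0 x = 1) ∧
    ∃ sl il rl : ℝ → ℝ → ℝ,
      IsDistribSol T W β γ s0 i0 r0 sl il rl ∧
      (∀ᵐ p ∂((volume : Measure (ℝ × ℝ)).restrict (Set.Icc 0 T ×ˢ Set.Icc (0:ℝ) 1)),
        0 ≤ sl p.1 p.2 ∧ sl p.1 p.2 ≤ 1 ∧ 0 ≤ il p.1 p.2 ∧ il p.1 p.2 ≤ 1 ∧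
        0 ≤ rl p.1 p.2 ∧ rl p.1 p.2 ≤ 1 ∧ sl p.1 p.2 + il p.1 p.2 + rl p.1 p.2 = 1) ∧
      -- weak* convergence in L^∞([0,T]×[0,1]) of the step-function solutions
      (∀ g : ℝ → ℝ → ℝ,
        IntegrableOn (fun p : ℝ × ℝ => g p.1 p.2) (Set.Icc 0 T ×ˢ Set.Icc (0:ℝ) 1) →
        Tendsto (fun m => ∫ p in (Set.Icc 0 T ×ˢ Set.Icc (0:ℝ) 1),
            stepFn (φ m) (fun j => s (φ m) j p.1) p.2 * g p.1 p.2 ∂(volume : Measure (ℝ × ℝ)))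
          atTop (nhds (∫ p in (Set.Icc 0 T ×ˢ Set.Icc (0:ℝ) 1),
            sl p.1 p.2 * g p.1 p.2 ∂(volume : Measure (ℝ × ℝ)))) ∧
        Tendsto (fun m => ∫ p in (Set.Icc 0 T ×ˢ Set.Icc (0:ℝ) 1),
            stepFn (φ m) (fun j => i (φ m) j p.1) p.2 * g p.1 p.2 ∂(volume : Measure (ℝ × ℝ)))
          atTop (nhds (∫ p in (Set.Icc 0 T ×ˢ Set.Icc (0:ℝ) 1),
            il p.1 p.2 * g p.1 p.2 ∂(volume : Measure (ℝ × ℝ)))) ∧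
        Tendsto (fun m => ∫ p in (Set.Icc 0 T ×ˢ Set.Icc (0:ℝ) 1),
            stepFn (φ m) (fun j => r (φ m) j p.1) p.2 * g p.1 p.2 ∂(volume : Measure (ℝ × ℝ)))
          atTop (nhds (∫ p in (Set.Icc 0 T ×ˢ Set.Icc (0:ℝ) 1),
            rl p.1 p.2 * g p.1 p.2 ∂(volume : Measure (ℝ × ℝ))))) := by
  classical
  have hn : ∀ n : ℕ, 1 ≤ n + 1 := fun n => Nat.le_add_left 1 n
  rw [IntegrableOn, ← mu3_eq] at hWL1
  simp only [← mu2_eq] at hβb hγb hβγM hβL1 hγL1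
  have hcl := fun n : ℕ => clean hT hM (hn n) (hAm (n+1)) (hAb (n+1))
    (fun j k => (hAsym (n+1) j k).mono fun t h => h.2) (hβcm (n+1)) (hγcm (n+1)) (hβγM (n+1))
    (hsol (n+1)) (hinit (n+1))
  choose S I R B G w S0 I0 R0 hap aS aI aR aB aG aw using hcl
  obtain ⟨Cβ, hCβ⟩ := hβb
  obtain ⟨Cγ, hCγ⟩ := hγb
  let D := max (max Cβ Cγ) 0
  have hD : -D ≤ D := by have : 0 ≤ D := le_max_right _ _; linarith
  have aβ : ∀ᵐ p ∂(mu2 T), cl (-D) D (β p.1 p.2) = β p.1 p.2 := by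
    filter_upwards [hCβ] with p hp
    have : |β p.1 p.2| ≤ D := hp.trans ((le_max_left _ _).trans (le_max_left _ _))
    exact cl_eq (abs_le.1 this)
  have aγ : ∀ᵐ p ∂(mu2 T), cl (-D) D (γ p.1 p.2) = γ p.1 p.2 := by
    filter_upwards [hCγ] with p hp
    have : |γ p.1 p.2| ≤ D := hp.trans ((le_max_right _ _).trans (le_max_left _ _))
    exact cl_eq (abs_le.1 this)
  have hcut' : Tendsto (fun n => ∫ τ, cutNorm (fun x y => w n τ x y - W τ x y) ∂(muT T)) atTop (nhds 0) := by
    refine (hcut.comp (tendsto_add_atTop_nat 1)).congr fun n => ?_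
    refine integral_congr_ae ?_
    filter_upwards [aw n] with t ht
    simp only [ht]
  have hβ' : Tendsto (fun n => ∫ p, |B n p.1 p.2 - cl (-D) D (β p.1 p.2)| ∂(mu2 T)) atTop (nhds 0) := by
    refine (hβL1.comp (tendsto_add_atTop_nat 1)).congr fun n => ?_
    refine integral_congr_ae ?_
    filter_upwards [aB n, aβ] with p h1 h2
    rw [h1, h2]
  have hγ' : Tendsto (fun n => ∫ p, |G n p.1 p.2 - cl (-D) D (γ p.1 p.2)| ∂(mu2 T)) atTop (nhds 0) := by
    refine (hγL1.comp (tendsto_add_atTop_nat 1)).congr fun n => ?_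
    refine integral_congr_ae ?_
    filter_upwards [aG n, aγ] with p h1 h2
    rw [h1, h2]
  obtain ⟨φ, hφ, s0, i0, r0, ms0, mi0, mr0, bs0, bi0, br0, hsum0, sl, il, rl, ms, mi, mr, bs, bi, br,
    hsum, cs, ci, cr, hH⟩ := core2 hT hM hap hWmeas hWL1 hcut' (β := fun t x => cl (-D) D (β t x))
    (γ := fun t x => cl (-D) D (γ t x)) (C := D) (cl_meas _ _ hβm) (cl_meas _ _ hγm)
    (fun t x => abs_le.2 (cl_mem hD _)) (fun t x => abs_le.2 (cl_mem hD _)) hβ' hγ'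
  have as := fun t x => abs_le_one_of (bs t x).1 (bs t x).2
  have ai := fun t x => abs_le_one_of (bi t x).1 (bi t x).2
  have ar := fun t x => abs_le_one_of (br t x).1 (br t x).2
  refine ⟨fun m => φ m + 1, fun a b hab => Nat.succ_lt_succ (hφ hab), s0, i0, r0, ms0, mi0, mr0, ?_,
    sl, il, rl, core3 (β' := fun t x => cl (-D) D (β t x)) (γ' := fun t x => cl (-D) D (γ t x)) aβ aγ ms mi mr as ai ar hH, ?_, ?_⟩
  · filter_upwards [hsum0] with x hx
    exact ⟨(bs0 x).1, (bs0 x).2, (bi0 x).1, (bi0 x).2, (br0 x).1, (br0 x).2, hx⟩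
  · rw [← mu2_eq]
    filter_upwards [hsum] with p hp
    exact ⟨(bs _ _).1, (bs _ _).2, (bi _ _).1, (bi _ _).2, (br _ _).1, (br _ _).2, hp⟩
  · intro g hg
    rw [IntegrableOn, ← mu2_eq] at hg
    simp only [← mu2_eq]
    refine ⟨?_, ?_, ?_⟩
    · refine (weak_ext (mu2 T) (fun n => unc (S (φ n))) (unc sl) 1 (fun n => (hap _).ms) ms
        (fun n p => abs_le_one_of ((hap _).s_b _ _).1 ((hap _).s_b _ _).2) (fun p => as _ _) cs
        (fun p => g p.1 p.2) hg).congr fun n => ?_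
      refine integral_congr_ae ?_
      filter_upwards [aS (φ n)] with p hp
      simp only [unc, hp]
    · refine (weak_ext (mu2 T) (fun n => unc (I (φ n))) (unc il) 1 (fun n => (hap _).mi) mi
        (fun n p => abs_le_one_of ((hap _).i_b _ _).1 ((hap _).i_b _ _).2) (fun p => ai _ _) ci
        (fun p => g p.1 p.2) hg).congr fun n => ?_
      refine integral_congr_ae ?_
      filter_upwards [aI (φ n)] with p hp
      simp only [unc, hp]
    · refine (weak_ext (mu2 T) (fun n => unc (R (φ n))) (unc rl) 1 (fun n => (hap _).mr) mr
        (fun n p => abs_le_one_of ((hap _).r_b _ _).1 ((hap _).r_b _ _).2) (fun p => ar _ _) cr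
        (fun p => g p.1 p.2) hg).congr fun n => ?_
      refine integral_congr_ae ?_
      filter_upwards [aR (φ n)] with p hp
      simp only [unc, hp]

end
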